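/- The following are equivalent: (1) SRP^L(ω₂); (2) ω₂ is a limit cardinal in L and SRP^L(γ) holds for every L-cardinal γ with ω₁ ≤ γ < ω₂; (3) the set {α < ω₂ : α is an L-cardinal and SRP^L(α) holds} is unbounded in ω₂. -/

import Mathlib

/-!
Common set-theoretic infrastructure for formalizing the paper
"The strong reflecting property and Harrington's Principle".

We work over Mathlib's `ZFSet.{0}` (a model of ZFC).  First-order satisfaction
for the language of set theory (with two auxiliary unary predicates) is
defined directly; Gödel's constructible hierarchy `L` (and its relativized
versions `L[A]`), hereditarily-small sets `H_κ`, transitive collapses,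
clubs, elementary submodels, admissible ordinals, and the various
reflecting properties are all defined from first principles.
-/

noncomputable section
attribute [local instance] Classical.propDecidable
namespace SRPPaper

open ZFSet

/-- Image of a `ZFSet.{0}` under an arbitrary (classically definable) function. -/
def img (f : ZFSet.{0} → ZFSet.{0}) : ZFSet.{0} → ZFSet.{0} :=
  @ZFSet.image f (Classical.allZFSetDefinable _)

/-! ### First-order formulas and satisfaction -/

/-- First-order formulas in the language `{∈, =, A, B}` where `A`, `B` are
unary predicate symbols; variables are de Bruijn-style indices in `Fin n`. -/
inductive Fml : ℕ → Type
  | mem {n} (i j : Fin n) : Fml n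
  | eq {n} (i j : Fin n) : Fml n
  | inA {n} (i : Fin n) : Fml n
  | inB {n} (i : Fin n) : Fml n
  | not {n} : Fml n → Fml n
  | and {n} : Fml n → Fml n → Fml n
  | ex {n} : Fml (n + 1) → Fml n

/-- Satisfaction over the structure `(S, ∈, A, B)`; quantifiers range over `S`,
the new variable of `ex` gets index `0`. -/
def SatAB (S A B : Set ZFSet.{0}) : ∀ {n}, Fml n → (Fin n → ZFSet.{0}) → Prop
  | _, .mem i j, v => v i ∈ v j
  | _, .eq i j, v => v i = v j
  | _, .inA i, v => v i ∈ A
  | _, .inB i, v => v i ∈ B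
  | _, .not φ, v => ¬ SatAB S A B φ v
  | _, .and φ ψ, v => SatAB S A B φ v ∧ SatAB S A B ψ v
  | _, .ex φ, v => ∃ x ∈ S, SatAB S A B φ (Fin.cons x v)

/-- Pure `∈`-satisfaction over the structure `(S, ∈)`. -/
def Sat (S : Set ZFSet.{0}) {n} (φ : Fml n) (v : Fin n → ZFSet.{0}) : Prop :=
  SatAB S ∅ ∅ φ v

/-- Δ₀ (bounded) formulas. -/
inductive IsDelta0 : ∀ {n}, Fml n → Prop
  | mem {n} (i j : Fin n) : IsDelta0 (.mem i j)
  | eq {n} (i j : Fin n) : IsDelta0 (.eq i j)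
  | inA {n} (i : Fin n) : IsDelta0 (.inA i)
  | inB {n} (i : Fin n) : IsDelta0 (.inB i)
  | not {n} {φ : Fml n} : IsDelta0 φ → IsDelta0 (.not φ)
  | and {n} {φ ψ : Fml n} : IsDelta0 φ → IsDelta0 ψ → IsDelta0 (.and φ ψ)
  | bex {n} (j : Fin (n + 1)) {φ : Fml (n + 1)} : j ≠ 0 → IsDelta0 φ →
      IsDelta0 (.ex (.and (.mem 0 j) φ))

/-- A Gödel code for formulas. -/
def codeF : ∀ {n}, Fml n → ℕ
  | _, .mem i j => Nat.pair 0 (Nat.pair i.val j.val)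
  | _, .eq i j => Nat.pair 1 (Nat.pair i.val j.val)
  | _, .inA i => Nat.pair 2 i.val
  | _, .inB i => Nat.pair 3 i.val
  | _, .not φ => Nat.pair 4 (codeF φ)
  | _, .and φ ψ => Nat.pair 5 (Nat.pair (codeF φ) (codeF ψ))
  | _, .ex φ => Nat.pair 6 (codeF φ)

/-! ### Ordinals, von Neumann naturals -/

/-- `x` is a (von Neumann) ordinal: a transitive set of transitive sets. -/
def IsOrd (x : ZFSet.{0}) : Prop :=
  x.IsTransitive ∧ ∀ y ∈ x, ZFSet.IsTransitive y

/-- `x` is a limit ordinal. -/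
def IsLimitOrd (x : ZFSet.{0}) : Prop :=
  IsOrd x ∧ x ≠ ∅ ∧ ∀ y ∈ x, ∃ z ∈ x, y ∈ z

/-- The `n`-th von Neumann natural number. -/
def natZ : ℕ → ZFSet.{0}
  | 0 => ∅
  | n + 1 => insert (natZ n) (natZ n)

/-- Decoding of von Neumann naturals. -/
def zfToNat (x : ZFSet.{0}) : ℕ :=
  if h : ∃ n : ℕ, natZ n = x then h.choose else 0

/-! ### Coded functions, products -/

/-- The cartesian product of two `ZFSet.{0}`s (as a set of Kuratowski pairs). -/
def prodZ (a b : ZFSet.{0}) : ZFSet.{0} :=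
  ZFSet.sep (fun z => ∃ x, x ∈ a ∧ ∃ y, y ∈ b ∧ z = ZFSet.pair x y)
    (ZFSet.powerset (ZFSet.powerset (a ∪ b)))

/-- `f` codes a surjection from `a` onto `b`. -/
def IsSurjF (a b f : ZFSet.{0}) : Prop :=
  ZFSet.IsFunc a b f ∧ ∀ y, y ∈ b → ∃ x, x ∈ a ∧ ZFSet.pair x y ∈ f

/-- `f` codes an injection from `a` into `b`. -/
def IsInjF (a b f : ZFSet.{0}) : Prop :=
  ZFSet.IsFunc a b f ∧
    ∀ x₁, x₁ ∈ a → ∀ x₂, x₂ ∈ a → ∀ y, ZFSet.pair x₁ y ∈ f → ZFSet.pair x₂ y ∈ f → x₁ = x₂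

/-- The set of values of a coded function `f`. -/
def imageOf (f : ZFSet.{0}) : ZFSet.{0} :=
  ZFSet.sep (fun y => ∃ x, ZFSet.pair x y ∈ f) (ZFSet.sUnion (ZFSet.sUnion f))

/-! ### Cardinals (in `V`) -/

/-- `x` and `y` are equinumerous. -/
def EqNum (x y : ZFSet.{0}) : Prop := Nonempty (x.toSet ≃ y.toSet)

/-- `|x| ≤ |y|`. -/
def CardLE (x y : ZFSet.{0}) : Prop := Nonempty (x.toSet ↪ y.toSet)

/-- `|x| < κ`, for `κ` a cardinal: `x` injects into some member of `κ`. -/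
def CardLT (x κ : ZFSet.{0}) : Prop := ∃ α, α ∈ κ ∧ CardLE x α

/-- `κ` is a cardinal (of `V`). -/
def IsCard (κ : ZFSet.{0}) : Prop := IsOrd κ ∧ ∀ α ∈ κ, ¬ EqNum α κ

/-- `x` is unbounded (cofinal) in the ordinal `κ`. -/
def UnbIn (x κ : ZFSet.{0}) : Prop := ∀ β ∈ κ, ∃ γ ∈ x, β ∈ γ ∨ β = γ

/-- `κ` is a regular cardinal: every cofinal subset of `κ` has size `κ`. -/
def IsRegular (κ : ZFSet.{0}) : Prop :=
  IsCard κ ∧ ∀ x : ZFSet.{0}, x ⊆ κ → UnbIn x κ → EqNum x κ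

/-- The least ordinal satisfying `p` (junk value `∅` if there is none). -/
def leastOrd (p : ZFSet.{0} → Prop) : ZFSet.{0} :=
  if h : ∃ α, (IsOrd α ∧ p α) ∧ ∀ β ∈ α, ¬ (IsOrd β ∧ p β) then h.choose else ∅

/-- The cardinal `ℵₙ` of `V` (`Aleph 0 = ω`). -/
def Aleph : ℕ → ZFSet.{0}
  | 0 => ZFSet.omega
  | n + 1 => leastOrd (fun κ => IsCard κ ∧ Aleph n ∈ κ)

/-- The cardinal successor (in `V`) of `κ`. -/
def SuccCard (κ : ZFSet.{0}) : ZFSet.{0} := leastOrd (fun α => IsCard α ∧ κ ∈ α)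

/-- `X` is countable. -/
def Ctbl (X : ZFSet.{0}) : Prop := X.toSet.Countable

/-- `|X| = ω`: `X` is countably infinite. -/
def CtblInf (X : ZFSet.{0}) : Prop := X.toSet.Countable ∧ X.toSet.Infinite

/-! ### `H_κ`, elementary submodels, transitive collapse -/

/-- The class `H_κ` of sets hereditarily of cardinality `< κ`. -/
def Hset (κ : ZFSet.{0}) : Set ZFSet.{0} :=
  {x | ∃ t : ZFSet.{0}, t.IsTransitive ∧ x ∈ t ∧ CardLT t κ}

/-- `X ≺ S`: `X` is an elementary submodel of the class `(S, ∈)`. -/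
def ElemSub (X : ZFSet.{0}) (S : Set ZFSet.{0}) : Prop :=
  X.toSet ⊆ S ∧ ∀ {n : ℕ} (φ : Fml n) (v : Fin n → ZFSet.{0}),
    (∀ i, v i ∈ X) → (Sat X.toSet φ v ↔ Sat S φ v)

/-- The transitive-collapse map of (the ∈-structure on) `X`:
`collapse X y = {collapse X z | z ∈ y ∩ X}`.  For `γ ∈ X`, `collapse X γ` is
the image `γ̄` of `γ` under the transitive collapse of `X`. -/
def collapse (X : ZFSet.{0}) : ZFSet.{0} → ZFSet.{0} :=
  ZFSet.mem_wf.fix (C := fun _ => ZFSet.{0}) fun y ih =>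
    img (fun z => if h : z ∈ y then ih z h else ∅) (ZFSet.sep (fun z => z ∈ X) y)

/-- The transitive collapse of `X` (as a set). -/
def collapseSet (X : ZFSet.{0}) : ZFSet.{0} := img (fun y => collapse X y) X

/-- The transitive closure of (the members of) `x`. -/
def tcl : ZFSet.{0} → ZFSet.{0} :=
  ZFSet.mem_wf.fix (C := fun _ => ZFSet.{0}) fun x ih =>
    x ∪ ZFSet.sUnion (img (fun y => if h : y ∈ x then ih y h else ∅) x)

/-- The (von Neumann) rank of a set, as an ordinal `ZFSet.{0}`. -/
def rankZ : ZFSet.{0} → ZFSet.{0} :=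
  ZFSet.mem_wf.fix (C := fun _ => ZFSet.{0}) fun x ih =>
    ZFSet.sUnion (img (fun y => if h : y ∈ x then insert (ih y h) (ih y h) else ∅) x)

/-- The order type of a set `X` of ordinals: the unique ordinal `α` such that
`(X, ∈) ≅ (α, ∈)` (junk value `∅` if there is none). -/
def otype (X : ZFSet.{0}) : ZFSet.{0} :=
  if h : ∃ α, IsOrd α ∧ ∃ e : X.toSet ≃ α.toSet,
      ∀ a b : X.toSet, (a : ZFSet.{0}) ∈ (b : ZFSet.{0}) ↔ ((e a : ZFSet.{0}) ∈ (e b : ZFSet.{0}))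
  then h.choose else ∅

/-! ### The constructible hierarchy (relative to a predicate) -/

/-- The set of subsets of `X` definable over `(X, ∈, A)` with parameters. -/
def DefSetA (A : Set ZFSet.{0}) (X : ZFSet.{0}) : ZFSet.{0} :=
  ZFSet.sep (fun B => ∃ (n : ℕ) (φ : Fml (n + 1)) (v : Fin n → ZFSet.{0}),
      (∀ i, v i ∈ X) ∧ B = ZFSet.sep (fun z => SatAB X.toSet A ∅ φ (Fin.cons z v)) X)
    (ZFSet.powerset X)

/-- The hierarchy `L_α[A]`: `LstageA A α = ⋃_{β ∈ α} Def_A (LstageA A β)`. -/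
def LstageA (A : Set ZFSet.{0}) : ZFSet.{0} → ZFSet.{0} :=
  ZFSet.mem_wf.fix (C := fun _ => ZFSet.{0}) fun α ih =>
    ZFSet.sUnion (img (fun β => if h : β ∈ α then DefSetA A (ih β h) else ∅) α)

/-- Gödel's hierarchy `L_α`. -/
def Lstage : ZFSet.{0} → ZFSet.{0} := LstageA ∅

/-- The constructible universe `L`, as a class. -/
def LClass : Set ZFSet.{0} := {x | ∃ α, IsOrd α ∧ x ∈ Lstage α}

/-- The class `L[A]`, for a set `A`. -/
def LrelClass (A : ZFSet.{0}) : Set ZFSet.{0} := {x | ∃ α, IsOrd α ∧ x ∈ LstageA A.toSet α}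

/-- The constructible universe as computed inside a transitive (set or class)
model `W`: the union of the `L_α` for `α` an ordinal of `W`. -/
def LClassIn (W : Set ZFSet.{0}) : Set ZFSet.{0} :=
  {x | ∃ α, IsOrd α ∧ α ∈ W ∧ x ∈ Lstage α}

/-- `κ` is a cardinal in the (transitive) class `W`:
no coded surjection lying in `W` maps some `α < κ` onto `κ`. -/
def CardIn (W : Set ZFSet.{0}) (κ : ZFSet.{0}) : Prop :=
  IsOrd κ ∧ ∀ α, α ∈ κ → ∀ f, f ∈ W → ¬ IsSurjF α κ f

/-- `κ` is an `L`-cardinal. -/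
def LCard (κ : ZFSet.{0}) : Prop := CardIn LClass κ

/-! ### Clubs and stationarity on `[S]^ω` and on `κ` -/

/-- The union of an `ℕ`-indexed family of `ZFSet.{0}`s. -/
def seqUnion (f : ℕ → ZFSet.{0}) : ZFSet.{0} :=
  ZFSet.sUnion (img (fun m => f (zfToNat m)) ZFSet.omega)

/-- `C` is a club of countable subsets of `S`: every member is a countable
subset of `S`, `C` is `⊆`-cofinal in the countable subsets of `S`, and `C` is
closed under unions of countable increasing chains. -/
def ClubSub (S : Set ZFSet.{0}) (C : Set ZFSet.{0}) : Prop :=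
  (∀ X ∈ C, (X : ZFSet.{0}).toSet ⊆ S ∧ CtblInf X) ∧
  (∀ X : ZFSet.{0}, X.toSet ⊆ S → CtblInf X → ∃ Y ∈ C, X ⊆ Y) ∧
  (∀ f : ℕ → ZFSet.{0}, (∀ n, f n ∈ C) → (∀ n, f n ⊆ f (n + 1)) → seqUnion f ∈ C)

/-- `C` is stationary in `[S]^ω`: it meets every club of countable subsets. -/
def StatSub (S : Set ZFSet.{0}) (C : Set ZFSet.{0}) : Prop :=
  ∀ D : Set ZFSet.{0}, ClubSub S D → ∃ X, X ∈ C ∧ X ∈ D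

/-- `D` is a club (closed unbounded set) in the ordinal `κ`. -/
def ClubIn (κ D : ZFSet.{0}) : Prop :=
  D ⊆ κ ∧ (∀ β ∈ κ, ∃ θ, θ ∈ D ∧ β ∈ θ) ∧
  ∀ α, α ∈ κ → α ≠ ∅ → (∀ β ∈ α, ∃ θ, θ ∈ D ∧ θ ∈ α ∧ (β ∈ θ ∨ β = θ)) → α ∈ D

/-- `D` is stationary in the ordinal `κ`. -/
def StatIn (κ D : ZFSet.{0}) : Prop :=
  D ⊆ κ ∧ ∀ C : ZFSet.{0}, ClubIn κ C → ∃ θ, θ ∈ D ∧ θ ∈ C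

/-! ### The strong and weak reflecting properties -/

/-- `SRP^M(γ)` for an inner model given as a class `W`:  for some regular
cardinal `κ > γ`, whenever `X ≺ H_κ` is countable with `γ ∈ X`, the image of
`γ` under the transitive collapse of `X` is a cardinal of `W`. -/
def SRPclass (W : Set ZFSet.{0}) (γ : ZFSet.{0}) : Prop :=
  ∃ κ, IsRegular κ ∧ γ ∈ κ ∧
    ∀ X : ZFSet.{0}, ElemSub X (Hset κ) → CtblInf X → γ ∈ X → CardIn W (collapse X γ)

/-- `SRP^L(γ)`: the strong reflecting property for `L`-cardinals. -/
def SRPL (γ : ZFSet.{0}) : Prop := SRPclass LClass γ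

/-- `WRP^L(γ)`: the weak reflecting property for `L`-cardinals. -/
def WRPL (γ : ZFSet.{0}) : Prop :=
  ∃ κ, IsRegular κ ∧ γ ∈ κ ∧
    ∃ X : ZFSet.{0}, ElemSub X (Hset κ) ∧ CtblInf X ∧ γ ∈ X ∧ LCard (collapse X γ)

/-- `SRP^M_{<λ}(λ)`: for some regular `θ > λ`, every `X ≺ H_θ` with `|X| < λ`
and `λ ∈ X` collapses `λ` to a `W`-cardinal. -/
def SRPlt (W : Set ZFSet.{0}) (lam : ZFSet.{0}) : Prop :=
  ∃ θ, IsRegular θ ∧ lam ∈ θ ∧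
    ∀ X : ZFSet.{0}, ElemSub X (Hset θ) → CardLT X lam → lam ∈ X → CardIn W (collapse X lam)

/-! ### Notions relativized to a transitive (set or class) model `W` -/

/-- `κ` is a regular cardinal in `W`: `κ` is a `W`-cardinal and every coded
function in `W` from some `α < κ` into `κ` is bounded. -/
def RegularIn (W : Set ZFSet.{0}) (κ : ZFSet.{0}) : Prop :=
  CardIn W κ ∧ ∀ α, α ∈ κ → ∀ f, f ∈ W → ZFSet.IsFunc α κ f →
    ∃ β, β ∈ κ ∧ ∀ ξ y, ξ ∈ α → ZFSet.pair ξ y ∈ f → y ∈ β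

/-- `H_κ` as computed in `W`. -/
def HsetIn (W : Set ZFSet.{0}) (κ : ZFSet.{0}) : Set ZFSet.{0} :=
  {x | x ∈ W ∧ ∃ t, t ∈ W ∧ t.IsTransitive ∧ x ∈ t ∧
    ∃ f, f ∈ W ∧ ∃ α, α ∈ κ ∧ IsInjF t α f}

/-- `X` is countable in `W`. -/
def CtblIn (W : Set ZFSet.{0}) (X : ZFSet.{0}) : Prop :=
  X = ∅ ∨ ∃ f, f ∈ W ∧ IsSurjF ZFSet.omega X f

/-- `|X| = ω` in `W`: countable and infinite in `W`. -/
def CtblInfIn (W : Set ZFSet.{0}) (X : ZFSet.{0}) : Prop :=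
  CtblIn W X ∧ ∀ n, n ∈ ZFSet.omega → ∀ f, f ∈ W → ¬ IsSurjF n X f

/-- The `ω₁` of `W`. -/
def omega1In (W : Set ZFSet.{0}) : ZFSet.{0} :=
  leastOrd (fun α => CardIn W α ∧ ZFSet.omega ∈ α)

/-- The `ω₂` of `W`. -/
def omega2In (W : Set ZFSet.{0}) : ZFSet.{0} :=
  leastOrd (fun α => CardIn W α ∧ omega1In W ∈ α)

/-- The cardinal successor of `κ` as computed in `W`. -/
def SuccCardIn (W : Set ZFSet.{0}) (κ : ZFSet.{0}) : ZFSet.{0} :=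
  leastOrd (fun α => CardIn W α ∧ κ ∈ α)

/-- `WRP^L(γ)` as computed inside the (transitive) model `W`:  for some
`κ ∈ W` regular in `W` with `γ < κ` there is an `X ∈ W`, countably infinite
in `W`, with `X ≺ H_κ^W`, `γ ∈ X`, whose collapse sends `γ` to a cardinal of
the `L` of `W`. -/
def WRPLIn (W : Set ZFSet.{0}) (γ : ZFSet.{0}) : Prop :=
  ∃ κ, κ ∈ W ∧ RegularIn W κ ∧ γ ∈ κ ∧
    ∃ X, X ∈ W ∧ ElemSub X (HsetIn W κ) ∧ CtblInfIn W X ∧ γ ∈ X ∧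
      CardIn (LClassIn W) (collapse X γ)

/-- `SRP^L(γ)` as computed inside the (transitive) model `W`. -/
def SRPLIn (W : Set ZFSet.{0}) (γ : ZFSet.{0}) : Prop :=
  ∃ κ, κ ∈ W ∧ RegularIn W κ ∧ γ ∈ κ ∧
    ∀ X, X ∈ W → ElemSub X (HsetIn W κ) → CtblInfIn W X → γ ∈ X →
      CardIn (LClassIn W) (collapse X γ)

/-! ### Models of (fragments of) ZFC, semantically -/

/-- `W` is a transitive model of `ZFC⁻` (ZFC with Power Set deleted and with
Collection), rendered semantically: nonempty, transitive, closed under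
pairing and union, contains `ω`, satisfies full Separation and Collection for
first-order formulas with parameters, and Choice. -/
def ModelsZFCminus (W : Set ZFSet.{0}) : Prop :=
  (∃ x, x ∈ W) ∧
  (∀ x, x ∈ W → x.toSet ⊆ W) ∧
  (∀ x y, x ∈ W → y ∈ W → insert x (insert y (∅ : ZFSet.{0})) ∈ W) ∧
  (∀ x, x ∈ W → ZFSet.sUnion x ∈ W) ∧
  (ZFSet.omega ∈ W) ∧
  (∀ (n : ℕ) (φ : Fml (n + 1)) (v : Fin n → ZFSet.{0}), (∀ i, v i ∈ W) → ∀ a, a ∈ W →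
    ZFSet.sep (fun z => SatAB W ∅ ∅ φ (Fin.cons z v)) a ∈ W) ∧
  (∀ (n : ℕ) (φ : Fml (n + 2)) (v : Fin n → ZFSet.{0}), (∀ i, v i ∈ W) → ∀ a, a ∈ W →
    (∀ x, x ∈ a → ∃ y, y ∈ W ∧ SatAB W ∅ ∅ φ (Fin.cons x (Fin.cons y v))) →
    ∃ b, b ∈ W ∧ ∀ x, x ∈ a → ∃ y, y ∈ b ∧ SatAB W ∅ ∅ φ (Fin.cons x (Fin.cons y v))) ∧
  (∀ x, x ∈ W → (∀ y, y ∈ x → y ≠ ∅) →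
    ∃ c, c ∈ W ∧ ∀ y, y ∈ x → ∃! z, z ∈ y ∧ ZFSet.pair y z ∈ c)

/-- `W` is a transitive model of `ZFC` (with Power Set). -/
def ModelsZFC (W : Set ZFSet.{0}) : Prop :=
  ModelsZFCminus W ∧ ∀ x, x ∈ W → ∃ p, p ∈ W ∧ ∀ z, z ∈ W → (z ∈ p ↔ z ⊆ x)

/-- `W` is a model of `Z₂ = ZFC⁻ +` "every set is countable". -/
def ModelsZ2 (W : Set ZFSet.{0}) : Prop :=
  ModelsZFCminus W ∧ ∀ x, x ∈ W → CtblIn W x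

/-- `p` is the power set of `x` as computed in `W`. -/
def IsPowIn (W : Set ZFSet.{0}) (x p : ZFSet.{0}) : Prop :=
  p ∈ W ∧ ∀ z, z ∈ W → (z ∈ p ↔ z ⊆ x)

/-- `W` is a model of `Z₃ = ZFC⁻ + 𝒫(ω)` exists `+` every set has size `≤ ℶ₁`. -/
def ModelsZ3 (W : Set ZFSet.{0}) : Prop :=
  ModelsZFCminus W ∧ (∃ p, IsPowIn W ZFSet.omega p) ∧
    ∀ x, x ∈ W → ∀ p, IsPowIn W ZFSet.omega p → ∃ f, f ∈ W ∧ IsInjF x p f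

/-- `W` is a model of `Z₄ = ZFC⁻ + 𝒫(𝒫(ω))` exists `+` every set has size `≤ ℶ₂`. -/
def ModelsZ4 (W : Set ZFSet.{0}) : Prop :=
  ModelsZFCminus W ∧
    (∃ p q, IsPowIn W ZFSet.omega p ∧ IsPowIn W p q) ∧
    ∀ x, x ∈ W → ∀ p q, IsPowIn W ZFSet.omega p → IsPowIn W p q →
      ∃ f, f ∈ W ∧ IsInjF x q f

/-! ### Forcing: the Lévy collapse, genericity, generic extensions -/

/-- The Lévy collapse `Col(ω, <κ)`: finite partial functions `p` with
`p(α, n) ∈ α` for `α < κ`, `n < ω`. -/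
def ColLt (κ : ZFSet.{0}) : ZFSet.{0} :=
  ZFSet.sep (fun p => p.toSet.Finite ∧
      (∀ z, z ∈ p → ∃ α n β, α ∈ κ ∧ n ∈ ZFSet.omega ∧ β ∈ α ∧
        z = ZFSet.pair (ZFSet.pair α n) β) ∧
      (∀ α n β β', ZFSet.pair (ZFSet.pair α n) β ∈ p →
        ZFSet.pair (ZFSet.pair α n) β' ∈ p → β = β'))
    (ZFSet.powerset (prodZ (prodZ κ ZFSet.omega) (ZFSet.sUnion κ)))

/-- `G` is a filter on the partial order `P` of partial functions ordered by
reverse inclusion (`p` is stronger than `q` iff `q ⊆ p`) which meets every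
dense subset of `P` lying in the (transitive) model `W`. -/
def GenericOver (W : Set ZFSet.{0}) (P G : ZFSet.{0}) : Prop :=
  G ⊆ P ∧
  (∀ p q, p ∈ G → q ∈ P → q ⊆ p → q ∈ G) ∧
  (∀ p q, p ∈ G → q ∈ G → ∃ r, r ∈ G ∧ p ⊆ r ∧ q ⊆ r) ∧
  (∀ D, D ∈ W → D ⊆ P → (∀ p, p ∈ P → ∃ q, q ∈ D ∧ p ⊆ q) → ∃ q, q ∈ G ∧ q ∈ D)

/-- Genericity for an abstract partial order `R` (a set of pairs) on `P`:
`pair p q ∈ R` means `p` is stronger than (extends) `q`. -/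
def GenericOnP (W : Set ZFSet.{0}) (P R G : ZFSet.{0}) : Prop :=
  G ⊆ P ∧
  (∀ p q, p ∈ G → q ∈ P → ZFSet.pair p q ∈ R → q ∈ G) ∧
  (∀ p q, p ∈ G → q ∈ G → ∃ r, r ∈ G ∧ ZFSet.pair r p ∈ R ∧ ZFSet.pair r q ∈ R) ∧
  (∀ D, D ∈ W → D ⊆ P → (∀ p, p ∈ P → ∃ q, q ∈ D ∧ ZFSet.pair q p ∈ R) →
    ∃ q, q ∈ G ∧ q ∈ D)

/-- Evaluation of a forcing name `τ` by a filter `G`: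
`nameVal G τ = {nameVal G σ | ∃ p ∈ G, (σ, p) ∈ τ}`. -/
def nameVal (G : ZFSet.{0}) : ZFSet.{0} → ZFSet.{0} :=
  (ZFSet.mem_wf.transGen).fix (C := fun _ => ZFSet.{0}) fun τ ih =>
    img (fun σ => if h : Relation.TransGen (· ∈ ·) σ τ then ih σ h else ∅)
      (ZFSet.sep (fun σ => ∃ p, p ∈ G ∧ ZFSet.pair σ p ∈ τ)
        (ZFSet.sUnion (ZFSet.sUnion τ)))

/-- The generic extension `M[G]` of a transitive set model `M`, via names. -/
def extSet (M G : ZFSet.{0}) : Set ZFSet.{0} := {x | ∃ τ, τ ∈ M ∧ x = nameVal G τ}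

/-! ### Remarkable cardinals (Schindler), relative to a ground model class -/

/-- Clubs of countable subsets of `S`, as computed in the (transitive) model
`E`: the club is coded by a set `D ∈ E`, its members are subsets of `S`
countably infinite in `E`, it is cofinal among such sets lying in `E`, and it
is closed under unions of increasing `ω`-chains coded in `E`. -/
def ClubSubIn (E : Set ZFSet.{0}) (S : Set ZFSet.{0}) (D : ZFSet.{0}) : Prop :=
  D ∈ E ∧
  (∀ X, X ∈ D → X.toSet ⊆ S ∧ CtblInfIn E X) ∧
  (∀ X : ZFSet.{0}, X ∈ E → X.toSet ⊆ S → CtblInfIn E X → ∃ Y, Y ∈ D ∧ X ⊆ Y) ∧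
  (∀ g, g ∈ E → ZFSet.IsFunc ZFSet.omega D g →
    (∀ n y y', n ∈ ZFSet.omega → ZFSet.pair n y ∈ g →
      ZFSet.pair (insert n n) y' ∈ g → y ⊆ y') →
    ZFSet.sUnion (imageOf g) ∈ D)

/-- Stationarity of a collection `C` of countable subsets of `S`, as computed
in the model `E`. -/
def StatSubIn (E : Set ZFSet.{0}) (S : Set ZFSet.{0}) (C : Set ZFSet.{0}) : Prop :=
  ∀ D : ZFSet.{0}, ClubSubIn E S D → ∃ X, X ∈ C ∧ X ∈ D

/-- `X` condenses remarkably (with ground model `W`, extension operation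
`Ext` sending a generic object to the corresponding extension of `W`,
collapse height `δ`, target `θ`, and generic `G`):  `X = ran(π)` for some
elementary `π : (H_β^{W[G∩H_α^W]}, ∈, H_β^W, G∩H_α^W) → (H_θ^{W[G]}, ∈, H_θ^W, G)`
with `α = crit(π) < β < δ` and `β` a cardinal of `W`. -/
def CondensesRemarkably (W : Set ZFSet.{0}) (Ext : ZFSet.{0} → Set ZFSet.{0})
    (δ θ G X : ZFSet.{0}) : Prop :=
  ∃ (f : ZFSet.{0} → ZFSet.{0}) (α β : ZFSet.{0}), IsOrd α ∧ α ∈ β ∧ β ∈ δ ∧ CardIn W β ∧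
    (∀ ξ, ξ ∈ α → f ξ = ξ) ∧ f α ≠ α ∧
    (let Gα : ZFSet.{0} := ZFSet.sep (fun p => p ∈ HsetIn W α) G
     let Dom : Set ZFSet.{0} := HsetIn (Ext Gα) β
     let Cod : Set ZFSet.{0} := HsetIn (Ext G) θ
     Set.MapsTo f Dom Cod ∧ X.toSet = f '' Dom ∧
     ∀ (n : ℕ) (φ : Fml n) (v : Fin n → ZFSet.{0}), (∀ i, v i ∈ Dom) →
       (SatAB Dom W Gα.toSet φ v ↔ SatAB Cod W G.toSet φ (f ∘ v)))

/-- `δ` is `θ`-remarkable, in the sense of the (transitive) ground model `W`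
with extensions given by `Ext`: for every `G` which is `Col(ω, <δ)`-generic
over `W`, in `W[G]` the set of countable `X ⊆ H_θ^{W[G]}` which condense
remarkably is stationary. -/
def ThetaRemarkableVia (W : Set ZFSet.{0}) (Ext : ZFSet.{0} → Set ZFSet.{0})
    (δ θ : ZFSet.{0}) : Prop :=
  ∀ G, GenericOver W (ColLt δ) G →
    StatSubIn (Ext G) (HsetIn (Ext G) θ)
      {X | CondensesRemarkably W Ext δ θ G X}

/-- `δ` is remarkable in the sense of `(W, Ext)`:  `θ`-remarkable for every
regular (in `W`) `θ > δ`. -/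
def RemarkableVia (W : Set ZFSet.{0}) (Ext : ZFSet.{0} → Set ZFSet.{0}) (δ : ZFSet.{0}) : Prop :=
  ∀ θ, RegularIn W θ → δ ∈ θ → ThetaRemarkableVia W Ext δ θ

/-! ### Indiscernibles and sharps -/

/-- `I` is a set (or class) of ordinal indiscernibles for the structure
`(S, ∈, A)`. -/
def IndiscFor (S A : Set ZFSet.{0}) (I : Set ZFSet.{0}) : Prop :=
  (∀ x ∈ I, IsOrd x ∧ x ∈ S) ∧
  ∀ (n : ℕ) (φ : Fml n) (v w : Fin n → ZFSet.{0}),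
    (∀ i, v i ∈ I) → (∀ i, w i ∈ I) →
    (∀ i j : Fin n, i < j → v i ∈ v j) → (∀ i j : Fin n, i < j → w i ∈ w j) →
    (SatAB S A ∅ φ v ↔ SatAB S A ∅ φ w)

/-- `0♯` exists: for some uncountable limit ordinal `λ`, `L_λ` has an
uncountable set of indiscernibles. -/
def ZeroSharpExists : Prop :=
  ∃ lam : ZFSet.{0}, IsLimitOrd lam ∧ ¬ lam.toSet.Countable ∧
    ∃ I : ZFSet.{0}, ¬ I.toSet.Countable ∧ IndiscFor (Lstage lam).toSet ∅ I.toSet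

/-- The sharp of `L[A]` exists: for some uncountable limit ordinal `λ`, the
structure `(L_λ[A], ∈, A)` has an uncountable set of indiscernibles. -/
def SharpOverExists (A : ZFSet.{0}) : Prop :=
  ∃ lam : ZFSet.{0}, IsLimitOrd lam ∧ ¬ lam.toSet.Countable ∧
    ∃ I : ZFSet.{0}, ¬ I.toSet.Countable ∧
      IndiscFor (LstageA A.toSet lam).toSet A.toSet I.toSet

/-- `I` is a closed unbounded proper class of ordinals. -/
def ProperClassClub (I : Set ZFSet.{0}) : Prop :=
  (∀ x ∈ I, IsOrd x) ∧
  (∀ α, IsOrd α → ∃ β, IsOrd β ∧ α ∈ β ∧ β ∈ I) ∧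
  (∀ α, IsOrd α → α ≠ ∅ → (∀ β ∈ α, ∃ θ, θ ∈ I ∧ θ ∈ α ∧ (β ∈ θ ∨ β = θ)) → α ∈ I)

/-- `s` is (a real coding) `0♯`: there is a closed unbounded proper class `I`
of Silver indiscernibles for `L` and `s` is the set of codes of formulas
satisfied in `L` by increasing tuples from `I`. -/
def IsZeroSharpReal (s : ZFSet.{0}) : Prop :=
  s ⊆ ZFSet.omega ∧
  ∃ I : Set ZFSet.{0}, ProperClassClub I ∧ IndiscFor LClass ∅ I ∧
    s = ZFSet.sep (fun m => ∃ (n : ℕ) (φ : Fml n) (v : Fin n → ZFSet.{0}),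
          (∀ i, v i ∈ I) ∧ (∀ i j : Fin n, i < j → v i ∈ v j) ∧
          Sat LClass φ v ∧ m = natZ (Nat.pair n (codeF φ))) ZFSet.omega

/-! ### Admissible ordinals and Harrington's Principle -/

/-- The (graph of the) function `f` is `Σ₁`-definable with parameters over the
structure `(S, ∈)`. -/
def Sigma1DefOver (S : Set ZFSet.{0}) (f : ZFSet.{0} → ZFSet.{0}) : Prop :=
  ∃ (n : ℕ) (ψ : Fml (n + 3)), IsDelta0 ψ ∧
    ∃ p : Fin n → ZFSet.{0}, (∀ i, p i ∈ S) ∧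
      ∀ a b, a ∈ S → b ∈ S →
        (f a = b ↔ Sat S (Fml.ex ψ) (Fin.cons a (Fin.cons b p)))

/-- `α` is `x`-admissible: `α > ω` is a limit ordinal and no
`Σ₁(L_α[x])`-definable function maps some `δ < α` cofinally into `α`. -/
def Admissible (x α : ZFSet.{0}) : Prop :=
  IsLimitOrd α ∧ ZFSet.omega ∈ α ∧
  ¬ ∃ δ, δ ∈ α ∧ ∃ f : ZFSet.{0} → ZFSet.{0},
      Sigma1DefOver (LstageA x.toSet α).toSet f ∧
      (∀ β, β ∈ δ → f β ∈ α) ∧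
      ∀ ξ, ξ ∈ α → ∃ β, β ∈ δ ∧ (ξ ∈ f β ∨ ξ = f β)

/-- The generalized Harrington Principle `HP(M)` for the inner model given by
the class `W`: there is a real `x` such that every `x`-admissible ordinal is a
cardinal of `W`. -/
def HPclass (W : Set ZFSet.{0}) : Prop :=
  ∃ x : ZFSet.{0}, x ⊆ ZFSet.omega ∧ ∀ α, Admissible x α → CardIn W α

/-- Harrington's Principle `HP(L)`. -/
def HPL : Prop := HPclass LClass

/-- `HP(L)` as computed inside the (transitive) model `W`. -/
def HPLIn (W : Set ZFSet.{0}) : Prop :=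
  ∃ x, x ∈ W ∧ x ⊆ ZFSet.omega ∧
    ∀ α, α ∈ W → Admissible x α → CardIn (LClassIn W) α

/-! ### Inner models, elementary embeddings, rigidity, covering -/

/-- `W` is an inner model: a transitive proper class containing all ordinals
and satisfying ZFC. -/
def InnerModelClass (W : Set ZFSet.{0}) : Prop :=
  (∀ x, x ∈ W → x.toSet ⊆ W) ∧ (∀ α : ZFSet.{0}, IsOrd α → α ∈ W) ∧ ModelsZFC W

/-- `j` is an elementary embedding of the class `(W, ∈)` into itself. -/
def ElemEmbOn (W : Set ZFSet.{0}) (j : ZFSet.{0} → ZFSet.{0}) : Prop :=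
  Set.MapsTo j W W ∧
  ∀ (n : ℕ) (φ : Fml n) (v : Fin n → ZFSet.{0}),
    (∀ i, v i ∈ W) → (Sat W φ v ↔ Sat W φ (j ∘ v))

/-- `W` has the rigidity property: there is no nontrivial elementary embedding
from `W` to `W`. -/
def RigidClass (W : Set ZFSet.{0}) : Prop :=
  ¬ ∃ j : ZFSet.{0} → ZFSet.{0}, ElemEmbOn W j ∧ ∃ x, x ∈ W ∧ j x ≠ x

/-- `W` has the full covering property: every set `X` of ordinals is covered
by some `Y ∈ W` with `|Y| = |X| + ω₁`. -/
def FullCovering (W : Set ZFSet.{0}) : Prop :=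
  ∀ X : ZFSet.{0}, (∀ z ∈ X, IsOrd z) →
    ∃ Y, Y ∈ W ∧ X ⊆ Y ∧ Nonempty (Y.toSet ≃ (X.toSet ⊕ (Aleph 1).toSet))

/-- The restriction `M|θ` of the inner model `W`: its elements of rank `< θ`. -/
def restrictTo (W : Set ZFSet.{0}) (θ : ZFSet.{0}) : Set ZFSet.{0} :=
  {x | x ∈ W ∧ rankZ x ∈ θ}

/-- The class `S` is definable (with parameters) in `H_θ`. -/
def DefinableInH (θ : ZFSet.{0}) (S : Set ZFSet.{0}) : Prop :=
  ∃ (n : ℕ) (φ : Fml (n + 1)) (v : Fin n → ZFSet.{0}),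
    (∀ i, v i ∈ Hset θ) ∧ ∀ x, x ∈ Hset θ → (x ∈ S ↔ Sat (Hset θ) φ (Fin.cons x v))

/-- `ν` is weakly inaccessible in `W`: a regular limit cardinal of `W`. -/
def WeaklyInaccIn (W : Set ZFSet.{0}) (ν : ZFSet.{0}) : Prop :=
  RegularIn W ν ∧ ZFSet.omega ∈ ν ∧
    ∀ β, β ∈ ν → ∃ δ, δ ∈ ν ∧ β ∈ δ ∧ CardIn W δ

/-! ### Measures, `κ`-models and `0†` -/

/-- `⟨L[U], ∈, U⟩ ⊨ "U is a normal ultrafilter over κ"`:  `L[U]` is a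
`κ`-model. -/
def IsKappaModel (κ U : ZFSet.{0}) : Prop :=
  IsOrd κ ∧ ZFSet.omega ∈ κ ∧ U ∈ LrelClass U ∧
  (∀ X, X ∈ U → X ⊆ κ ∧ X ∈ LrelClass U) ∧ κ ∈ U ∧ (∅ : ZFSet.{0}) ∉ U ∧
  (∀ X Y, X ∈ U → Y ∈ U → X ∩ Y ∈ U) ∧
  (∀ X Y, X ∈ U → Y ∈ LrelClass U → X ⊆ Y → Y ⊆ κ → Y ∈ U) ∧
  (∀ X, X ∈ LrelClass U → X ⊆ κ → (X ∈ U ∨ κ \ X ∈ U)) ∧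
  (∀ α, α ∈ κ → (insert α ∅ : ZFSet.{0}) ∉ U) ∧
  (∀ δ g, δ ∈ κ → g ∈ LrelClass U → ZFSet.IsFunc δ (ZFSet.powerset κ) g →
    (∀ ξ y, ZFSet.pair ξ y ∈ g → y ∈ U) →
    ZFSet.sep (fun β => ∀ ξ, ξ ∈ δ → ∀ y, ZFSet.pair ξ y ∈ g → β ∈ y) κ ∈ U) ∧
  (∀ f X, f ∈ LrelClass U → X ∈ U → ZFSet.IsFunc κ κ f →
    (∀ α, α ∈ X → α ≠ ∅ → ∀ y, ZFSet.pair α y ∈ f → y ∈ α) →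
    ∃ β Y, β ∈ κ ∧ Y ∈ U ∧ ∀ α, α ∈ Y → ZFSet.pair α β ∈ f)

/-- `0†` exists: there is a `κ`-model (for some `κ`) and a nontrivial
elementary embedding from that model to itself with critical point
greater than `κ`. -/
def ZeroDaggerExists : Prop :=
  ∃ κ U : ZFSet.{0}, IsKappaModel κ U ∧
    ∃ j : ZFSet.{0} → ZFSet.{0}, ElemEmbOn (LrelClass U) j ∧
      ∃ η, IsOrd η ∧ κ ∈ η ∧ (∀ β, β ∈ η → j β = β) ∧ j η ≠ η

/-- `U` witnesses that `κ` is a measurable cardinal (in `V`): `U` is a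
`κ`-complete nonprincipal normal ultrafilter on `κ`. -/
def IsMeasureOn (κ U : ZFSet.{0}) : Prop :=
  IsOrd κ ∧ ZFSet.omega ∈ κ ∧
  (∀ X, X ∈ U → X ⊆ κ) ∧ κ ∈ U ∧ (∅ : ZFSet.{0}) ∉ U ∧
  (∀ X Y, X ∈ U → Y ∈ U → X ∩ Y ∈ U) ∧
  (∀ X Y, X ∈ U → X ⊆ Y → Y ⊆ κ → Y ∈ U) ∧
  (∀ X : ZFSet.{0}, X ⊆ κ → (X ∈ U ∨ κ \ X ∈ U)) ∧
  (∀ α, α ∈ κ → (insert α ∅ : ZFSet.{0}) ∉ U) ∧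
  (∀ x : ZFSet.{0}, x.toSet ⊆ U.toSet → CardLT x κ → x ≠ ∅ →
    ZFSet.sep (fun β => ∀ y, y ∈ x → β ∈ y) κ ∈ U) ∧
  (∀ f X, X ∈ U → ZFSet.IsFunc κ κ f →
    (∀ α, α ∈ X → α ≠ ∅ → ∀ y, ZFSet.pair α y ∈ f → y ∈ α) →
    ∃ β Y, β ∈ κ ∧ Y ∈ U ∧ ∀ α, α ∈ Y → ZFSet.pair α β ∈ f)

/-- `κ` is a measurable cardinal. -/
def IsMeasurable (κ : ZFSet.{0}) : Prop := ∃ U, IsMeasureOn κ U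

/-- `U ∈ W` witnesses measurability of `κ` inside the inner model `W`. -/
def MeasurableIn (W : Set ZFSet.{0}) (κ U : ZFSet.{0}) : Prop :=
  U ∈ W ∧ IsOrd κ ∧ ZFSet.omega ∈ κ ∧
  (∀ X, X ∈ U → X ⊆ κ) ∧ κ ∈ U ∧ (∅ : ZFSet.{0}) ∉ U ∧
  (∀ X Y, X ∈ U → Y ∈ U → X ∩ Y ∈ U) ∧
  (∀ X Y, X ∈ U → Y ∈ W → X ⊆ Y → Y ⊆ κ → Y ∈ U) ∧
  (∀ X, X ∈ W → X ⊆ κ → (X ∈ U ∨ κ \ X ∈ U)) ∧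
  (∀ α, α ∈ κ → (insert α ∅ : ZFSet.{0}) ∉ U) ∧
  (∀ δ g, δ ∈ κ → g ∈ W → ZFSet.IsFunc δ (ZFSet.powerset κ) g →
    (∀ ξ y, ZFSet.pair ξ y ∈ g → y ∈ U) →
    ZFSet.sep (fun β => ∀ ξ, ξ ∈ δ → ∀ y, ZFSet.pair ξ y ∈ g → β ∈ y) κ ∈ U)

/-- There is an inner model with a measurable cardinal. -/
def ExistsInnerModelMeasurable : Prop :=
  ∃ W : Set ZFSet.{0}, InnerModelClass W ∧ ∃ κ U, MeasurableIn W κ U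

/-! ### Core-model-like inner models -/

/-- `W` satisfies the GCH. -/
def GCHIn (W : Set ZFSet.{0}) : Prop :=
  ∀ κ, CardIn W κ → (ZFSet.omega ∈ κ ∨ ZFSet.omega = κ) →
    ∃ f, f ∈ W ∧ IsInjF (ZFSet.sep (fun z => z ∈ W) (ZFSet.powerset κ))
      (SuccCardIn W κ) f

/-- `W` has the condensation property: the transitive collapse of any
elementary submodel of an initial segment of `W` is again an initial segment
of `W`. -/
def CondensationFor (W : Set ZFSet.{0}) : Prop :=
  ∀ θ : ZFSet.{0}, IsOrd θ → ∀ X : ZFSet.{0},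
    X.toSet ⊆ restrictTo W θ → ElemSub X (restrictTo W θ) →
    ∃ θ', IsOrd θ' ∧ (collapseSet X).toSet = restrictTo W θ'

/-- The properties of the Dodd–Jensen core model `K` (below a measurable
cardinal) which are relevant here: `K` is an inner model satisfying the GCH,
with condensation, and (by Dodd–Jensen, given that there is no inner model
with a measurable) the rigidity property. -/
def CoreModelProps (W : Set ZFSet.{0}) : Prop :=
  InnerModelClass W ∧ GCHIn W ∧ CondensationFor W ∧ RigidClass W

/-! ### `L(ℝ)`, determinacy, and `HOD` -/

/-- The base of the `L(ℝ)` hierarchy: the transitive closure of `{𝒫(ω)}`. -/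
def lrBase : ZFSet.{0} :=
  insert (ZFSet.powerset ZFSet.omega) (tcl (ZFSet.powerset ZFSet.omega))

/-- The hierarchy `L_α(ℝ)`. -/
def LRstage : ZFSet.{0} → ZFSet.{0} :=
  ZFSet.mem_wf.fix (C := fun _ => ZFSet.{0}) fun α ih =>
    lrBase ∪ ZFSet.sUnion
      (img (fun β => if h : β ∈ α then DefSetA ∅ (ih β h) else ∅) α)

/-- The class `L(ℝ)`. -/
def LRClass : Set ZFSet.{0} := {x | ∃ α, IsOrd α ∧ x ∈ LRstage α}

/-- The `ZFSet` coding the function `ω → ω` given by `g`. -/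
def seqCode (g : ℕ → ℕ) : ZFSet.{0} :=
  img (fun m => ZFSet.pair m (natZ (g (zfToNat m)))) ZFSet.omega

/-- The game on `ω` with payoff `A` (a set of coded functions `ω → ω`) is
determined: one of the two players has a winning strategy. -/
def DeterminedZ (A : ZFSet.{0}) : Prop :=
  (∃ σ : List ℕ → ℕ, ∀ g : ℕ → ℕ,
    (∀ n : ℕ, g (2 * n) = σ (List.ofFn (fun i : Fin (2 * n) => g i.val))) →
    seqCode g ∈ A) ∨
  (∃ τ : List ℕ → ℕ, ∀ g : ℕ → ℕ,
    (∀ n : ℕ, g (2 * n + 1) = τ (List.ofFn (fun i : Fin (2 * n + 1) => g i.val))) →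
    seqCode g ∉ A)

/-- `AD^{L(ℝ)}`: every set of reals in `L(ℝ)` is determined.  (Since every
real, and every strategy, belongs to `L(ℝ)`, this is equivalent to `L(ℝ) ⊨ AD`.) -/
def ADinLR : Prop :=
  ∀ A, A ∈ LRClass → (∀ f, f ∈ A → ZFSet.IsFunc ZFSet.omega ZFSet.omega f) →
    DeterminedZ A

/-- `x` is ordinal definable. -/
def IsOD (x : ZFSet.{0}) : Prop :=
  ∃ (n : ℕ) (φ : Fml (n + 1)) (v : Fin n → ZFSet.{0}),
    (∀ i, IsOrd (v i)) ∧ ∀ y, (Sat Set.univ φ (Fin.cons y v) ↔ y = x)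

/-- The class `HOD` of hereditarily ordinal definable sets. -/
def HODClass : Set ZFSet.{0} :=
  {x | IsOD x ∧ ∀ y, y ∈ tcl x → IsOD y}

/-- The class `L[A]` as computed inside the (transitive) model `W`. -/
def LrelClassIn (W : Set ZFSet.{0}) (A : ZFSet.{0}) : Set ZFSet.{0} :=
  {x | ∃ α, IsOrd α ∧ α ∈ W ∧ x ∈ LstageA A.toSet α}

/-! ## Definability over transitive classes -/

abbrev V := ZFSet.{0}

/-- Renaming of the free variables of a formula. -/
def Fml.ren : ∀ {n m : ℕ}, (Fin n → Fin m) → Fml n → Fml m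
  | _, _, ρ, .mem i j => .mem (ρ i) (ρ j)
  | _, _, ρ, .eq i j => .eq (ρ i) (ρ j)
  | _, _, ρ, .inA i => .inA (ρ i)
  | _, _, ρ, .inB i => .inB (ρ i)
  | _, _, ρ, .not φ => .not (φ.ren ρ)
  | _, _, ρ, .and φ ψ => .and (φ.ren ρ) (ψ.ren ρ)
  | _, _, ρ, .ex φ => .ex (φ.ren (Fin.cons 0 (fun i => (ρ i).succ)))

theorem Fml.satAB_ren (S A B : Set V) : ∀ {n m : ℕ} (φ : Fml n) (ρ : Fin n → Fin m)
    (v : Fin m → V), SatAB S A B (φ.ren ρ) v ↔ SatAB S A B φ (fun i => v (ρ i))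
  | _, _, .mem i j, ρ, v => Iff.rfl
  | _, _, .eq i j, ρ, v => Iff.rfl
  | _, _, .inA i, ρ, v => Iff.rfl
  | _, _, .inB i, ρ, v => Iff.rfl
  | _, _, .not φ, ρ, v => not_congr (Fml.satAB_ren S A B φ ρ v)
  | _, _, .and φ ψ, ρ, v =>
      and_congr (Fml.satAB_ren S A B φ ρ v) (Fml.satAB_ren S A B ψ ρ v)
  | _, _, .ex φ, ρ, v => by
      refine exists_congr fun x => and_congr_right fun _ => ?_
      rw [Fml.satAB_ren S A B φ]
      have : (fun i => (Fin.cons x v : Fin _ → V) ((Fin.cons 0 (fun i => (ρ i).succ) :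
          Fin _ → Fin _) i)) = (Fin.cons x fun i => v (ρ i)) := by
        funext i
        refine Fin.cases ?_ (fun i => ?_) i <;> simp
      rw [this]

theorem Fml.sat_ren (S : Set V) {n m : ℕ} (φ : Fml n) (ρ : Fin n → Fin m)
    (v : Fin m → V) : Sat S (φ.ren ρ) v ↔ Sat S φ (fun i => v (ρ i)) :=
  Fml.satAB_ren S ∅ ∅ φ ρ v

/-- Infinite assignments. -/
abbrev Env := ℕ → V

def Env.tl (v : Env) : Env := fun n => v (n + 1)

def Env.cons (x : V) (v : Env) : Env
  | 0 => x
  | n + 1 => v n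

open Env

@[simp] theorem Env.cons_zero (x : V) (v : Env) : cons x v 0 = x := rfl
@[simp] theorem Env.cons_succ (x : V) (v : Env) (n : ℕ) : cons x v (n + 1) = v n := rfl
theorem Env.tl_apply (v : Env) (n : ℕ) : tl v n = v (n + 1) := rfl

def EIn (W : Set V) (v : Env) : Prop := ∀ i, v i ∈ W

theorem EIn.cons {W : Set V} {x : V} {v : Env} (hx : x ∈ W) (hv : EIn W v) :
    EIn W (Env.cons x v)
  | 0 => hx
  | n + 1 => hv n

theorem EIn.tl {W : Set V} {v : Env} (hv : EIn W v) : EIn W (Env.tl v) := fun n => hv (n + 1)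

/-- The value of an atomic term: a variable or a parameter. -/
def aval (v : Env) {A : Set V} : ℕ ⊕ A → V := Sum.elim v (fun a => (a : V))

/-- `P` is first-order definable over `(W, ∈)` with parameters from `A`. -/
class Dfn (W A : Set V) (P : Env → Prop) : Prop where
  out : ∃ (n : ℕ) (φ : Fml n) (e : Fin n → ℕ ⊕ A),
    ∀ v, EIn W v → (P v ↔ Sat W φ (fun i => aval v (e i)))

/-- `t` is a function on assignments with definable graph and values in `W`. -/
class DfnF (W A : Set V) (t : Env → V) : Prop where
  mem' : ∀ v, EIn W v → t v ∈ W
  graph : Dfn W A (fun v => v 0 = t (tl v))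

class Par (W A : Set V) : Prop where
  sub : A ⊆ W

instance (W : Set V) : Par W W := ⟨subset_rfl⟩
instance (W : Set V) : Par W ∅ := ⟨Set.empty_subset _⟩

section Basic
variable {W A : Set V}

theorem Dfn.of_iff {P Q : Env → Prop} (hP : Dfn W A P)
    (h : ∀ v, EIn W v → (Q v ↔ P v)) : Dfn W A Q := by
  obtain ⟨n, φ, e, H⟩ := hP.out
  exact ⟨n, φ, e, fun v hv => (h v hv).trans (H v hv)⟩

theorem Dfn.mono {B : Set V} {P : Env → Prop} (hP : Dfn W A P) (h : A ⊆ B) : Dfn W B P := by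
  obtain ⟨n, φ, e, H⟩ := hP.out
  refine ⟨n, φ, fun i => (e i).map id (Set.inclusion h), fun v hv => (H v hv).trans ?_⟩
  have : (fun i => aval v (e i)) =
      (fun i => aval v ((e i).map id (Set.inclusion h))) := by
    funext i
    rcases e i with k | a <;> rfl
  rw [this]

theorem Dfn.ren {P : Env → Prop} (hP : Dfn W A P) (ρ : ℕ → ℕ) :
    Dfn W A (fun v => P (fun i => v (ρ i))) := by
  obtain ⟨n, φ, e, H⟩ := hP.out
  refine ⟨n, φ, fun i => (e i).map ρ id, fun v hv => (H _ fun i => hv (ρ i)).trans ?_⟩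
  have : (fun i => aval (fun i => v (ρ i)) (e i)) =
      (fun i => aval v ((e i).map ρ id)) := by
    funext i
    rcases e i with k | a <;> rfl
  rw [this]

theorem Dfn.const_iff (p : Prop) : Dfn W A (fun _ => p) := by
  by_cases h : p
  · refine ⟨1, .eq 0 0, fun _ => .inl 0, fun v _ => ?_⟩
    simp [h, Sat, SatAB]
  · refine ⟨1, .not (.eq 0 0), fun _ => .inl 0, fun v _ => ?_⟩
    simp [h, Sat, SatAB]

instance Dfn.true_inst : Dfn W A (fun _ => True) := Dfn.const_iff _
instance Dfn.false_inst : Dfn W A (fun _ => False) := Dfn.const_iff _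

instance Dfn.not_inst {P : Env → Prop} [hP : Dfn W A P] : Dfn W A (fun v => ¬ P v) := by
  obtain ⟨n, φ, e, H⟩ := hP.out
  exact ⟨n, .not φ, e, fun v hv => not_congr (H v hv)⟩

instance Dfn.and_inst {P Q : Env → Prop} [hP : Dfn W A P] [hQ : Dfn W A Q] :
    Dfn W A (fun v => P v ∧ Q v) := by
  obtain ⟨n, φ, e, H⟩ := hP.out
  obtain ⟨m, ψ, e', H'⟩ := hQ.out
  refine ⟨n + m, .and (φ.ren (Fin.castAdd m)) (ψ.ren (Fin.natAdd n)), Fin.append e e',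
    fun v hv => and_congr ?_ ?_⟩
  · refine (H v hv).trans (Iff.trans ?_ (Fml.sat_ren W φ (Fin.castAdd m) _).symm)
    simp
  · refine (H' v hv).trans (Iff.trans ?_ (Fml.sat_ren W ψ (Fin.natAdd n) _).symm)
    simp

instance Dfn.or_inst {P Q : Env → Prop} [hP : Dfn W A P] [hQ : Dfn W A Q] :
    Dfn W A (fun v => P v ∨ Q v) :=
  Dfn.of_iff (P := fun v => ¬ (¬ P v ∧ ¬ Q v)) inferInstance fun v _ => by tauto

instance Dfn.imp_inst {P Q : Env → Prop} [hP : Dfn W A P] [hQ : Dfn W A Q] :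
    Dfn W A (fun v => P v → Q v) :=
  Dfn.of_iff (P := fun v => ¬ (P v ∧ ¬ Q v)) inferInstance fun v _ => by tauto

instance Dfn.iff_inst {P Q : Env → Prop} [hP : Dfn W A P] [hQ : Dfn W A Q] :
    Dfn W A (fun v => P v ↔ Q v) :=
  Dfn.of_iff (P := fun v => (P v → Q v) ∧ (Q v → P v)) inferInstance fun v _ => by tauto

theorem Dfn.ex {P : Env → Prop} (hP : Dfn W A P) :
    Dfn W A (fun v => ∃ x ∈ W, P (cons x v)) := by
  obtain ⟨n, φ, e, H⟩ := hP.out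
  let ρ : Fin n → Fin (n + 1) := fun i => if e i = .inl 0 then 0 else i.succ
  let e' : Fin n → ℕ ⊕ A := fun i => (e i).map (fun k => k - 1) id
  refine ⟨n, .ex (φ.ren ρ), e', fun v hv => exists_congr fun x => and_congr_right fun hx => ?_⟩
  refine (H _ (EIn.cons hx hv)).trans (Iff.trans ?_ (Fml.sat_ren W φ ρ _).symm)
  have : (fun i => aval (Env.cons x v) (e i)) =
      (fun i => (Fin.cons x (fun i => aval v (e' i)) : Fin (n + 1) → V) (ρ i)) := by
    funext i
    rcases h : e i with k | a
    · rcases k with _ | k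
      · simp [ρ, h, aval]
      · simp [ρ, e', h, aval]
    · simp [ρ, e', h, aval]
  rw [this]

instance Dfn.exW_inst {P : V → Env → Prop} [hP : Dfn W A (fun v => P (v 0) (tl v))] :
    Dfn W A (fun v => ∃ x ∈ W, P x v) := hP.ex

instance Dfn.allW_inst {P : V → Env → Prop} [hP : Dfn W A (fun v => P (v 0) (tl v))] :
    Dfn W A (fun v => ∀ x ∈ W, P x v) :=
  Dfn.of_iff (P := fun v => ¬ ∃ x ∈ W, ¬ P x v) inferInstance fun v _ => by push Not; rfl

theorem Dfn.mem_var (i j : ℕ) : Dfn W A (fun v => v i ∈ v j) :=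
  ⟨2, .mem 0 1, ![.inl i, .inl j], fun _ _ => Iff.rfl⟩

theorem Dfn.eq_var (i j : ℕ) : Dfn W A (fun v => v i = v j) :=
  ⟨2, .eq 0 1, ![.inl i, .inl j], fun _ _ => Iff.rfl⟩

/-- Substitution of a definable term for the first variable. -/
theorem Dfn.subst {P : Env → Prop} (hP : Dfn W A P) {t : Env → V} (ht : DfnF W A t) :
    Dfn W A (fun v => P (cons (t v) v)) := by
  have h1 := ht.graph
  have : Dfn W A (fun v => ∃ x ∈ W, ((fun w => w 0 = t (tl w) ∧ P w) (cons x v))) :=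
    Dfn.ex (P := fun w => w 0 = t (Env.tl w) ∧ P w) inferInstance
  refine this.of_iff fun v hv => ?_
  constructor
  · intro h
    exact ⟨t v, ht.mem' v hv, rfl, h⟩
  · rintro ⟨x, _, h, h'⟩
    have h : x = t v := h
    rwa [h] at h'

theorem DfnF.ren {t : Env → V} (ht : DfnF W A t) (ρ : ℕ → ℕ) :
    DfnF W A (fun v => t (fun i => v (ρ i))) where
  mem' v hv := ht.mem' _ fun i => hv (ρ i)
  graph := by
    have := ht.graph.ren (fun i => Nat.casesOn i 0 (fun j => ρ j + 1))
    exact this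

theorem DfnF.shift {t : Env → V} (ht : DfnF W A t) : DfnF W A (fun v => t (tl v)) :=
  ht.ren (fun i => i + 1)

/-- Composition of a definable unary, binary, ternary relation with definable terms. -/
theorem Dfn.comp1 {R : V → Prop} (hR : Dfn W A (fun v => R (v 0))) {s : Env → V}
    (hs : DfnF W A s) : Dfn W A (fun v => R (s v)) := hR.subst hs

theorem Dfn.comp2 {R : V → V → Prop} (hR : Dfn W A (fun v => R (v 0) (v 1))) {s t : Env → V}
    (hs : DfnF W A s) (ht : DfnF W A t) : Dfn W A (fun v => R (s v) (t v)) :=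
  (hR.subst (hs.shift)).subst ht |>.of_iff (P := fun v => R (s v) (t v)) (fun _ _ => Iff.rfl)

theorem Dfn.comp3 {R : V → V → V → Prop} (hR : Dfn W A (fun v => R (v 0) (v 1) (v 2)))
    {s t u : Env → V} (hs : DfnF W A s) (ht : DfnF W A t) (hu : DfnF W A u) :
    Dfn W A (fun v => R (s v) (t v) (u v)) :=
  ((hR.subst (hs.shift.shift)).subst ht.shift).subst hu

instance Dfn.mem_inst {s t : Env → V} [hs : DfnF W A s] [ht : DfnF W A t] :
    Dfn W A (fun v => s v ∈ t v) :=
  Dfn.comp2 (R := fun x y => x ∈ y) (Dfn.mem_var 0 1) hs ht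

instance Dfn.eq_inst {s t : Env → V} [hs : DfnF W A s] [ht : DfnF W A t] :
    Dfn W A (fun v => s v = t v) :=
  Dfn.comp2 (R := fun x y => x = y) (Dfn.eq_var 0 1) hs ht

class EMap (m : Env → Env) : Prop where
  out : ∃ k, ∀ v i, m v i = v (i + k)

instance : EMap (fun v => v) := ⟨0, fun _ _ => rfl⟩
instance : EMap tl := ⟨1, fun _ _ => rfl⟩
instance EMap.tl_inst {m : Env → Env} [h : EMap m] : EMap (fun v => tl (m v)) := by
  obtain ⟨k, hk⟩ := h.out
  refine ⟨k + 1, fun v i => ?_⟩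
  rw [Env.tl_apply, hk]
  congr 1
  omega

instance DfnF.var_inst {m : Env → Env} [h : EMap m] {i : ℕ} : DfnF W A (fun v => m v i) := by
  obtain ⟨k, hk⟩ := h.out
  constructor
  · intro v hv
    rw [hk]
    exact hv _
  · exact (Dfn.eq_var 0 (i + k + 1)).of_iff fun v _ => by rw [hk]; rfl

theorem DfnF.const [hA : Par W A] {c : V} (hc : c ∈ A) : DfnF W A (fun _ => c) :=
  ⟨fun _ _ => hA.sub hc,
    ⟨2, .eq 0 1, ![.inl 0, .inr ⟨c, hc⟩], fun _ _ => Iff.rfl⟩⟩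

instance DfnF.const_inst [hA : Par W A] {c : V} [hc : Fact (c ∈ A)] : DfnF W A (fun _ => c) :=
  DfnF.const hc.out

end Basic

/-! ## Good classes -/

/-- Transitive classes with enough closure for definable recursion. -/
class Good (W : Set V) : Prop where
  trans : ∀ x ∈ W, ∀ y ∈ x, y ∈ W
  empty : ∅ ∈ W
  upair : ∀ a ∈ W, ∀ b ∈ W, ({a, b} : V) ∈ W
  sUnion : ∀ a ∈ W, (⋃₀ a : V) ∈ W
  sep' : ∀ P : Env → Prop, Dfn W W P → ∀ a ∈ W, ∀ v, EIn W v →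
    ZFSet.sep (fun x => P (cons x v)) a ∈ W
  coll : ∀ a ∈ W, ∀ b ∈ W, ∀ f : V → V → V, (∀ x ∈ a, ∀ y ∈ b, f x y ∈ W) →
    ∃ c ∈ W, ∀ x ∈ a, ∀ y ∈ b, f x y ∈ c

section GoodDfn
variable {W A : Set V} [hW : Good W]

instance Dfn.exB_inst {t : Env → V} {P : V → Env → Prop} [ht : DfnF W A t]
    [hP : Dfn W A (fun v => P (v 0) (tl v))] : Dfn W A (fun v => ∃ x ∈ t v, P x v) := by
  have h2 := ht.shift
  refine Dfn.of_iff (P := fun v => ∃ x ∈ W, x ∈ t v ∧ P x v) inferInstance fun v hv => ?_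
  exact ⟨fun ⟨x, h, h'⟩ => ⟨x, hW.trans _ (ht.mem' v hv) _ h, h, h'⟩,
    fun ⟨x, _, h⟩ => ⟨x, h⟩⟩

instance Dfn.allB_inst {t : Env → V} {P : V → Env → Prop} [ht : DfnF W A t]
    [hP : Dfn W A (fun v => P (v 0) (tl v))] : Dfn W A (fun v => ∀ x ∈ t v, P x v) :=
  Dfn.of_iff (P := fun v => ¬ ∃ x ∈ t v, ¬ P x v) inferInstance fun v _ => by push Not; rfl

instance Dfn.subset_inst {s t : Env → V} [hs : DfnF W A s] [ht : DfnF W A t] :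
    Dfn W A (fun v => s v ⊆ t v) := by
  have := ht.shift
  exact Dfn.of_iff (P := fun v => ∀ x ∈ s v, x ∈ t v) inferInstance fun v _ => Iff.rfl

/-- A term is definable when its membership relation is. -/
theorem DfnF.of_mem {t : Env → V} (h : ∀ v, EIn W v → t v ∈ W)
    (h' : Dfn W A (fun v => v 0 ∈ t (tl v))) : DfnF W A t := by
  refine ⟨h, ?_⟩
  have h2 : Dfn W A (fun v => v 0 ∈ t (tl (tl v))) := by
    have := h'.ren (fun i => Nat.casesOn i 0 (fun j => j + 2))
    exact this
  refine Dfn.of_iff (P := fun v => (∀ x ∈ v 0, x ∈ t (tl v)) ∧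
    ∀ x ∈ W, x ∈ t (tl v) → x ∈ v 0) inferInstance fun v hv => ?_
  constructor
  · intro e
    rw [e]
    exact ⟨fun _ h => h, fun _ _ h => h⟩
  · rintro ⟨h1, h3⟩
    exact ZFSet.ext fun x => ⟨fun hx => h1 x hx,
      fun hx => h3 x (hW.trans _ (h _ hv.tl) _ hx) hx⟩

theorem Good.sep {P : V → Prop} (hP : Dfn W W (fun v => P (v 0))) {a : V} (ha : a ∈ W) :
    ZFSet.sep P a ∈ W :=
  hW.sep' _ hP a ha (fun _ => ∅) fun _ => hW.empty

/-- Subsets of members of `W` that are definable with parameters. -/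
theorem DfnF.of_bdd [hA : Par W A] {t : Env → V}
    (hb : ∀ v, EIn W v → ∃ c ∈ W, ∀ x ∈ t v, x ∈ c)
    (h' : Dfn W A (fun v => v 0 ∈ t (tl v))) : DfnF W A t := by
  refine DfnF.of_mem (fun v hv => ?_) h'
  obtain ⟨c, hc, hc'⟩ := hb v hv
  have := hW.sep' _ (h'.mono hA.sub) c hc v hv
  convert this using 1
  ext x
  simp only [ZFSet.mem_sep, Env.cons_zero]
  exact ⟨fun h => ⟨hc' x h, h⟩, fun h => h.2⟩

instance DfnF.sep_inst [Par W A] {t : Env → V} {P : Env → V → Prop} [ht : DfnF W A t]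
    [hP : Dfn W A (fun v => P (tl v) (v 0))] :
    DfnF W A (fun v => ZFSet.sep (P v) (t v)) := by
  have := ht.shift
  refine DfnF.of_bdd (fun v hv => ⟨t v, ht.mem' v hv, fun x hx => (ZFSet.mem_sep.1 hx).1⟩) ?_
  simp only [ZFSet.mem_sep]
  infer_instance

instance DfnF.empty_inst : DfnF W A (fun _ => ∅) :=
  DfnF.of_mem (fun _ _ => hW.empty) (by simp only [ZFSet.notMem_empty]; infer_instance)

instance DfnF.upair_inst {s t : Env → V} [hs : DfnF W A s] [ht : DfnF W A t] :
    DfnF W A (fun v => {s v, t v}) := by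
  have := hs.shift
  have := ht.shift
  refine DfnF.of_mem (fun v hv => hW.upair _ (hs.mem' v hv) _ (ht.mem' v hv)) ?_
  simp only [ZFSet.mem_pair]
  infer_instance

instance DfnF.singleton_inst {s : Env → V} [hs : DfnF W A s] :
    DfnF W A (fun v => {s v}) := by
  have := DfnF.upair_inst (W := W) (A := A) (s := s) (t := s)
  simpa using this

instance DfnF.pair_inst {s t : Env → V} [hs : DfnF W A s] [ht : DfnF W A t] :
    DfnF W A (fun v => pair (s v) (t v)) := by
  unfold pair
  infer_instance

instance DfnF.sUnion_inst {s : Env → V} [hs : DfnF W A s] :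
    DfnF W A (fun v => (⋃₀ (s v) : V)) := by
  have := hs.shift
  refine DfnF.of_mem (fun v hv => hW.sUnion _ (hs.mem' v hv)) ?_
  simp only [ZFSet.mem_sUnion]
  infer_instance

instance DfnF.union_inst {s t : Env → V} [hs : DfnF W A s] [ht : DfnF W A t] :
    DfnF W A (fun v => s v ∪ t v) := by
  have : ∀ v, s v ∪ t v = ⋃₀ {s v, t v} := fun v => by simp
  simp only [this]
  infer_instance

instance DfnF.insert_inst {s t : Env → V} [hs : DfnF W A s] [ht : DfnF W A t] :
    DfnF W A (fun v => insert (s v) (t v)) := by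
  have : ∀ v, insert (s v) (t v) = {s v} ∪ t v := fun v => by ext; simp
  simp only [this]
  infer_instance

instance DfnF.inter_inst [Par W A] {s t : Env → V} [hs : DfnF W A s] [ht : DfnF W A t] :
    DfnF W A (fun v => s v ∩ t v) := by
  have := hs.shift
  have := ht.shift
  have : ∀ v, s v ∩ t v = ZFSet.sep (fun x => x ∈ t v) (s v) := fun v => by ext; simp
  simp only [this]
  infer_instance

instance DfnF.diff_inst [Par W A] {s t : Env → V} [hs : DfnF W A s] [ht : DfnF W A t] :
    DfnF W A (fun v => s v \ t v) := by
  have := hs.shift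
  have := ht.shift
  have : ∀ v, s v \ t v = ZFSet.sep (fun x => x ∉ t v) (s v) := fun v => by ext; simp
  simp only [this]
  infer_instance

theorem natZ_mem_good (k : ℕ) : natZ k ∈ W := by
  induction k with
  | zero => exact hW.empty
  | succ k ih =>
    have := (DfnF.insert_inst (W := W) (A := W) (s := fun v => v 0) (t := fun v => v 0)).mem'
      (fun _ => natZ k) (fun _ => ih)
    exact this

instance DfnF.natZ_inst (k : ℕ) : DfnF W A (fun _ => natZ k) := by
  induction k with
  | zero => exact DfnF.empty_inst
  | succ k ih => exact DfnF.insert_inst (s := fun _ => natZ k) (t := fun _ => natZ k)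

theorem Good.pair_mem {a b : V} (ha : a ∈ W) (hb : b ∈ W) : pair a b ∈ W :=
  hW.upair _ (by have := hW.upair _ ha _ ha; simpa using this) _ (hW.upair _ ha _ hb)

theorem Good.of_pair_mem {a b : V} (h : pair a b ∈ W) : a ∈ W ∧ b ∈ W := by
  have h2 : ({a, b} : V) ∈ W := hW.trans _ h _ (by simp [pair])
  exact ⟨hW.trans _ h2 _ (by simp), hW.trans _ h2 _ (by simp)⟩

theorem Good.union_mem {a b : V} (ha : a ∈ W) (hb : b ∈ W) : a ∪ b ∈ W := by
  have := hW.sUnion _ (hW.upair _ ha _ hb)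
  simpa using this

theorem Good.coll1 {a : V} (ha : a ∈ W) {f : V → V} (h : ∀ x ∈ a, f x ∈ W) :
    ∃ c ∈ W, ∀ x ∈ a, f x ∈ c := by
  have h1 : ({∅} : V) ∈ W := by simpa using hW.upair _ hW.empty _ hW.empty
  obtain ⟨c, hc, hc'⟩ := hW.coll a ha _ h1 (fun x _ => f x) (fun x hx _ _ => h x hx)
  exact ⟨c, hc, fun x hx => hc' x hx ∅ (by simp)⟩

instance DfnF.prod_inst [Par W A] {s t : Env → V} [hs : DfnF W A s] [ht : DfnF W A t] :
    DfnF W A (fun v => (s v).prod (t v)) := by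
  have := hs.shift
  have := ht.shift.shift
  refine DfnF.of_bdd (fun v hv => ?_) ?_
  · obtain ⟨c, hc, hc'⟩ := hW.coll _ (hs.mem' v hv) _ (ht.mem' v hv) pair
      (fun x hx y hy => hW.pair_mem (hW.trans _ (hs.mem' v hv) _ hx)
        (hW.trans _ (ht.mem' v hv) _ hy))
    refine ⟨c, hc, fun z hz => ?_⟩
    obtain ⟨a, ha, b, hb, rfl⟩ := ZFSet.mem_prod.1 hz
    exact hc' a ha b hb
  · simp only [ZFSet.mem_prod]
    infer_instance

end GoodDfn

theorem mem_img {f : V → V} {x y : V} : y ∈ img f x ↔ ∃ z ∈ x, f z = y := by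
  unfold img
  exact @ZFSet.mem_image f (Classical.allZFSetDefinable _) x y

/-- The graph of `f` restricted to the set `a`. -/
def grph (f : V → V) (a : V) : V := img (fun x => pair x (f x)) a

theorem mem_grph {f : V → V} {a p : V} : p ∈ grph f a ↔ ∃ z ∈ a, pair z (f z) = p := mem_img

theorem pair_mem_grph {f : V → V} {a x y : V} : pair x y ∈ grph f a ↔ x ∈ a ∧ y = f x := by
  rw [mem_grph]
  constructor
  · rintro ⟨z, hz, h⟩
    obtain ⟨rfl, rfl⟩ := pair_inj.1 h
    exact ⟨hz, rfl⟩
  · rintro ⟨h, rfl⟩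
    exact ⟨x, h, rfl⟩

section Recursion
variable {W A : Set V}

theorem DfnF.comp1 {f : V → V} (h : DfnF W A (fun v => f (v 0))) {s : Env → V}
    (hs : DfnF W A s) : DfnF W A (fun v => f (s v)) where
  mem' v hv := h.mem' (fun _ => s v) fun _ => hs.mem' v hv
  graph := by
    have h1 : Dfn W A (fun v => v 0 = f (v 1)) := h.graph
    have := hs.shift
    exact Dfn.comp2 (R := fun x y => x = f y) h1
      (DfnF.var_inst (m := fun v => v) (i := 0)) this

theorem DfnF.comp2 {f : V → V → V} (h : DfnF W A (fun v => f (v 0) (v 1))) {s t : Env → V}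
    (hs : DfnF W A s) (ht : DfnF W A t) : DfnF W A (fun v => f (s v) (t v)) where
  mem' v hv := h.mem' (cons (s v) fun _ => t v) (EIn.cons (hs.mem' v hv) fun _ => ht.mem' v hv)
  graph := by
    have h1 : Dfn W A (fun v => v 0 = f (v 1) (v 2)) := h.graph
    have h2 := hs.shift
    have h3 := ht.shift
    exact Dfn.comp3 (R := fun x y z => x = f y z) h1
      (DfnF.var_inst (m := fun v => v) (i := 0)) h2 h3

variable [hW : Good W] [hA : Par W A]

variable (W) in
def Attempt (pred : V → V) (Γ : V → V → V → Prop) (x g : V) : Prop :=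
  (∀ p ∈ g, ∃ z ∈ pred x, ∃ y ∈ W, p = pair z y) ∧
  ∀ z ∈ pred x, ∃ y ∈ W, pair z y ∈ g ∧ (∀ y' ∈ W, pair z y' ∈ g → y' = y) ∧
    Γ z (ZFSet.sep (fun p => ∃ u ∈ pred z, ∃ w ∈ W, p = pair u w) g) y

theorem definable_recursion {C : V → Prop} {pred Φ : V → V} {Γ : V → V → V → Prop}
    (hC : Dfn W A (fun v => C (v 0))) (hpred : DfnF W A (fun v => pred (v 0)))
    (hΓ : Dfn W A (fun v => Γ (v 0) (v 1) (v 2)))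
    (ind : ∀ Q : V → Prop, (∀ x, C x → (∀ y ∈ pred x, Q y) → Q x) → ∀ x, C x → Q x)
    (hcl : ∀ x, C x → ∀ y ∈ pred x, C y ∧ pred y ⊆ pred x)
    (step : ∀ x ∈ W, C x → grph Φ (pred x) ∈ W → Φ x ∈ W ∧
      ∀ y ∈ W, (Γ x (grph Φ (pred x)) y ↔ y = Φ x)) :
    (∀ x ∈ W, C x → Φ x ∈ W) ∧ Dfn W A (fun v => C (v 0) ∧ v 1 = Φ (v 0)) := by
  have hpr : ∀ {s : Env → V}, DfnF W A s → DfnF W A (fun v => pred (s v)) :=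
    fun hs => DfnF.comp1 hpred hs
  have hpW : ∀ x ∈ W, pred x ∈ W := fun x hx => hpred.mem' (fun _ => x) fun _ => hx
  have hAtt : Dfn W A (fun v => Attempt W pred Γ (v 0) (v 1)) := by
    unfold Attempt
    have i1 : ∀ m : Env → Env, ∀ i : ℕ, EMap m → DfnF W A (fun v => pred (m v i)) :=
      fun m i _ => hpr DfnF.var_inst
    have i2 : Dfn W A (fun v => Γ (v 1) (ZFSet.sep (fun p => ∃ u ∈ pred (v 1), ∃ w ∈ W,
        p = pair u w) (tl (tl v) 1)) (v 0)) := by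
      have a1 : DfnF W A (fun v => v 1) := DfnF.var_inst (m := fun v => v)
      have a2 : DfnF W A (fun v => v 0) := DfnF.var_inst (m := fun v => v)
      have a3 : DfnF W A (fun v => pred (v 1)) := i1 (fun v => v) 1 inferInstance
      have a4 : DfnF W A (fun v => pred (tl v 1)) := i1 tl 1 inferInstance
      exact Dfn.comp3 hΓ a1 inferInstance a2
    have i2' : Dfn W A (fun v => Γ (tl v 0) (ZFSet.sep (fun p => ∃ u ∈ pred (tl v 0), ∃ w ∈ W,
        p = pair u w) (tl (tl v) 1)) (v 0)) := i2
    have i3 := i1 (fun v => v) 0 inferInstance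
    have i4 := i1 (fun v => tl v) 0 inferInstance
    infer_instance
  have key : ∀ x ∈ W, C x → grph Φ (pred x) ∈ W →
      ∀ g ∈ W, (Attempt W pred Γ x g ↔ g = grph Φ (pred x)) := by
    intro x hx hCx hgx
    have hz : ∀ z ∈ pred x, grph Φ (pred z) ∈ W := by
      intro z hz
      have hd : DfnF W A (fun v => ZFSet.sep (fun p => ∃ u ∈ pred (v 1), ∃ w ∈ W,
        p = pair u w) (v 0)) := by
        have : DfnF W A (fun v => pred (tl v 1)) := hpr DfnF.var_inst
        infer_instance
      have := hd.mem' (cons (grph Φ (pred x)) fun _ => z)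
        (EIn.cons hgx fun _ => hW.trans _ (hpW x hx) _ hz)
      convert this using 1
      ext p
      simp only [ZFSet.mem_sep, mem_grph, Env.cons_zero]
      constructor
      · rintro ⟨u, hu, rfl⟩
        have hu' := (hcl x hCx z hz).2 hu
        refine ⟨⟨u, hu', rfl⟩, u, hu, Φ u, ?_, rfl⟩
        exact (hW.of_pair_mem (hW.trans _ hgx _ (mem_grph.2 ⟨u, hu', rfl⟩))).2
      · rintro ⟨⟨u, hu, rfl⟩, w, hw, y, hy, h⟩
        obtain ⟨rfl, -⟩ := pair_inj.1 h
        exact ⟨u, hw, rfl⟩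
    have hPhi : ∀ z ∈ pred x, Φ z ∈ W := fun z hz =>
      (hW.of_pair_mem (hW.trans _ hgx _ (mem_grph.2 ⟨z, hz, rfl⟩))).2
    have hrest : ∀ z ∈ pred x, ∀ g, (∀ u ∈ pred z, ∀ y ∈ W, (pair u y ∈ g ↔ y = Φ u)) →
        ZFSet.sep (fun p => ∃ u ∈ pred z, ∃ w ∈ W, p = pair u w) g = grph Φ (pred z) := by
      intro z hz g h
      ext p
      simp only [ZFSet.mem_sep, mem_grph]
      constructor
      · rintro ⟨hp, u, hu, w, hw, rfl⟩
        exact ⟨u, hu, by rw [(h u hu w hw).1 hp]⟩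
      · rintro ⟨u, hu, rfl⟩
        have := hPhi u ((hcl x hCx z hz).2 hu)
        exact ⟨(h u hu _ this).2 rfl, u, hu, _, this, rfl⟩
    intro g hg
    constructor
    · rintro ⟨h1, h2⟩
      have h3 : ∀ z, C z → z ∈ pred x → ∀ y ∈ W, (pair z y ∈ g ↔ y = Φ z) := by
        refine ind _ fun z hCz IH hzx => ?_
        obtain ⟨y0, hy0, hy1, hy2, hy3⟩ := h2 z hzx
        rw [hrest z hzx g fun u hu => IH u hu ((hcl x hCx z hzx).2 hu)] at hy3
        have := ((step z (hW.trans _ (hpW x hx) _ hzx) hCz (hz z hzx)).2 y0 hy0).1 hy3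
        subst this
        exact fun y hy => ⟨hy2 y hy, fun h => h ▸ hy1⟩
      ext p
      rw [mem_grph]
      constructor
      · intro hp
        obtain ⟨z, hz, y, hy, rfl⟩ := h1 p hp
        exact ⟨z, hz, by rw [(h3 z (hcl x hCx z hz).1 hz y hy).1 hp]⟩
      · rintro ⟨z, hz, rfl⟩
        exact (h3 z (hcl x hCx z hz).1 hz _ (hPhi z hz)).2 rfl
    · rintro rfl
      refine ⟨fun p hp => ?_, fun z hzx => ⟨Φ z, hPhi z hzx, mem_grph.2 ⟨z, hzx, rfl⟩,
        fun y' _ h => (pair_mem_grph.1 h).2, ?_⟩⟩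
      · obtain ⟨z, hz, rfl⟩ := mem_grph.1 hp
        exact ⟨z, hz, _, hPhi z hz, rfl⟩
      · rw [hrest z hzx _ fun u hu y _ => ?_]
        · exact ((step z (hW.trans _ (hpW x hx) _ hzx) (hcl x hCx z hzx).1 (hz z hzx)).2 _
            (hPhi z hzx)).2 rfl
        · rw [pair_mem_grph]
          exact ⟨fun h => h.2, fun h => ⟨(hcl x hCx z hzx).2 hu, h⟩⟩
  have key2 : ∀ x ∈ W, C x → grph Φ (pred x) ∈ W →
      ∀ y ∈ W, ((∃ g ∈ W, Attempt W pred Γ x g ∧ Γ x g y) ↔ y = Φ x) := by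
    intro x hx hCx hgx y hy
    rw [← (step x hx hCx hgx).2 y hy]
    constructor
    · rintro ⟨g, hg, h1, h2⟩
      rwa [(key x hx hCx hgx g hg).1 h1] at h2
    · exact fun h => ⟨_, hgx, (key x hx hCx hgx _ hgx).2 rfl, h⟩
  have hPsi : Dfn W A (fun v => ∃ g ∈ W, Attempt W pred Γ (v 0) g ∧ Γ (v 0) g (v 1)) := by
    have a1 : DfnF W A (fun v => v 1) := DfnF.var_inst (m := fun v => v)
    have a2 : DfnF W A (fun v => v 0) := DfnF.var_inst (m := fun v => v)
    have a3 : DfnF W A (fun v => v 2) := DfnF.var_inst (m := fun v => v)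
    have b1 : Dfn W A (fun v => Attempt W pred Γ (tl v 0) (v 0)) := Dfn.comp2 hAtt a1 a2
    have b2 : Dfn W A (fun v => Γ (tl v 0) (v 0) (tl v 1)) := Dfn.comp3 hΓ a1 a2 a3
    infer_instance
  have main : ∀ x, C x → x ∈ W → grph Φ (pred x) ∈ W := by
    refine ind _ fun x hCx IH hx => ?_
    have hzW : ∀ z ∈ pred x, z ∈ W := fun z hz => hW.trans _ (hpW x hx) _ hz
    have hPhi : ∀ z ∈ pred x, Φ z ∈ W := fun z hz =>
      (step z (hzW z hz) (hcl x hCx z hz).1 (IH z hz (hzW z hz))).1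
    obtain ⟨c, hc, hc'⟩ := hW.coll1 (hpW x hx) (f := fun z => pair z (Φ z))
      fun z hz => hW.pair_mem (hzW z hz) (hPhi z hz)
    have hd : DfnF W A (fun v => ZFSet.sep (fun p => ∃ z ∈ v 1, ∃ y ∈ W, p = pair z y ∧
        ∃ g ∈ W, Attempt W pred Γ z g ∧ Γ z g y) (v 0)) := by
      have b : Dfn W A (fun v => ∃ g ∈ W, Attempt W pred Γ (tl v 0) g ∧ Γ (tl v 0) g (v 0)) :=
        Dfn.comp2 (R := fun z y => ∃ g ∈ W, Attempt W pred Γ z g ∧ Γ z g y) hPsi (DfnF.var_inst (m := tl) (i := 0)) (DfnF.var_inst (m := fun v => v) (i := 0))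
      infer_instance
    have := hd.mem' (cons c fun _ => pred x) (EIn.cons hc fun _ => hpW x hx)
    convert this using 1
    ext p
    simp only [ZFSet.mem_sep, Env.cons_zero, Env.cons_succ, mem_grph]
    change _ ↔ p ∈ c ∧ ∃ z ∈ pred x, _
    constructor
    · rintro ⟨z, hz, rfl⟩
      exact ⟨hc' z hz, z, hz, _, hPhi z hz, rfl,
        (key2 z (hzW z hz) (hcl x hCx z hz).1 (IH z hz (hzW z hz)) _ (hPhi z hz)).2 rfl⟩
    · rintro ⟨_, z, hz, y, hy, rfl, h⟩
      rw [key2 z (hzW z hz) (hcl x hCx z hz).1 (IH z hz (hzW z hz)) _ hy] at h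
      exact ⟨z, hz, by rw [h]⟩
  refine ⟨fun x hx hCx => (step x hx hCx (main x hCx hx)).1, ?_⟩
  refine Dfn.of_iff (P := fun v => C (v 0) ∧
    ∃ g ∈ W, Attempt W pred Γ (v 0) g ∧ Γ (v 0) g (v 1)) inferInstance fun v hv => ?_
  refine and_congr_right fun h => ?_
  exact (key2 _ (hv 0) h (main _ h (hv 0)) _ (hv 1)).symm

end Recursion

/-! ## Ordinals -/

abbrev oz (o : Ordinal.{0}) : V := Ordinal.toZFSet o

theorem isOrd_iff_isOrdinal {x : V} : IsOrd x ↔ x.IsOrdinal :=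
  (ZFSet.isOrdinal_iff_forall_mem_isTransitive).symm

theorem isOrd_iff {x : V} : IsOrd x ↔ ∃ o, x = oz o := by
  rw [isOrd_iff_isOrdinal, ZFSet.isOrdinal_iff_mem_range_toZFSet]
  exact ⟨fun ⟨o, h⟩ => ⟨o, h.symm⟩, fun ⟨o, h⟩ => ⟨o, h.symm⟩⟩

theorem isOrd_oz (o : Ordinal.{0}) : IsOrd (oz o) := isOrd_iff.2 ⟨o, rfl⟩

theorem mem_oz {x : V} {o : Ordinal.{0}} : x ∈ oz o ↔ ∃ a < o, x = oz a := by
  rw [Ordinal.mem_toZFSet_iff]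
  exact ⟨fun ⟨a, h, e⟩ => ⟨a, h, e.symm⟩, fun ⟨a, h, e⟩ => ⟨a, h, e.symm⟩⟩

theorem oz_mem {a b : Ordinal.{0}} : oz a ∈ oz b ↔ a < b := Ordinal.toZFSet_mem_toZFSet_iff

theorem oz_inj {a b : Ordinal.{0}} : oz a = oz b ↔ a = b := Ordinal.toZFSet_injective.eq_iff

theorem oz_sub {a b : Ordinal.{0}} : oz a ⊆ oz b ↔ a ≤ b := by
  constructor
  · intro h
    by_contra hc
    have := h (oz_mem.2 (not_le.1 hc))
    exact lt_irrefl _ (oz_mem.1 this)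
  · intro h x hx
    obtain ⟨c, hc, rfl⟩ := mem_oz.1 hx
    exact oz_mem.2 (hc.trans_le h)

theorem rank_oz (o : Ordinal.{0}) : ZFSet.rank (oz o) = o := by simp [oz]

theorem oz_succ (a : Ordinal.{0}) : oz (Order.succ a) = insert (oz a) (oz a) := by
  ext x
  simp only [ZFSet.mem_insert_iff, mem_oz, Order.lt_succ_iff]
  constructor
  · rintro ⟨b, hb, rfl⟩
    rcases hb.eq_or_lt with rfl | h
    · exact Or.inl rfl
    · exact Or.inr ⟨b, h, rfl⟩
  · rintro (rfl | ⟨b, hb, rfl⟩)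
    · exact ⟨a, le_rfl, rfl⟩
    · exact ⟨b, hb.le, rfl⟩

theorem oz_zero : oz 0 = ∅ := by
  ext x
  simp

theorem natZ_eq (k : ℕ) : natZ k = oz k := by
  induction k with
  | zero => simp [natZ]
  | succ k ih =>
    rw [natZ, ih, ← oz_succ]
    simp

theorem oz_max (a b : Ordinal.{0}) : oz (max a b) = oz a ∪ oz b := by
  rcases le_total a b with h | h
  · rw [max_eq_right h]
    ext x
    rw [ZFSet.mem_union]
    exact ⟨Or.inr, fun h' => h'.elim (fun h'' => oz_sub.2 h h'') id⟩
  · rw [max_eq_left h]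
    ext x
    rw [ZFSet.mem_union]
    exact ⟨Or.inl, fun h' => h'.elim id (fun h'' => oz_sub.2 h h'')⟩

theorem ord_induction {Q : V → Prop} (h : ∀ x, IsOrd x → (∀ y ∈ x, Q y) → Q x) :
    ∀ x, IsOrd x → Q x := by
  intro x hx
  obtain ⟨o, rfl⟩ := isOrd_iff.1 hx
  clear hx
  induction o using WellFoundedLT.induction with
  | ind o ih =>
    refine h _ (isOrd_oz o) fun y hy => ?_
    obtain ⟨a, ha, rfl⟩ := mem_oz.1 hy
    exact ih a ha

/-! ## Gödel pairing -/

def gkey (p : Ordinal.{0} × Ordinal.{0}) : Ordinal.{0} ×ₗ (Ordinal.{0} ×ₗ Ordinal.{0}) :=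
  toLex (max p.1 p.2, toLex (p.1, p.2))

def GLt (p q : Ordinal.{0} × Ordinal.{0}) : Prop := gkey p < gkey q

theorem gLt_iff {p q : Ordinal.{0} × Ordinal.{0}} : GLt p q ↔
    max p.1 p.2 < max q.1 q.2 ∨ (max p.1 p.2 = max q.1 q.2 ∧
      (p.1 < q.1 ∨ (p.1 = q.1 ∧ p.2 < q.2))) := by
  simp only [GLt, gkey, Prod.Lex.toLex_lt_toLex]

theorem gkey_inj : Function.Injective gkey := by
  rintro ⟨a, b⟩ ⟨c, d⟩ h
  simp only [gkey, EmbeddingLike.apply_eq_iff_eq, Prod.mk.injEq] at h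
  exact Prod.ext h.2.1 h.2.2

theorem gLt_wf : WellFounded GLt := InvImage.wf gkey wellFounded_lt

theorem gLt_tri (p q : Ordinal.{0} × Ordinal.{0}) : GLt p q ∨ p = q ∨ GLt q p := by
  rcases lt_trichotomy (gkey p) (gkey q) with h | h | h
  · exact Or.inl h
  · exact Or.inr (Or.inl (gkey_inj h))
  · exact Or.inr (Or.inr h)

instance small_gLt (p : Ordinal.{0} × Ordinal.{0}) : Small.{0} {q // GLt q p} := by
  have : {q | GLt q p} ⊆ Set.Iic (max p.1 p.2) ×ˢ Set.Iic (max p.1 p.2) := by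
    intro q hq
    have h : max q.1 q.2 ≤ max p.1 p.2 := by
      rcases gLt_iff.1 hq with h | h
      · exact h.le
      · exact h.1.le
    exact ⟨(le_max_left _ _).trans h, (le_max_right _ _).trans h⟩
  exact small_subset this

/-- Gödel's pairing function on ordinals. -/
def J : Ordinal.{0} × Ordinal.{0} → Ordinal.{0} :=
  gLt_wf.fix fun p ih => ⨆ q : {q // GLt q p}, Order.succ (ih q.1 q.2)

theorem J_eq (p : Ordinal.{0} × Ordinal.{0}) :
    J p = ⨆ q : {q // GLt q p}, Order.succ (J q.1) := by
  rw [J, WellFounded.fix_eq]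

theorem J_lt {p q : Ordinal.{0} × Ordinal.{0}} (h : GLt p q) : J p < J q := by
  rw [J_eq q]
  exact (Order.lt_succ _).trans_le
    (Ordinal.le_iSup (fun q' : {q' // GLt q' q} => Order.succ (J q'.1)) ⟨p, h⟩)

theorem J_lt_iff {p q : Ordinal.{0} × Ordinal.{0}} : J p < J q ↔ GLt p q := by
  refine ⟨fun h => ?_, J_lt⟩
  rcases gLt_tri p q with h' | rfl | h'
  · exact h'
  · exact absurd h (lt_irrefl _)
  · exact absurd h (J_lt h').not_gt

theorem J_inj : Function.Injective J := by
  intro p q h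
  rcases gLt_tri p q with h' | h' | h'
  · exact absurd h (J_lt h').ne
  · exact h'
  · exact absurd h (J_lt h').ne'

theorem lt_J {p : Ordinal.{0} × Ordinal.{0}} {ξ : Ordinal.{0}} :
    ξ < J p ↔ ∃ q, GLt q p ∧ J q = ξ := by
  constructor
  · induction p using gLt_wf.induction generalizing ξ with
    | _ p ih =>
      intro h
      rw [J_eq, Ordinal.lt_iSup_iff] at h
      obtain ⟨⟨q, hq⟩, h⟩ := h
      rcases (Order.lt_succ_iff.1 h).eq_or_lt with h | h
      · exact ⟨q, hq, h.symm⟩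
      · obtain ⟨r, hr, rfl⟩ := ih q hq h
        exact ⟨r, J_lt_iff.1 (h.trans (J_lt hq)), rfl⟩
  · rintro ⟨q, hq, rfl⟩
    exact J_lt hq

theorem le_J_zero (c : Ordinal.{0}) : c ≤ J (0, c) := by
  induction c using WellFoundedLT.induction with
  | ind c ih =>
    refine le_of_forall_lt fun d hd => (ih d hd).trans_lt (J_lt ?_)
    rw [gLt_iff]
    simp [hd]

theorem max_le_J (a b : Ordinal.{0}) : max a b ≤ J (a, b) := by
  refine (le_J_zero _).trans ?_
  by_contra h
  rw [not_le, J_lt_iff, gLt_iff] at h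
  rcases eq_or_ne a 0 with rfl | ha
  · simp at h
  · simp only [zero_le, sup_of_le_right] at h
    simp [ha] at h

theorem left_le_J (a b : Ordinal.{0}) : a ≤ J (a, b) := (le_max_left a b).trans (max_le_J a b)
theorem right_le_J (a b : Ordinal.{0}) : b ≤ J (a, b) := (le_max_right a b).trans (max_le_J a b)

theorem lt_J_of_pos {i c : Ordinal.{0}} (hi : 0 < i) : c < J (i, c) := by
  refine (le_J_zero c).trans_lt (J_lt ?_)
  rw [gLt_iff]
  rcases lt_or_ge c i with h | h
  · left
    simp [h]
  · right
    simp [h, hi]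

theorem J_surj : Function.Surjective J := by
  intro ξ
  have : ξ < J (Order.succ ξ, 0) := (Order.lt_succ ξ).trans_le (left_le_J _ _)
  obtain ⟨q, _, h⟩ := lt_J.1 this
  exact ⟨q, h⟩

def unJ (ξ : Ordinal.{0}) : Ordinal.{0} × Ordinal.{0} := (J_surj ξ).choose

theorem J_unJ (ξ : Ordinal.{0}) : J (unJ ξ) = ξ := (J_surj ξ).choose_spec
theorem unJ_J (p : Ordinal.{0} × Ordinal.{0}) : unJ (J p) = p := J_inj (J_unJ _)

theorem unJ_fst_le (ξ : Ordinal.{0}) : (unJ ξ).1 ≤ ξ := by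
  conv_rhs => rw [← J_unJ ξ]
  exact left_le_J _ _

theorem unJ_snd_le (ξ : Ordinal.{0}) : (unJ ξ).2 ≤ ξ := by
  conv_rhs => rw [← J_unJ ξ]
  exact right_le_J _ _

theorem unJ_snd_lt {ξ : Ordinal.{0}} (h : 0 < (unJ ξ).1) : (unJ ξ).2 < ξ := by
  conv_rhs => rw [← J_unJ ξ]
  exact lt_J_of_pos h

/-! ## Gödel operations and the enumeration of the constructible sets -/

def rng (a : V) : V := ZFSet.sep (fun y => ∃ x ∈ (⋃₀ (⋃₀ a) : V), pair x y ∈ a) (⋃₀ (⋃₀ a))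

theorem fst_mem_UU {x y a : V} (h : pair x y ∈ a) : x ∈ (⋃₀ (⋃₀ a) : V) :=
  ZFSet.mem_sUnion.2 ⟨{x}, ZFSet.mem_sUnion.2 ⟨_, h, by simp [pair]⟩, by simp⟩

theorem snd_mem_UU {x y a : V} (h : pair x y ∈ a) : y ∈ (⋃₀ (⋃₀ a) : V) :=
  ZFSet.mem_sUnion.2 ⟨{x, y}, ZFSet.mem_sUnion.2 ⟨_, h, by simp [pair]⟩, by simp⟩

theorem mem_rng {a y : V} : y ∈ rng a ↔ ∃ x, pair x y ∈ a := by
  simp only [rng, ZFSet.mem_sep]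
  exact ⟨fun ⟨_, x, _, h⟩ => ⟨x, h⟩, fun ⟨x, h⟩ => ⟨snd_mem_UU h, x, fst_mem_UU h, h⟩⟩

def opE (a N : V) : V := ZFSet.sep (fun z => ∃ x ∈ a, ∃ y ∈ a, ∃ w ∈ N,
  z = pair x (pair y w) ∧ x ∈ y) (a.prod (a.prod N))

def opEq (a N : V) : V := ZFSet.sep (fun z => ∃ x ∈ a, ∃ w ∈ N,
  z = pair x (pair x w)) (a.prod (a.prod N))

def opSwap (R : V) : V := ZFSet.sep (fun z => ∃ x ∈ (⋃₀ (⋃₀ (⋃₀ (⋃₀ R))) : V),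
  ∃ y ∈ (⋃₀ (⋃₀ R) : V), ∃ w ∈ (⋃₀ (⋃₀ (⋃₀ (⋃₀ R))) : V), z = pair x (pair y w) ∧
    pair y (pair x w) ∈ R)
  ((⋃₀ (⋃₀ (⋃₀ (⋃₀ R))) : V).prod ((⋃₀ (⋃₀ R) : V).prod (⋃₀ (⋃₀ (⋃₀ (⋃₀ R))))))

def opSec (R p : V) : V := ZFSet.sep (fun x => pair x p ∈ R) (⋃₀ (⋃₀ R))

theorem mem_opE {a N z : V} : z ∈ opE a N ↔
    ∃ x ∈ a, ∃ y ∈ a, ∃ w ∈ N, z = pair x (pair y w) ∧ x ∈ y := by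
  simp only [opE, ZFSet.mem_sep, and_iff_right_iff_imp]
  rintro ⟨x, hx, y, hy, w, hw, rfl, -⟩
  simp [*]

theorem mem_opEq {a N z : V} : z ∈ opEq a N ↔ ∃ x ∈ a, ∃ w ∈ N, z = pair x (pair x w) := by
  simp only [opEq, ZFSet.mem_sep, and_iff_right_iff_imp]
  rintro ⟨x, hx, w, hw, rfl⟩
  simp [*]

theorem mem_opSwap {R z : V} : z ∈ opSwap R ↔
    ∃ x y w, z = pair x (pair y w) ∧ pair y (pair x w) ∈ R := by
  simp only [opSwap, ZFSet.mem_sep]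
  constructor
  · rintro ⟨-, x, _, y, _, w, _, h⟩
    exact ⟨x, y, w, h⟩
  · rintro ⟨x, y, w, rfl, h⟩
    have h1 := fst_mem_UU h
    have h2 := fst_mem_UU (snd_mem_UU h)
    have h3 := snd_mem_UU (snd_mem_UU h)
    exact ⟨by simp only [ZFSet.pair_mem_prod]; exact ⟨h2, h1, h3⟩, x, h2, y, h1, w, h3, rfl, h⟩

theorem mem_opSec {R p x : V} : x ∈ opSec R p ↔ pair x p ∈ R := by
  simp only [opSec, ZFSet.mem_sep, and_iff_right_iff_imp]
  exact fst_mem_UU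

/-- The fundamental operations generating the constructible sets. -/
def op : ℕ → V → V → V
  | 0, a, b => {a, b}
  | 1, a, b => a \ b
  | 2, a, b => a.prod b
  | 3, a, _ => rng a
  | 4, a, b => opE a b
  | 5, a, b => opEq a b
  | 6, a, _ => opSwap a
  | _, a, b => opSec a b

def HasOp (α : Ordinal.{0}) (k : ℕ) : Prop := k < 8 ∧ (unJ α).1 = ((k + 1 : ℕ) : Ordinal.{0})

theorem HasOp.unique {α : Ordinal.{0}} {k l : ℕ} (h : HasOp α k) (h' : HasOp α l) : k = l := by
  have := h.2.symm.trans h'.2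
  simpa using this

theorem HasOp.pos {α : Ordinal.{0}} {k : ℕ} (h : HasOp α k) : 0 < (unJ α).1 := by
  rw [h.2]
  exact_mod_cast Nat.succ_pos k

theorem HasOp.lt_fst {α : Ordinal.{0}} {k : ℕ} (h : HasOp α k) :
    (unJ (unJ α).2).1 < α := (unJ_fst_le _).trans_lt (unJ_snd_lt h.pos)

theorem HasOp.lt_snd {α : Ordinal.{0}} {k : ℕ} (h : HasOp α k) :
    (unJ (unJ α).2).2 < α := (unJ_snd_le _).trans_lt (unJ_snd_lt h.pos)

/-- The enumeration of the constructible sets. -/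
def F : Ordinal.{0} → V :=
  wellFounded_lt.fix fun α ih =>
    if h : ∃ k, HasOp α k then
      op h.choose (ih (unJ (unJ α).2).1 h.choose_spec.lt_fst)
        (ih (unJ (unJ α).2).2 h.choose_spec.lt_snd)
    else ZFSet.range (fun ξ : Set.Iio α => ih ξ.1 ξ.2)

theorem F_op' {α : Ordinal.{0}} {k : ℕ} (h : HasOp α k) :
    F α = op k (F (unJ (unJ α).2).1) (F (unJ (unJ α).2).2) := by
  have h' : ∃ k, HasOp α k := ⟨k, h⟩
  rw [F, WellFounded.fix_eq, dif_pos h', h'.choose_spec.unique h]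

theorem F_op {k : ℕ} (hk : k < 8) (a b : Ordinal.{0}) :
    F (J (((k + 1 : ℕ) : Ordinal.{0}), J (a, b))) = op k (F a) (F b) := by
  rw [F_op' (k := k) ⟨hk, by rw [unJ_J]⟩]
  simp [unJ_J]

theorem mem_F_of_not {α : Ordinal.{0}} (h : ¬ ∃ k, HasOp α k) {x : V} :
    x ∈ F α ↔ ∃ ξ < α, x = F ξ := by
  rw [F, WellFounded.fix_eq, dif_neg h]
  simp only [ZFSet.mem_range, Subtype.exists, Set.mem_Iio, exists_prop]
  exact ⟨fun ⟨ξ, h, e⟩ => ⟨ξ, h, e.symm⟩, fun ⟨ξ, h, e⟩ => ⟨ξ, h, e.symm⟩⟩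

def KClass : Set V := Set.range F

theorem op_mem_K {k : ℕ} (hk : k < 8) {a b : V} (ha : a ∈ KClass) (hb : b ∈ KClass) :
    op k a b ∈ KClass := by
  obtain ⟨α, rfl⟩ := ha
  obtain ⟨β, rfl⟩ := hb
  exact ⟨_, F_op hk α β⟩

/-! ## Definability of the enumeration in good classes -/

section
variable {W A : Set V} [hW : Good W] [hA : Par W A]

instance Dfn.isTransitive_inst {s : Env → V} [hs : DfnF W A s] :
    Dfn W A (fun v => (s v).IsTransitive) := by
  have := hs.shift
  unfold ZFSet.IsTransitive
  infer_instance

instance Dfn.isOrd_inst {s : Env → V} [hs : DfnF W A s] :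
    Dfn W A (fun v => IsOrd (s v)) := by
  unfold IsOrd
  infer_instance

instance DfnF.rng_inst {s : Env → V} [hs : DfnF W A s] : DfnF W A (fun v => rng (s v)) := by
  have := hs.shift
  have := hs.shift.shift
  unfold rng
  infer_instance

theorem op_dfn (k : ℕ) : DfnF W A (fun v => op k (v 0) (v 1)) := by
  rcases k with _ | _ | _ | _ | _ | _ | _ | k <;> simp only [op]
  · infer_instance
  · infer_instance
  · infer_instance
  · infer_instance
  · unfold opE
    infer_instance
  · unfold opEq
    infer_instance
  · unfold opSwap
    infer_instance
  · unfold opSec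
    infer_instance

instance DfnF.op_inst {k : ℕ} {s t : Env → V} [hs : DfnF W A s] [ht : DfnF W A t] :
    DfnF W A (fun v => op k (s v) (t v)) := DfnF.comp2 (op_dfn k) hs ht

theorem Good.op_mem {k : ℕ} {a b : V} (ha : a ∈ W) (hb : b ∈ W) : op k a b ∈ W :=
  (op_dfn (W := W) (A := W) k).mem' (cons a fun _ => b) (EIn.cons ha fun _ => hb)

omit hW hA in
theorem Dfn.exLt {P : ℕ → Env → Prop} (n : ℕ) (h : ∀ k, Dfn W A (P k)) :
    Dfn W A (fun v => ∃ k, k < n ∧ P k v) := by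
  induction n with
  | zero => exact (Dfn.const_iff False).of_iff fun v _ => by simp
  | succ n ih =>
    have h1 := h n
    refine Dfn.of_iff (P := fun v => (∃ k, k < n ∧ P k v) ∨ P n v) inferInstance fun v _ => ?_
    constructor
    · rintro ⟨k, hk, hp⟩
      rcases Nat.lt_succ_iff_lt_or_eq.1 hk with h | rfl
      · exact Or.inl ⟨k, h, hp⟩
      · exact Or.inr hp
    · rintro (⟨k, hk, hp⟩ | hp)
      · exact ⟨k, hk.trans (Nat.lt_succ_self n), hp⟩
      · exact ⟨n, Nat.lt_succ_self n, hp⟩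

def OrdPair (x : V) : Prop := ∃ α β, x = pair (oz α) (oz β)

/-- The value of `J` at the pair of ordinals coded by `x`. -/
def Jv (x : V) : V :=
  if h : ∃ p : Ordinal.{0} × Ordinal.{0}, x = pair (oz p.1) (oz p.2) then oz (J h.choose) else ∅

theorem Jv_pair (a b : Ordinal.{0}) : Jv (pair (oz a) (oz b)) = oz (J (a, b)) := by
  have h : ∃ p : Ordinal.{0} × Ordinal.{0}, pair (oz a) (oz b) = pair (oz p.1) (oz p.2) :=
    ⟨(a, b), rfl⟩
  rw [Jv, dif_pos h]
  have := h.choose_spec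
  rw [pair_inj, oz_inj, oz_inj] at this
  congr 2
  exact Prod.ext this.1.symm this.2.symm

def JBound (x : V) : V := insert (⋃₀ (⋃₀ x)) (⋃₀ (⋃₀ x))

/-- The predecessors of a code in the Gödel ordering. -/
def JPred (x : V) : V :=
  ZFSet.sep (fun q => ∃ a ∈ JBound x, ∃ b ∈ JBound x, ∃ c ∈ (⋃₀ x : V), ∃ d ∈ (⋃₀ x : V),
    q = pair a b ∧ x = pair c d ∧
    (a ∪ b ∈ c ∪ d ∨ (a ∪ b = c ∪ d ∧ (a ∈ c ∨ (a = c ∧ b ∈ d)))))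
    ((JBound x).prod (JBound x))

theorem mem_JPred {a b : Ordinal.{0}} {q : V} : q ∈ JPred (pair (oz a) (oz b)) ↔
    ∃ c d, q = pair (oz c) (oz d) ∧ GLt (c, d) (a, b) := by
  have hU : (⋃₀ (pair (oz a) (oz b)) : V) = {oz a, oz b} := by
    ext z
    simp only [pair, ZFSet.mem_sUnion, ZFSet.mem_pair, exists_eq_or_imp, ZFSet.mem_singleton,
      exists_eq_left]
    tauto
  have hB : JBound (pair (oz a) (oz b)) = oz (Order.succ (max a b)) := by
    rw [JBound, hU, ZFSet.sUnion_pair, ← oz_max, oz_succ]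
  rw [JPred, hB, hU]
  simp only [ZFSet.mem_sep, ZFSet.mem_prod]
  constructor
  · rintro ⟨-, x, hx, y, hy, c, hc, d, hd, rfl, h, h'⟩
    obtain ⟨x, hx', rfl⟩ := mem_oz.1 hx
    obtain ⟨y, hy', rfl⟩ := mem_oz.1 hy
    obtain ⟨rfl, rfl⟩ := pair_inj.1 h
    refine ⟨x, y, rfl, ?_⟩
    rw [gLt_iff]
    simpa only [← oz_max, oz_mem, oz_inj] using h'
  · rintro ⟨c, d, rfl, h⟩
    rw [gLt_iff] at h
    have hle : max c d ≤ max a b := h.elim (fun h => h.le) (fun h => h.1.le)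
    have hc := oz_mem.2 (Order.lt_succ_iff.2 ((le_max_left c d).trans hle))
    have hd := oz_mem.2 (Order.lt_succ_iff.2 ((le_max_right c d).trans hle))
    refine ⟨⟨_, hc, _, hd, rfl⟩, _, hc, _, hd, oz a, by simp, oz b, by simp, rfl, rfl, ?_⟩
    simpa only [← oz_max, oz_mem, oz_inj] using h

theorem J_dfn_aux :
    (∀ x ∈ W, OrdPair x → Jv x ∈ W) ∧ Dfn W A (fun v => OrdPair (v 0) ∧ v 1 = Jv (v 0)) := by
  refine definable_recursion (C := OrdPair) (pred := JPred) (Φ := Jv)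
    (Γ := fun _ g y => y = rng g) ?_ ?_ inferInstance ?_ ?_ ?_
  · refine Dfn.of_iff (P := fun v => ∃ a ∈ W, ∃ b ∈ W, IsOrd a ∧ IsOrd b ∧ v 0 = pair a b)
      inferInstance fun v hv => ?_
    constructor
    · rintro ⟨a, b, h⟩
      have h1 := hv 0
      rw [h] at h1
      obtain ⟨h2, h3⟩ := hW.of_pair_mem h1
      exact ⟨_, h2, _, h3, isOrd_oz a, isOrd_oz b, h⟩
    · rintro ⟨a, _, b, _, ha, hb, h⟩
      obtain ⟨a, rfl⟩ := isOrd_iff.1 ha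
      obtain ⟨b, rfl⟩ := isOrd_iff.1 hb
      exact ⟨a, b, h⟩
  · have hB : DfnF W A (fun v => JBound (v 0)) := by
      unfold JBound
      infer_instance
    have hB1 : DfnF W A (fun v => JBound (tl v 0)) := hB.shift
    have hB2 : DfnF W A (fun v => JBound (tl (tl v) 0)) := hB.shift.shift
    have hB3 : DfnF W A (fun v => JBound (tl (tl (tl v)) 0)) := hB.shift.shift.shift
    unfold JPred
    infer_instance
  · rintro Q h x ⟨a, b, rfl⟩
    suffices ∀ p : Ordinal.{0} × Ordinal.{0}, Q (pair (oz p.1) (oz p.2)) from this (a, b)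
    intro p
    induction p using gLt_wf.induction with
    | _ p ih =>
      refine h _ ⟨_, _, rfl⟩ fun y hy => ?_
      obtain ⟨c, d, rfl, h⟩ := mem_JPred.1 hy
      exact ih _ h
  · rintro x ⟨a, b, rfl⟩ y hy
    obtain ⟨c, d, rfl, h⟩ := mem_JPred.1 hy
    refine ⟨⟨c, d, rfl⟩, fun z hz => ?_⟩
    obtain ⟨c', d', rfl, h'⟩ := mem_JPred.1 hz
    exact mem_JPred.2 ⟨_, _, rfl, lt_trans h' h⟩
  · rintro x hx ⟨a, b, rfl⟩ hg
    have : rng (grph Jv (JPred (pair (oz a) (oz b)))) = Jv (pair (oz a) (oz b)) := by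
      ext z
      simp only [mem_rng, pair_mem_grph]
      rw [Jv_pair, mem_oz]
      constructor
      · rintro ⟨q, hq, rfl⟩
        obtain ⟨c, d, rfl, h⟩ := mem_JPred.1 hq
        exact ⟨_, J_lt h, Jv_pair _ _⟩
      · rintro ⟨ξ, hξ, rfl⟩
        obtain ⟨⟨c, d⟩, h, rfl⟩ := lt_J.1 hξ
        exact ⟨_, mem_JPred.2 ⟨c, d, rfl, h⟩, (Jv_pair _ _).symm⟩
    rw [this]
    refine ⟨?_, fun y _ => Iff.rfl⟩
    rw [← this]
    exact (DfnF.rng_inst (W := W) (A := W) (s := fun v => v 0)).mem' (fun _ => _) fun _ => hg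

/-- The graph of Gödel pairing as a relation on sets. -/
def Jr (a b c : V) : Prop := ∃ α β, a = oz α ∧ b = oz β ∧ c = oz (J (α, β))

instance Dfn.Jr_inst {s t u : Env → V} [hs : DfnF W A s] [ht : DfnF W A t] [hu : DfnF W A u] :
    Dfn W A (fun v => Jr (s v) (t v) (u v)) := by
  have h : DfnF W A (fun v => pair (s v) (t v)) := inferInstance
  refine (Dfn.comp2 (R := fun x y => OrdPair x ∧ y = Jv x) J_dfn_aux.2 h hu).of_iff
    fun v _ => ?_
  constructor
  · rintro ⟨α, β, h1, h2, h3⟩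
    rw [h1, h2, h3, Jv_pair]
    exact ⟨⟨_, _, rfl⟩, rfl⟩
  · rintro ⟨⟨α, β, h⟩, h'⟩
    obtain ⟨h1, h2⟩ := pair_inj.1 h
    rw [h1, h2, Jv_pair] at h'
    exact ⟨α, β, h1, h2, h'⟩

theorem Good.J_mem {a b : Ordinal.{0}} (ha : oz a ∈ W) (hb : oz b ∈ W) : oz (J (a, b)) ∈ W := by
  rw [← Jv_pair]
  exact (J_dfn_aux (W := W) (A := W)).1 _ (hW.pair_mem ha hb) ⟨a, b, rfl⟩

theorem Good.oz_mem_of_le {a b : Ordinal.{0}} (h : a ≤ b) (hb : oz b ∈ W) : oz a ∈ W := by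
  rcases h.eq_or_lt with rfl | h
  · exact hb
  · exact hW.trans _ hb _ (oz_mem.2 h)

theorem F_dfn_aux :
    (∀ x ∈ W, IsOrd x → F x.rank ∈ W) ∧ Dfn W A (fun v => IsOrd (v 0) ∧ v 1 = F (v 0).rank) := by
  refine definable_recursion (C := IsOrd) (pred := fun x => x) (Φ := fun x => F x.rank)
    (Γ := fun x g y => (∃ k, k < 8 ∧ ∃ c ∈ W, ∃ a ∈ W, ∃ b ∈ W, Jr (natZ (k + 1)) c x ∧
        Jr a b c ∧ ∃ fa ∈ W, ∃ fb ∈ W, pair a fa ∈ g ∧ pair b fb ∈ g ∧ y = op k fa fb) ∨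
      ((¬ ∃ k, k < 8 ∧ ∃ c ∈ W, Jr (natZ (k + 1)) c x) ∧ y = rng g))
    inferInstance inferInstance ?_ (fun Q h => ord_induction h) ?_ ?_
  · have h1 := Dfn.exLt (W := W) (A := A) 8 (P := fun k v => ∃ c ∈ W, ∃ a ∈ W, ∃ b ∈ W,
        Jr (natZ (k + 1)) c (v 0) ∧ Jr a b c ∧ ∃ fa ∈ W, ∃ fb ∈ W,
        pair a fa ∈ v 1 ∧ pair b fb ∈ v 1 ∧ v 2 = op k fa fb) (fun k => inferInstance)
    have h2 := Dfn.exLt (W := W) (A := A) 8 (P := fun k v => ∃ c ∈ W,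
        Jr (natZ (k + 1)) c (v 0)) (fun k => inferInstance)
    infer_instance
  · intro x hx y hy
    obtain ⟨a, rfl⟩ := isOrd_iff.1 hx
    obtain ⟨b, hb, rfl⟩ := mem_oz.1 hy
    exact ⟨isOrd_oz b, oz_sub.2 hb.le⟩
  · rintro x hx ho hg
    obtain ⟨α, rfl⟩ := isOrd_iff.1 ho
    have hmem : ∀ ξ < α, F ξ ∈ W := by
      intro ξ hξ
      have : pair (oz ξ) (F ξ) ∈ grph (fun x => F x.rank) (oz α) :=
        pair_mem_grph.2 ⟨oz_mem.2 hξ, by rw [rank_oz]⟩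
      exact (hW.of_pair_mem (hW.trans _ hg _ this)).2
    have hord : ∀ ξ ≤ α, oz ξ ∈ W := fun ξ h => hW.oz_mem_of_le h hx
    have hJ : ∀ k : ℕ, ∀ c : V, Jr (natZ (k + 1)) c (oz α) →
        (unJ α).1 = ((k + 1 : ℕ) : Ordinal.{0}) ∧ c = oz (unJ α).2 := by
      rintro k c ⟨i, γ, h1, rfl, h3⟩
      rw [natZ_eq, oz_inj] at h1
      rw [oz_inj] at h3
      subst h1 h3
      simp [unJ_J]
    rw [rank_oz]
    by_cases hk : ∃ k, HasOp α k
    · obtain ⟨k, hk⟩ := hk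
      have hJ1 : Jr (natZ (k + 1)) (oz (unJ α).2) (oz α) := by
        refine ⟨_, _, natZ_eq _, rfl, ?_⟩
        rw [← hk.2]
        exact congrArg oz (J_unJ α).symm
      have hJ2 : Jr (oz (unJ (unJ α).2).1) (oz (unJ (unJ α).2).2) (oz (unJ α).2) :=
        ⟨_, _, rfl, rfl, congrArg oz (J_unJ _).symm⟩
      rw [F_op' hk]
      refine ⟨hW.op_mem (hmem _ hk.lt_fst) (hmem _ hk.lt_snd), fun y hy => ?_⟩
      constructor
      · rintro (⟨l, hl, c, hc, a, ha, b, hb, h1, h2, fa, hfa, fb, hfb, h3, h4, rfl⟩ | ⟨h, -⟩)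
        · obtain ⟨h5, rfl⟩ := hJ l c h1
          obtain ⟨a, b, rfl, rfl, h6⟩ := h2
          rw [oz_inj] at h6
          rw [h6, unJ_J]
          rw [pair_mem_grph] at h3 h4
          rw [h3.2, h4.2, rank_oz, rank_oz, hk.unique (l := l) ⟨hl, h5⟩]
        · exact absurd ⟨k, hk.1, _, hord _ (unJ_snd_le _), hJ1⟩ h
      · intro h
        refine Or.inl ⟨k, hk.1, _, hord _ (unJ_snd_le _), _, hord _ hk.lt_fst.le, _,
          hord _ hk.lt_snd.le, hJ1, hJ2, _, hmem _ hk.lt_fst, _, hmem _ hk.lt_snd,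
          pair_mem_grph.2 ⟨oz_mem.2 hk.lt_fst, by rw [rank_oz]⟩,
          pair_mem_grph.2 ⟨oz_mem.2 hk.lt_snd, by rw [rank_oz]⟩, h⟩
    · have hr : rng (grph (fun x => F x.rank) (oz α)) = F α := by
        ext y
        rw [mem_F_of_not hk, mem_rng]
        simp only [pair_mem_grph]
        constructor
        · rintro ⟨x, hx, rfl⟩
          obtain ⟨ξ, h, rfl⟩ := mem_oz.1 hx
          exact ⟨ξ, h, by rw [rank_oz]⟩
        · rintro ⟨ξ, h, rfl⟩
          exact ⟨oz ξ, oz_mem.2 h, by rw [rank_oz]⟩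
      have hn : ¬ ∃ k, k < 8 ∧ ∃ c ∈ W, Jr (natZ (k + 1)) c (oz α) := by
        rintro ⟨k, h, c, _, h'⟩
        exact hk ⟨k, h, (hJ k c h').1⟩
      rw [hr]
      refine ⟨?_, fun y _ => ?_⟩
      · rw [← hr]
        exact (DfnF.rng_inst (W := W) (A := W) (s := fun v => v 0)).mem' (fun _ => _) fun _ => hg
      · constructor
        · rintro (⟨l, hl, c, hc, a, ha, b, hb, h1, -⟩ | ⟨-, h⟩)
          · exact absurd ⟨l, hl, c, hc, h1⟩ hn
          · exact h
        · exact fun h => Or.inr ⟨hn, h⟩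

/-- The graph of the enumeration as a relation on sets. -/
def Fr (x y : V) : Prop := ∃ α, x = oz α ∧ y = F α

instance Dfn.Fr_inst {s t : Env → V} [hs : DfnF W A s] [ht : DfnF W A t] :
    Dfn W A (fun v => Fr (s v) (t v)) := by
  refine (Dfn.comp2 (R := fun x y => IsOrd x ∧ y = F x.rank) F_dfn_aux.2 hs ht).of_iff
    fun v _ => ?_
  constructor
  · rintro ⟨α, h1, h2⟩
    rw [h1, h2, rank_oz]
    exact ⟨isOrd_oz _, rfl⟩
  · rintro ⟨h, h'⟩
    obtain ⟨α, h⟩ := isOrd_iff.1 h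
    rw [h, rank_oz] at h'
    exact ⟨α, h, h'⟩

theorem Good.F_mem {α : Ordinal.{0}} (h : oz α ∈ W) : F α ∈ W := by
  have := (F_dfn_aux (W := W) (A := W)).1 _ h (isOrd_oz α)
  rwa [rank_oz] at this

end

/-! ## Reflection and towers -/

theorem exists_closed_ordinal (g : Ordinal.{0} → Ordinal.{0}) (α : Ordinal.{0}) :
    ∃ β, α < β ∧ Order.IsSuccLimit β ∧ ∀ γ < β, g γ < β := by
  let h : Ordinal.{0} → Ordinal.{0} :=
    fun δ => max (Order.succ δ) (⨆ ξ : Set.Iic δ, Order.succ (g ξ))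
  let u : ℕ → Ordinal.{0} := fun n => h^[n] α
  have hu : ∀ n, u (n + 1) = h (u n) := fun n => Function.iterate_succ_apply' h n α
  have hle : ∀ n, u n ≤ ⨆ n, u n := fun n => Ordinal.le_iSup u n
  have hs : ∀ n, u n < u (n + 1) := fun n => by
    rw [hu]
    exact (Order.lt_succ _).trans_le (le_max_left _ _)
  refine ⟨⨆ n, u n, (hs 0).trans_le (hle 1), ?_, fun γ hγ => ?_⟩
  · refine ⟨fun hm => ?_, Order.isSuccPrelimit_of_succ_lt fun γ hγ => ?_⟩
    · have := (hs 0).trans_le (hle 1)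
      exact absurd (hm this.le) (not_le.2 this)
    · obtain ⟨n, hn⟩ := (Ordinal.lt_iSup_iff).1 hγ
      exact ((Order.succ_le_of_lt hn).trans_lt (hs n)).trans_le (hle _)
  · obtain ⟨n, hn⟩ := (Ordinal.lt_iSup_iff).1 hγ
    refine lt_of_lt_of_le ?_ (hle (n + 1))
    rw [hu]
    refine (Order.lt_succ _).trans_le (le_trans ?_ (le_max_right _ _))
    exact Ordinal.le_iSup (fun ξ : Set.Iic (u n) => Order.succ (g ξ)) ⟨γ, hn.le⟩

/-- A continuous filtration of the class `W` by sets. -/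
structure Tower (W : Set V) (T : Ordinal.{0} → V) (g₀ : Ordinal.{0} → Ordinal.{0}) : Prop where
  mem : ∀ x, x ∈ W ↔ ∃ β, x ∈ T β
  mono : ∀ β γ, β ≤ γ → ∀ x ∈ T β, x ∈ T γ
  cont : ∀ β, Order.IsSuccLimit β → ∀ x ∈ T β, ∃ γ < β, x ∈ T γ
  closed : ∀ β, Order.IsSuccLimit β → (∀ γ < β, g₀ γ < β) → T β ∈ W ∧
    ∀ P : Env → Prop, Dfn (T β).toSet (T β).toSet P → ∀ v, EIn (T β).toSet v →
      ZFSet.sep (fun x => P (cons x v)) (T β) ∈ W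
  trans : ∀ x ∈ W, ∀ y ∈ x, y ∈ W

namespace Tower
variable {W : Set V} {T : Ordinal.{0} → V} {g₀ : Ordinal.{0} → Ordinal.{0}}

theorem reflection (h : Tower W T g₀) : ∀ {n : ℕ} (φ : Fml n),
    ∃ g : Ordinal.{0} → Ordinal.{0}, ∀ β, Order.IsSuccLimit β → (∀ γ < β, g γ < β) →
      ∀ v : Fin n → V, (∀ i, v i ∈ T β) → (Sat (T β).toSet φ v ↔ Sat W φ v)
  | _, .mem i j => ⟨fun _ => 0, fun _ _ _ _ _ => Iff.rfl⟩
  | _, .eq i j => ⟨fun _ => 0, fun _ _ _ _ _ => Iff.rfl⟩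
  | _, .inA i => ⟨fun _ => 0, fun _ _ _ _ _ => Iff.rfl⟩
  | _, .inB i => ⟨fun _ => 0, fun _ _ _ _ _ => Iff.rfl⟩
  | _, .not φ => by
      obtain ⟨g, hg⟩ := h.reflection φ
      exact ⟨g, fun β hβ hc v hv => not_congr (hg β hβ hc v hv)⟩
  | _, .and φ ψ => by
      obtain ⟨g, hg⟩ := h.reflection φ
      obtain ⟨g', hg'⟩ := h.reflection ψ
      exact ⟨fun γ => max (g γ) (g' γ), fun β hβ hc v hv => and_congr
        (hg β hβ (fun γ hγ => (le_max_left _ _).trans_lt (hc γ hγ)) v hv)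
        (hg' β hβ (fun γ hγ => (le_max_right _ _).trans_lt (hc γ hγ)) v hv)⟩
  | n, .ex φ => by
      obtain ⟨g, hg⟩ := h.reflection φ
      let w : (Fin n → V) → Ordinal.{0} := fun v =>
        if hx : ∃ ξ, ∃ x ∈ T ξ, Sat W φ (Fin.cons x v) then hx.choose else 0
      have hw : ∀ v, (∃ x ∈ W, Sat W φ (Fin.cons x v)) →
          ∃ x ∈ T (w v), Sat W φ (Fin.cons x v) := by
        rintro v ⟨x, hx, hs⟩
        obtain ⟨ξ, hξ⟩ := (h.mem x).1 hx
        have : ∃ ξ, ∃ x ∈ T ξ, Sat W φ (Fin.cons x v) := ⟨ξ, x, hξ, hs⟩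
        simp only [w, dif_pos this]
        exact this.choose_spec
      let k : Ordinal.{0} → Ordinal.{0} := fun γ =>
        ⨆ v : Fin n → {x // x ∈ T γ}, w (fun i => (v i).1)
      refine ⟨fun γ => max (g γ) (k γ), fun β hβ hc v hv => ?_⟩
      have ih := hg β hβ (fun γ hγ => (le_max_left _ _).trans_lt (hc γ hγ))
      have hγ : ∃ γ < β, ∀ i, v i ∈ T γ := by
        choose c hc1 hc2 using fun i => h.cont β hβ (v i) (hv i)
        have h0 : 0 < β := pos_iff_ne_zero.2 fun h0 => hβ.1 (h0 ▸ isMin_bot)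
        refine ⟨Finset.univ.sup c, ?_, fun i => h.mono _ _ (Finset.le_sup (Finset.mem_univ i)) _
          (hc2 i)⟩
        exact (Finset.sup_lt_iff h0).2 fun i _ => hc1 i
      constructor
      · rintro ⟨x, hx, hs⟩
        refine ⟨x, (h.mem x).2 ⟨β, hx⟩, (ih _ ?_).1 hs⟩
        intro i
        refine Fin.cases ?_ (fun i => ?_) i
        · exact hx
        · simpa using hv i
      · intro hs
        obtain ⟨γ, hγ, hvγ⟩ := hγ
        obtain ⟨x, hx, hs⟩ := hw v hs
        have h1 : w v ≤ k γ :=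
          Ordinal.le_iSup (fun v : Fin n → {x // x ∈ T γ} => w (fun i => (v i).1))
            (fun i => ⟨v i, hvγ i⟩)
        have h2 : w v < β := h1.trans_lt ((le_max_right _ _).trans_lt (hc γ hγ))
        have hx' : x ∈ T β := h.mono _ _ h2.le _ hx
        refine ⟨x, hx', (ih _ ?_).2 hs⟩
        intro i
        refine Fin.cases ?_ (fun i => ?_) i
        · exact hx'
        · simpa using hv i

theorem exists_stage (h : Tower W T g₀) {ι : Type} (f : ι → V) (hf : ∀ i, f i ∈ W) :
    ∃ β, ∀ i, f i ∈ T β := by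
  choose b hb using fun i => (h.mem _).1 (hf i)
  exact ⟨⨆ i, b i, fun i => h.mono _ _ (Ordinal.le_iSup b i) _ (hb i)⟩

theorem exists_good_stage (h : Tower W T g₀) (α : Ordinal.{0}) :
    ∃ β, α < β ∧ T β ∈ W := by
  obtain ⟨β, h1, h2, h3⟩ := exists_closed_ordinal g₀ α
  exact ⟨β, h1, (h.closed β h2 h3).1⟩

/-- Every set-sized family of members of `W` is covered by a member of `W`. -/
theorem cover (h : Tower W T g₀) (a : V) (f : V → V) (hf : ∀ x ∈ a, f x ∈ W) :
    ∃ c ∈ W, ∀ x ∈ a, f x ∈ c := by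
  obtain ⟨α, hα⟩ := h.exists_stage (ι := Shrink.{0} {x // x ∈ a})
    (fun i => f ((equivShrink _).symm i).1) (fun i => hf _ ((equivShrink _).symm i).2)
  obtain ⟨β, h1, h2⟩ := h.exists_good_stage α
  refine ⟨T β, h2, fun x hx => h.mono _ _ h1.le _ ?_⟩
  have := hα (equivShrink _ ⟨x, hx⟩)
  simpa using this

theorem sep (h : Tower W T g₀) (P : Env → Prop) (hP : Dfn W W P) (a : V) (ha : a ∈ W) (v : Env)
    (hv : EIn W v) : ZFSet.sep (fun x => P (cons x v)) a ∈ W := by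
  obtain ⟨n, φ, e, H⟩ := hP.out
  obtain ⟨g, hg⟩ := h.reflection φ
  obtain ⟨α₁, h1⟩ := h.exists_stage v hv
  obtain ⟨α₂, h2⟩ := (h.mem a).1 ha
  obtain ⟨α₃, h3⟩ := h.exists_stage (fun i => aval v (e i)) (fun i => by
    rcases e i with k | b
    · exact hv k
    · exact b.2)
  obtain ⟨α₄, h3'⟩ := h.exists_stage (ι := Shrink.{0} {x // x ∈ a})
    (fun i => ((equivShrink _).symm i).1) (fun i => h.trans _ ha _ ((equivShrink _).symm i).2)
  obtain ⟨β, h4, h5, h6⟩ := exists_closed_ordinal (fun γ => max (g γ) (g₀ γ))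
    (max (max α₁ α₄) (max α₂ α₃))
  have hle : ∀ x, x ∈ T α₁ ∨ x ∈ T α₄ ∨ x ∈ T α₂ ∨ x ∈ T α₃ → x ∈ T β := by
    simp only [max_lt_iff] at h4
    obtain ⟨⟨h41, h44⟩, h42, h43⟩ := h4
    rintro x (hx | hx | hx | hx)
    exacts [h.mono _ _ h41.le _ hx, h.mono _ _ h44.le _ hx, h.mono _ _ h42.le _ hx,
      h.mono _ _ h43.le _ hx]
  have haβ : a ∈ T β := hle _ (Or.inr (Or.inr (Or.inl h2)))
  have hc := (h.closed β h5 fun γ hγ => (le_max_right _ _).trans_lt (h6 γ hγ)).2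
  have hr := hg β h5 fun γ hγ => (le_max_left _ _).trans_lt (h6 γ hγ)
  have hvβ : EIn (T β).toSet v := fun i => hle _ (Or.inl (h1 i))
  have heβ : ∀ i (b : W), e i = .inr b → (b : V) ∈ T β := fun i b hb => by
    have := h3 i
    simp only [hb] at this
    exact hle _ (Or.inr (Or.inr (Or.inr this)))
  have hex : ∀ i, ∃ s : ℕ ⊕ (T β).toSet, ∀ u, aval u s = aval u (e i) := by
    intro i
    rcases h : e i with k | b
    · exact ⟨.inl k, fun _ => rfl⟩
    · exact ⟨.inr ⟨b, heβ i b h⟩, fun _ => rfl⟩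
  choose e' he'' using hex
  have he' : ∀ u i, aval u (e' i) = aval u (e i) := fun u i => he'' i u
  have hD : Dfn (T β).toSet (T β).toSet (fun u => Sat W φ fun i => aval u (e i)) := by
    refine ⟨n, φ, e', fun u hu => ?_⟩
    simp only [he']
    refine (hr _ fun i => ?_).symm
    rw [← he']
    rcases e' i with k | b
    · exact hu k
    · exact b.2
  have haD : ∀ x ∈ a, x ∈ T β := fun x hx => by
    have := h3' (equivShrink _ ⟨x, hx⟩)
    simp only [Equiv.symm_apply_apply] at this
    exact hle _ (Or.inr (Or.inl this))
  have : DfnF (T β).toSet (T β).toSet (fun _ => a) := DfnF.const haβ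
  have key := hc (fun u => u 0 ∈ a ∧ Sat W φ fun i => aval u (e i)) inferInstance v hvβ
  convert key using 1
  ext x
  simp only [ZFSet.mem_sep, Env.cons_zero]
  constructor
  · rintro ⟨h1, h2⟩
    exact ⟨haD x h1, h1, (H _ (EIn.cons (h.trans _ ha _ h1) hv)).1 h2⟩
  · rintro ⟨-, h1, h2⟩
    exact ⟨h1, (H _ (EIn.cons (h.trans _ ha _ h1) hv)).2 h2⟩

theorem good (h : Tower W T g₀) : Good W := by
  have hc : ∀ {P : Env → Prop}, Dfn W W P → ∀ (a : V), a ∈ W → ∀ v, EIn W v → ∀ b : V,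
      (∀ x ∈ b, x ∈ a) → (∀ x ∈ a, P (cons x v) ↔ x ∈ b) → b ∈ W := by
    intro P hP a ha v hv b h1 h2
    convert h.sep P hP a ha v hv using 1
    ext x
    simp only [ZFSet.mem_sep]
    exact ⟨fun hx => ⟨h1 x hx, (h2 x (h1 x hx)).2 hx⟩, fun hx => (h2 x hx.1).1 hx.2⟩
  obtain ⟨β, -, hβ⟩ := h.exists_good_stage 0
  refine ⟨h.trans, ?_, fun a ha b hb => ?_, fun a ha => ?_, h.sep, fun a ha b hb f hf => ?_⟩
  · exact hc Dfn.false_inst _ hβ (fun _ => T β) (fun _ => hβ) ∅ (by simp) (by simp)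
  · obtain ⟨c, hc1, hc2⟩ := h.cover {a, b} (fun x => x) (by simp [ha, hb])
    refine hc (P := fun v => v 0 = v 1 ∨ v 0 = v 2) inferInstance c hc1 (cons a fun _ => b)
      (EIn.cons ha fun _ => hb) _ hc2 (by simp)
  · obtain ⟨c, hc1, hc2⟩ := h.cover (⋃₀ a) (fun x => x) (fun x hx => by
      obtain ⟨y, hy, hx⟩ := ZFSet.mem_sUnion.1 hx
      exact h.trans _ (h.trans _ ha _ hy) _ hx)
    refine hc (P := fun v => ∃ y ∈ W, y ∈ v 1 ∧ v 0 ∈ y) inferInstance c hc1 (fun _ => a)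
      (fun _ => ha) _ hc2 fun x _ => ?_
    simp only [ZFSet.mem_sUnion]
    exact ⟨fun ⟨y, _, hy⟩ => ⟨y, hy⟩, fun ⟨y, hy, hx⟩ => ⟨y, h.trans _ ha _ hy, hy, hx⟩⟩
  · have hk : ∀ p : V, ∃ z ∈ W, ∀ x ∈ a, ∀ y ∈ b, p = pair x y → z = f x y := by
      intro p
      by_cases hp : ∃ x ∈ a, ∃ y ∈ b, p = pair x y
      · obtain ⟨x, hx, y, hy, rfl⟩ := hp
        refine ⟨f x y, hf x hx y hy, fun x' _ y' _ e => ?_⟩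
        obtain ⟨rfl, rfl⟩ := pair_inj.1 e
        rfl
      · exact ⟨_, hβ, fun x hx y hy e => absurd ⟨x, hx, y, hy, e⟩ hp⟩
    choose k hk1 hk2 using hk
    obtain ⟨c, hc1, hc2⟩ := h.cover (a.prod b) k fun p _ => hk1 p
    refine ⟨c, hc1, fun x hx y hy => ?_⟩
    rw [← hk2 _ x hx y hy rfl]
    exact hc2 _ (by simp [hx, hy])

/-- The class contains all ordinals. -/
theorem oz_mem (h : Tower W T g₀) (α : Ordinal.{0}) : oz α ∈ W := by
  have := h.good
  induction α using WellFoundedLT.induction with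
  | ind α ih =>
    obtain ⟨c, hc1, hc2⟩ := h.cover (oz α) (fun x => x) (fun x hx => by
      obtain ⟨β, hβ, rfl⟩ := mem_oz.1 hx
      exact ih β hβ)
    have h1 : ZFSet.sep (fun x => IsOrd x ∧ x ⊆ c) c ∈ W := by
      have : Fact (c ∈ W) := ⟨hc1⟩
      exact Good.sep inferInstance hc1
    obtain ⟨δ, hδ⟩ : ∃ δ, ZFSet.sep (fun x => IsOrd x ∧ x ⊆ c) c = oz δ := by
      refine isOrd_iff.1 ⟨fun x hx y hy => ?_, fun x hx => ?_⟩
      · simp only [ZFSet.mem_sep] at hx ⊢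
        obtain ⟨h2, h3, h4⟩ := hx
        obtain ⟨β, rfl⟩ := isOrd_iff.1 h3
        obtain ⟨γ, hγ, rfl⟩ := mem_oz.1 hy
        exact ⟨h4 hy, isOrd_oz γ, fun z hz => h4 (oz_sub.2 hγ.le hz)⟩
      · exact (ZFSet.mem_sep.1 hx).2.1.1
    rw [hδ] at h1
    refine Good.oz_mem_of_le ?_ h1
    rw [← oz_sub, ← hδ]
    intro x hx
    obtain ⟨β, hβ, rfl⟩ := mem_oz.1 hx
    refine ZFSet.mem_sep.2 ⟨hc2 _ hx, isOrd_oz β, fun y hy => ?_⟩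
    exact hc2 _ (oz_sub.2 hβ.le hy)

end Tower

/-! ## The constructible hierarchy -/

theorem mem_Def {X B : V} : B ∈ DefSetA ∅ X ↔ ∃ (n : ℕ) (φ : Fml (n + 1)) (v : Fin n → V),
    (∀ i, v i ∈ X) ∧ B = ZFSet.sep (fun z => Sat X.toSet φ (Fin.cons z v)) X := by
  simp only [DefSetA, ZFSet.mem_sep, ZFSet.mem_powerset]
  refine ⟨fun h => h.2, fun h => ⟨?_, h⟩⟩
  obtain ⟨n, φ, v, _, rfl⟩ := h
  exact fun x hx => (ZFSet.mem_sep.1 hx).1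

theorem subset_of_mem_Def {X B : V} (h : B ∈ DefSetA ∅ X) : B ⊆ X := by
  obtain ⟨n, φ, v, _, rfl⟩ := mem_Def.1 h
  exact fun x hx => (ZFSet.mem_sep.1 hx).1

theorem mem_Def_of_dfn {X : V} {P : Env → Prop} (hP : Dfn X.toSet X.toSet P) {v : Env}
    (hv : EIn X.toSet v) : ZFSet.sep (fun x => P (cons x v)) X ∈ DefSetA ∅ X := by
  obtain ⟨n, φ, e, H⟩ := hP.out
  let ρ : Fin n → Fin (n + 1) := fun i => if e i = .inl 0 then 0 else i.succ
  let e' : Fin n → ℕ ⊕ X.toSet := fun i => (e i).map (fun k => k - 1) id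
  refine mem_Def.2 ⟨n, φ.ren ρ, fun i => aval v (e' i), fun i => ?_, ?_⟩
  · change aval v (e' i) ∈ X
    rcases e' i with k | b
    · exact hv k
    · exact b.2
  · ext x
    simp only [ZFSet.mem_sep, Fml.sat_ren]
    refine and_congr_right fun hx => (H _ (EIn.cons hx hv)).trans ?_
    have : (fun i => aval (Env.cons x v) (e i)) =
        (fun i => (Fin.cons x (fun i => aval v (e' i)) : Fin (n + 1) → V) (ρ i)) := by
      funext i
      rcases h : e i with k | a
      · rcases k with _ | k
        · simp [ρ, h, aval]
        · simp [ρ, e', h, aval]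
      · simp [ρ, e', h, aval]
    rw [this]

theorem mem_Lstage {α x : V} : x ∈ Lstage α ↔ ∃ β ∈ α, x ∈ DefSetA ∅ (Lstage β) := by
  rw [Lstage, LstageA, WellFounded.fix_eq]
  simp only [ZFSet.mem_sUnion, mem_img]
  constructor
  · rintro ⟨_, ⟨β, hβ, rfl⟩, hx⟩
    rw [dif_pos hβ] at hx
    exact ⟨β, hβ, hx⟩
  · rintro ⟨β, hβ, hx⟩
    exact ⟨_, ⟨β, hβ, rfl⟩, by rwa [dif_pos hβ]⟩

def Lo (α : Ordinal.{0}) : V := Lstage (oz α)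

theorem mem_Lo {α : Ordinal.{0}} {x : V} : x ∈ Lo α ↔ ∃ β < α, x ∈ DefSetA ∅ (Lo β) := by
  rw [Lo, mem_Lstage]
  constructor
  · rintro ⟨_, hβ, hx⟩
    obtain ⟨β, h, rfl⟩ := mem_oz.1 hβ
    exact ⟨β, h, hx⟩
  · rintro ⟨β, h, hx⟩
    exact ⟨_, oz_mem.2 h, hx⟩

theorem Lo_mono {α β : Ordinal.{0}} (h : α ≤ β) {x : V} (hx : x ∈ Lo α) : x ∈ Lo β := by
  rw [mem_Lo] at *
  obtain ⟨γ, hγ, hx⟩ := hx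
  exact ⟨γ, hγ.trans_le h, hx⟩

theorem Lo_trans {α : Ordinal.{0}} {x y : V} (hx : x ∈ Lo α) (hy : y ∈ x) : y ∈ Lo α := by
  obtain ⟨γ, hγ, hx⟩ := mem_Lo.1 hx
  exact Lo_mono hγ.le (subset_of_mem_Def hx hy)

theorem mem_LClass {x : V} : x ∈ LClass ↔ ∃ α, x ∈ Lo α := by
  constructor
  · rintro ⟨α, h, hx⟩
    obtain ⟨α, rfl⟩ := isOrd_iff.1 h
    exact ⟨α, hx⟩
  · rintro ⟨α, hx⟩
    exact ⟨_, isOrd_oz α, hx⟩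

theorem Def_mem_L {α : Ordinal.{0}} {x : V} (h : x ∈ DefSetA ∅ (Lo α)) : x ∈ LClass :=
  mem_LClass.2 ⟨Order.succ α, mem_Lo.2 ⟨α, Order.lt_succ α, h⟩⟩

theorem Lo_tower : Tower LClass Lo (fun _ => 0) where
  mem _ := mem_LClass
  mono _ _ h _ hx := Lo_mono h hx
  cont β hβ x hx := by
    obtain ⟨γ, h, hx⟩ := mem_Lo.1 hx
    exact ⟨_, hβ.succ_lt h, mem_Lo.2 ⟨γ, Order.lt_succ γ, hx⟩⟩
  closed β hβ _ := by
    have h1 : ∀ P : Env → Prop, Dfn (Lo β).toSet (Lo β).toSet P → ∀ v, EIn (Lo β).toSet v →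
        ZFSet.sep (fun x => P (cons x v)) (Lo β) ∈ LClass :=
      fun P hP v hv => Def_mem_L (mem_Def_of_dfn hP hv)
    refine ⟨Def_mem_L (α := β) (mem_Def.2 ⟨0, .eq 0 0, fun i => i.elim0, fun i => i.elim0, ?_⟩), h1⟩
    ext x
    simp [Sat, SatAB]
  trans x hx y hy := by
    obtain ⟨α, hx⟩ := mem_LClass.1 hx
    exact mem_LClass.2 ⟨α, Lo_trans hx hy⟩

instance good_L : Good LClass := Lo_tower.good

theorem K_subset_L : KClass ⊆ LClass := by
  rintro _ ⟨α, rfl⟩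
  exact Good.F_mem (Lo_tower.oz_mem α)

/-! ## The class enumerated by `F` is transitive and closed under definable sections -/

/-- Ordinals containing all natural numbers and closed under the pairing function. -/
structure JCl (β : Ordinal.{0}) : Prop where
  nat : ∀ n : ℕ, (n : Ordinal.{0}) < β
  pair : ∀ a < β, ∀ b < β, J (a, b) < β

theorem exists_JCl (α : Ordinal.{0}) : ∃ β, α < β ∧ JCl β := by
  obtain ⟨β, h1, h2, h3⟩ := exists_closed_ordinal (fun γ => J (γ, γ)) α
  refine ⟨β, h1, ⟨fun n => ?_, fun a ha b hb => ?_⟩⟩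
  · induction n with
    | zero => simpa using h2.bot_lt
    | succ n ih =>
      have := h2.succ_lt ih
      rwa [Order.succ_eq_add_one, ← Nat.cast_succ] at this
  · refine lt_of_le_of_lt ?_ (h3 _ (max_lt ha hb))
    rcases gLt_tri (a, b) (max a b, max a b) with h | h | h
    · exact (J_lt h).le
    · rw [← h]
    · rw [gLt_iff] at h
      simp only [max_self] at h
      rcases h with h | ⟨-, h | ⟨h', h⟩⟩
      · exact absurd h (lt_irrefl _)
      · exact absurd h (not_lt.2 (le_max_left _ _))
      · exact absurd h (not_lt.2 (le_max_right _ _))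

/-- The sets enumerated by `F` below `β`. -/
def Kb (β : Ordinal.{0}) : Set V := {x | ∃ ξ < β, x = F ξ}

def HK (S : Set V) : Set V := {x | ∀ z, Relation.ReflTransGen (fun z y : V => z ∈ y) z x → z ∈ S}

theorem mem_HK {S : Set V} {x : V} : x ∈ HK S ↔ x ∈ S ∧ ∀ y ∈ x, y ∈ HK S := by
  constructor
  · intro h
    exact ⟨h x .refl, fun y hy z hz => h z (hz.tail hy)⟩
  · rintro ⟨h1, h2⟩ z hz
    rcases hz.cases_tail with rfl | ⟨y, hzy, hy⟩
    · exact h1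
    · exact h2 y hy z hzy

theorem HK_of_pair {S : Set V} {x y : V} (h : pair x y ∈ HK S) : x ∈ HK S ∧ y ∈ HK S := by
  have h2 := (mem_HK.1 h).2 {x, y} (by simp [pair])
  exact ⟨(mem_HK.1 h2).2 x (by simp), (mem_HK.1 h2).2 y (by simp)⟩

section
variable {β : Ordinal.{0}} (hβ : JCl β)
include hβ

theorem JCl.op_mem {k : ℕ} (hk : k < 8) {a b : V} (ha : a ∈ Kb β) (hb : b ∈ Kb β) :
    op k a b ∈ Kb β := by
  obtain ⟨α, hα, rfl⟩ := ha
  obtain ⟨γ, hγ, rfl⟩ := hb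
  exact ⟨_, hβ.pair _ (hβ.nat (k + 1)) _ (hβ.pair _ hα _ hγ), (F_op hk α γ).symm⟩

theorem HK_upair {x y : V} (hx : x ∈ HK (Kb β)) (hy : y ∈ HK (Kb β)) : ({x, y} : V) ∈ HK (Kb β) :=
  mem_HK.2 ⟨hβ.op_mem (k := 0) (by norm_num) (mem_HK.1 hx).1 (mem_HK.1 hy).1, by simp [hx, hy]⟩

theorem HK_pair {x y : V} (hx : x ∈ HK (Kb β)) (hy : y ∈ HK (Kb β)) : pair x y ∈ HK (Kb β) :=
  HK_upair hβ (by simpa using HK_upair hβ hx hx) (HK_upair hβ hx hy)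

theorem HK_op {k : ℕ} (hk : k < 8) {a b : V} (ha : a ∈ HK (Kb β)) (hb : b ∈ HK (Kb β)) :
    op k a b ∈ HK (Kb β) := by
  refine mem_HK.2 ⟨hβ.op_mem hk (mem_HK.1 ha).1 (mem_HK.1 hb).1, fun y hy => ?_⟩
  have ha' := (mem_HK.1 ha).2
  have hb' := (mem_HK.1 hb).2
  rcases k with _ | _ | _ | _ | _ | _ | _ | k <;> simp only [op] at hy
  · rcases ZFSet.mem_pair.1 hy with rfl | rfl <;> assumption
  · exact ha' _ (ZFSet.mem_sdiff.1 hy).1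
  · obtain ⟨u, hu, w, hw, rfl⟩ := ZFSet.mem_prod.1 hy
    exact HK_pair hβ (ha' _ hu) (hb' _ hw)
  · obtain ⟨x, hx⟩ := mem_rng.1 hy
    exact (HK_of_pair (ha' _ hx)).2
  · obtain ⟨x, hx, z, hz, w, hw, rfl, -⟩ := mem_opE.1 hy
    exact HK_pair hβ (ha' _ hx) (HK_pair hβ (ha' _ hz) (hb' _ hw))
  · obtain ⟨x, hx, w, hw, rfl⟩ := mem_opEq.1 hy
    exact HK_pair hβ (ha' _ hx) (HK_pair hβ (ha' _ hx) (hb' _ hw))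
  · obtain ⟨x, y, w, rfl, h⟩ := mem_opSwap.1 hy
    obtain ⟨h1, h2⟩ := HK_of_pair (ha' _ h)
    obtain ⟨h2, h3⟩ := HK_of_pair h2
    exact HK_pair hβ h2 (HK_pair hβ h1 h3)
  · exact (HK_of_pair (ha' _ (mem_opSec.1 hy))).1

theorem F_mem_HK {α : Ordinal.{0}} (hα : α < β) : F α ∈ HK (Kb β) := by
  induction α using WellFoundedLT.induction with
  | ind α ih =>
    by_cases h : ∃ k, HasOp α k
    · obtain ⟨k, hk⟩ := h
      rw [F_op' hk]
      exact HK_op hβ hk.1 (ih _ hk.lt_fst (hk.lt_fst.trans hα)) (ih _ hk.lt_snd (hk.lt_snd.trans hα))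
    · refine mem_HK.2 ⟨⟨α, hα, rfl⟩, fun y hy => ?_⟩
      obtain ⟨ξ, hξ, rfl⟩ := (mem_F_of_not h).1 hy
      exact ih ξ hξ (hξ.trans hα)

theorem JCl.trans {x y : V} (hx : x ∈ Kb β) (hy : y ∈ x) : y ∈ Kb β := by
  obtain ⟨α, hα, rfl⟩ := hx
  exact (mem_HK.1 ((mem_HK.1 (F_mem_HK hβ hα)).2 y hy)).1

end

theorem K_trans {x y : V} (hx : x ∈ KClass) (hy : y ∈ x) : y ∈ KClass := by
  obtain ⟨α, rfl⟩ := hx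
  obtain ⟨β, h1, h2⟩ := exists_JCl α
  obtain ⟨ξ, -, rfl⟩ := h2.trans ⟨α, h1, rfl⟩ hy
  exact ⟨ξ, rfl⟩

/-- The finite powers of a set. -/
def powZ (M : V) : ℕ → V
  | 0 => {∅}
  | n + 1 => M.prod (powZ M n)

def tup : ℕ → Env → V
  | 0, _ => ∅
  | n + 1, v => pair (v 0) (tup n (tl v))

theorem tup_mem {M : V} : ∀ {n : ℕ} {v : Env}, EIn M.toSet v → tup n v ∈ powZ M n
  | 0, _, _ => by simp [tup, powZ]
  | n + 1, v, hv => by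
      simp only [tup, powZ, ZFSet.pair_mem_prod]
      exact ⟨hv 0, tup_mem hv.tl⟩

theorem exists_mem_of_ne {M : V} (hM : M ≠ ∅) : ∃ x, x ∈ M :=
  (ZFSet.eq_empty_or_nonempty M).resolve_left hM

theorem exists_tup {M : V} (hM : M ≠ ∅) : ∀ {n : ℕ} {x : V}, x ∈ powZ M n →
    ∃ v, EIn M.toSet v ∧ x = tup n v
  | 0, x, h => by
      obtain ⟨m, hm⟩ := exists_mem_of_ne hM
      exact ⟨fun _ => m, fun _ => hm, by simpa [tup, powZ] using h⟩
  | n + 1, x, h => by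
      obtain ⟨a, ha, b, hb, rfl⟩ := ZFSet.mem_prod.1 h
      obtain ⟨v, hv, rfl⟩ := exists_tup hM hb
      exact ⟨cons a v, EIn.cons ha hv, rfl⟩

theorem powZ_succ_inj {M : V} (hM : M ≠ ∅) {n : ℕ} {N : V} (h : powZ M n = M.prod N) :
    ∃ m, n = m + 1 ∧ N = powZ M m := by
  obtain ⟨a, ha⟩ := exists_mem_of_ne hM
  rcases n with _ | m
  · have : (∅ : V) ∈ M.prod N := by rw [← h]; simp [powZ]
    obtain ⟨x, _, y, _, h⟩ := ZFSet.mem_prod.1 this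
    have : ({x} : V) ∈ (∅ : V) := by rw [h]; simp [pair]
    simp at this
  · refine ⟨m, rfl, ?_⟩
    ext y
    have := congrArg (fun z => pair a y ∈ z) h
    simp only [powZ, ZFSet.pair_mem_prod, eq_iff_iff] at this
    have ha' : a ∈ M := ha
    tauto

/-- `D` is the set of `n`-tuples from `M` satisfying `P`. -/
def IsD (M : V) (n : ℕ) (D : V) (P : Env → Prop) : Prop :=
  D ⊆ powZ M n ∧ ∀ v, EIn M.toSet v → (tup n v ∈ D ↔ P v)

theorem IsD.congr {M : V} {n : ℕ} {D : V} {P Q : Env → Prop} (h : IsD M n D P)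
    (e : ∀ v, EIn M.toSet v → (Q v ↔ P v)) : IsD M n D Q :=
  ⟨h.1, fun v hv => (h.2 v hv).trans (e v hv).symm⟩

theorem IsD.full (M : V) (n : ℕ) : IsD M n (powZ M n) (fun _ => True) :=
  ⟨fun _ h => h, fun _ hv => iff_of_true (tup_mem hv) trivial⟩

theorem IsD.diff {M : V} {n : ℕ} {D D' : V} {P P' : Env → Prop} (h : IsD M n D P)
    (h' : IsD M n D' P') : IsD M n (D \ D') (fun v => P v ∧ ¬ P' v) :=
  ⟨fun _ hx => h.1 (ZFSet.mem_sdiff.1 hx).1, fun v hv => by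
    rw [ZFSet.mem_sdiff, h.2 v hv, h'.2 v hv]⟩

theorem IsD.weak {M : V} {n : ℕ} {D : V} {P : Env → Prop} (h : IsD M n D P) :
    IsD M (n + 1) (M.prod D) (fun v => P (tl v)) := by
  refine ⟨fun x hx => ?_, fun v hv => ?_⟩
  · obtain ⟨a, ha, b, hb, rfl⟩ := ZFSet.mem_prod.1 hx
    simp [powZ, ha, h.1 hb]
  · have := hv 0
    simp only [tup, ZFSet.pair_mem_prod, h.2 _ hv.tl]
    exact and_iff_right this

def Env.swap (v : Env) : Env := cons (v 1) (cons (v 0) (tl (tl v)))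

theorem EIn.swap {W : Set V} {v : Env} (hv : EIn W v) : EIn W v.swap :=
  (EIn.cons (hv 1) (EIn.cons (hv 0) hv.tl.tl))

theorem IsD.swap {M : V} {n : ℕ} {D : V} {P : Env → Prop} (h : IsD M (n + 2) D P) :
    IsD M (n + 2) (opSwap D) (fun v => P v.swap) := by
  refine ⟨fun x hx => ?_, fun v hv => ?_⟩
  · obtain ⟨x, y, w, rfl, hx'⟩ := mem_opSwap.1 hx
    have := h.1 hx'
    simp only [powZ, ZFSet.pair_mem_prod] at this ⊢
    tauto
  · change _ ↔ P v.swap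
    rw [← h.2 _ hv.swap, mem_opSwap]
    constructor
    · rintro ⟨x, y, w, e, hx⟩
      obtain ⟨e1, e2⟩ := pair_inj.1 e
      obtain ⟨e3, e4⟩ := pair_inj.1 e2
      change v 1 = y at e3
      change tup n v.tl.tl = w at e4
      rw [← e1, ← e3, ← e4] at hx
      exact hx
    · exact fun hx => ⟨_, _, _, rfl, hx⟩

theorem IsD.rng {M : V} {n : ℕ} {D : V} {P : Env → Prop} (h : IsD M (n + 1) D P) :
    IsD M n (rng D) (fun v => ∃ x ∈ M.toSet, P (cons x v)) := by
  refine ⟨fun y hy => ?_, fun v hv => ?_⟩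
  · obtain ⟨x, hx⟩ := mem_rng.1 hy
    exact (ZFSet.pair_mem_prod.1 (h.1 hx)).2
  · rw [mem_rng]
    constructor
    · rintro ⟨x, hx⟩
      have hxM : x ∈ M := (ZFSet.pair_mem_prod.1 (h.1 hx)).1
      exact ⟨x, hxM, (h.2 _ (EIn.cons hxM hv)).1 hx⟩
    · rintro ⟨x, hx, hp⟩
      exact ⟨x, (h.2 _ (EIn.cons hx hv)).2 hp⟩

theorem IsD.E (M : V) (n : ℕ) : IsD M (n + 2) (opE M (powZ M n)) (fun v => v 0 ∈ v 1) := by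
  refine ⟨fun x hx => ?_, fun v hv => ?_⟩
  · obtain ⟨x, hx', y, hy, w, hw, rfl, -⟩ := mem_opE.1 hx
    simp [powZ, hx', hy, hw]
  · rw [mem_opE]
    constructor
    · rintro ⟨x, _, y, _, w, _, e, hx⟩
      obtain ⟨e1, e2⟩ := pair_inj.1 e
      obtain ⟨e3, -⟩ := pair_inj.1 e2
      change v 1 = y at e3
      rw [e1, e3]
      exact hx
    · exact fun hx => ⟨_, hv 0, _, hv 1, _, tup_mem hv.tl.tl, rfl, hx⟩

theorem IsD.Eq (M : V) (n : ℕ) : IsD M (n + 2) (opEq M (powZ M n)) (fun v => v 0 = v 1) := by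
  refine ⟨fun x hx => ?_, fun v hv => ?_⟩
  · obtain ⟨x, hx', w, hw, rfl⟩ := mem_opEq.1 hx
    simp [powZ, hx', hw]
  · rw [mem_opEq]
    constructor
    · rintro ⟨x, _, w, _, e⟩
      obtain ⟨e1, e2⟩ := pair_inj.1 e
      obtain ⟨e3, -⟩ := pair_inj.1 e2
      change v 1 = x at e3
      rw [e1, e3]
    · intro hx
      refine ⟨_, hv 0, _, tup_mem hv.tl.tl, ?_⟩
      have hx' : tl v 0 = v 0 := hx.symm
      simp only [tup, hx']

/-- Closure conditions for families of pairs `(Mⁿ, D)`. -/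
structure Rules (M : V) (Q : V → V → Prop) : Prop where
  top : Q {∅} {∅}
  memr : ∀ N R, Q N R → Q (M.prod (M.prod N)) (opE M N)
  eqr : ∀ N R, Q N R → Q (M.prod (M.prod N)) (opEq M N)
  diff : ∀ N R R', Q N R → Q N R' → Q N (R \ R')
  weak : ∀ N R, Q N R → Q (M.prod N) (M.prod R)
  swap : ∀ N R, Q (M.prod (M.prod N)) R → Q (M.prod (M.prod N)) (opSwap R)
  rng : ∀ N R, Q (M.prod N) R → Q N (rng R)

namespace Rules
variable {M : V} {Q : V → V → Prop}

def Has (M : V) (Q : V → V → Prop) (n : ℕ) (P : Env → Prop) : Prop :=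
  ∃ D, Q (powZ M n) D ∧ IsD M n D P

theorem full (h : Rules M Q) : ∀ n, Q (powZ M n) (powZ M n)
  | 0 => h.top
  | n + 1 => h.weak _ _ (h.full n)

theorem has_diff (h : Rules M Q) {n : ℕ} {P P' : Env → Prop} (hP : Has M Q n P)
    (hP' : Has M Q n P') : Has M Q n (fun v => P v ∧ ¬ P' v) := by
  obtain ⟨D, h1, h2⟩ := hP
  obtain ⟨D', h1', h2'⟩ := hP'
  exact ⟨_, h.diff _ _ _ h1 h1', h2.diff h2'⟩

theorem has_true (h : Rules M Q) (n : ℕ) : Has M Q n (fun _ => True) :=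
  ⟨_, h.full n, IsD.full M n⟩

theorem has_weak (h : Rules M Q) {n : ℕ} {P : Env → Prop} (hP : Has M Q n P) :
    Has M Q (n + 1) (fun v => P (tl v)) := by
  obtain ⟨D, h1, h2⟩ := hP
  exact ⟨_, h.weak _ _ h1, h2.weak⟩

theorem has_swap (h : Rules M Q) {n : ℕ} {P : Env → Prop} (hP : Has M Q (n + 2) P) :
    Has M Q (n + 2) (fun v => P v.swap) := by
  obtain ⟨D, h1, h2⟩ := hP
  exact ⟨_, h.swap _ _ h1, h2.swap⟩

theorem has_congr {n : ℕ} {P P' : Env → Prop} (hP : Has M Q n P)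
    (e : ∀ v, P' v ↔ P v) : Has M Q n P' := by
  obtain ⟨D, h1, h2⟩ := hP
  exact ⟨D, h1, h2.congr fun v _ => e v⟩

theorem has_false (h : Rules M Q) (n : ℕ) : Has M Q n (fun _ => False) :=
  has_congr (h.has_diff (h.has_true n) (h.has_true n)) (by simp)

theorem has_atom (h : Rules M Q) (r : V → V → Prop) (h0 : ∀ n, Has M Q (n + 1) fun v => r (v 0) (v 0))
    (h1 : ∀ n, Has M Q (n + 2) fun v => r (v 0) (v 1)) :
    ∀ n i j, i < n → j < n → Has M Q n fun v => r (v i) (v j)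
  | 0, i, _, hi, _ => absurd hi (Nat.not_lt_zero i)
  | n + 1, 0, 0, _, _ => h0 n
  | n + 1, i + 1, j + 1, hi, hj =>
      h.has_weak (h.has_atom r h0 h1 n i j (Nat.lt_of_succ_lt_succ hi) (Nat.lt_of_succ_lt_succ hj))
  | n + 2, 0, 1, _, _ => h1 n
  | n + 2, 1, 0, _, _ => h.has_swap (h1 n)
  | n + 2, 0, j + 2, hi, hj => by
      have := h.has_atom r h0 h1 (n + 1) 0 (j + 1) (Nat.succ_pos _) (Nat.lt_of_succ_lt_succ hj)
      exact h.has_swap (h.has_weak this)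
  | n + 2, i + 2, 0, hi, hj => by
      have := h.has_atom r h0 h1 (n + 1) (i + 1) 0 (Nat.lt_of_succ_lt_succ hi) (Nat.succ_pos _)
      exact h.has_swap (h.has_weak this)
  | 1, 0, j + 1, _, hj => absurd hj (by omega)
  | 1, i + 1, 0, hi, _ => absurd hi (by omega)

theorem has_mem (h : Rules M Q) {n i j : ℕ} (hi : i < n) (hj : j < n) :
    Has M Q n fun v => v i ∈ v j :=
  h.has_atom (fun x y => x ∈ y) (fun n => has_congr (h.has_false _) (by simp [ZFSet.mem_irrefl]))
    (fun n => ⟨_, h.memr _ _ (h.full n), IsD.E M n⟩) n i j hi hj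

theorem has_eq (h : Rules M Q) {n i j : ℕ} (hi : i < n) (hj : j < n) :
    Has M Q n fun v => v i = v j :=
  h.has_atom (fun x y => x = y) (fun n => has_congr (h.has_true _) (by simp))
    (fun n => ⟨_, h.eqr _ _ (h.full n), IsD.Eq M n⟩) n i j hi hj

theorem has_sat (h : Rules M Q) : ∀ {n : ℕ} (φ : Fml n),
    Has M Q n fun v => Sat M.toSet φ fun i => v i
  | _, .mem i j => h.has_mem i.2 j.2
  | _, .eq i j => h.has_eq i.2 j.2
  | _, .inA i => has_congr (h.has_false _) (by simp [Sat, SatAB])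
  | _, .inB i => has_congr (h.has_false _) (by simp [Sat, SatAB])
  | _, .not φ => has_congr (h.has_diff (h.has_true _) (h.has_sat φ)) (by simp [Sat, SatAB])
  | _, .and φ ψ => has_congr
      (h.has_diff (h.has_sat φ) (h.has_diff (h.has_sat φ) (h.has_sat ψ)))
      (fun v => by
        have : Sat M.toSet (.and φ ψ) (fun i => v i) ↔
          Sat M.toSet φ (fun i => v i) ∧ Sat M.toSet ψ (fun i => v i) := Iff.rfl
        tauto)
  | n, .ex φ => by
      obtain ⟨D, h1, h2⟩ := h.has_sat φ
      refine ⟨_, h.rng _ _ h1, (h2.rng).congr fun v hv => ?_⟩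
      refine exists_congr fun x => and_congr_right fun _ => ?_
      have : (fun i : Fin (n + 1) => cons x v i) = Fin.cons x (fun i : Fin n => v i) := by
        funext i
        refine Fin.cases ?_ (fun i => ?_) i <;> simp
      rw [this]
      rfl

theorem exists_sec (h : Rules M Q) (hM : M ≠ ∅) {x : V} (hx : x ∈ DefSetA ∅ M) :
    ∃ N R p, Q (M.prod N) R ∧ p ∈ N ∧ x = opSec R p := by
  obtain ⟨n, φ, w, hw, rfl⟩ := mem_Def.1 hx
  obtain ⟨D, h1, h2⟩ := h.has_sat φ
  obtain ⟨m, hm⟩ := exists_mem_of_ne hM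
  let v : Env := fun i => if hi : i < n then w ⟨i, hi⟩ else m
  have hv : EIn M.toSet v := fun i => by
    change v i ∈ M
    simp only [v]
    split_ifs
    · exact hw _
    · exact hm
  refine ⟨powZ M n, D, tup n v, h1, tup_mem hv, ?_⟩
  have hfun : ∀ z, (fun i : Fin (n + 1) => cons z v i) = Fin.cons z w := by
    intro z
    funext i
    refine Fin.cases ?_ (fun i => ?_) i
    · simp
    · simp [v]
  ext z
  rw [mem_opSec, ZFSet.mem_sep]
  constructor
  · rintro ⟨hz, hs⟩
    exact (h2.2 _ (EIn.cons (show z ∈ M.toSet from hz) hv)).2 (by beta_reduce; rw [hfun]; exact hs)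
  · intro hz
    have hzM : z ∈ M := (ZFSet.pair_mem_prod.1 (h2.1 hz)).1
    have := (h2.2 _ (EIn.cons (show z ∈ M.toSet from hzM) hv)).1 hz
    beta_reduce at this
    rw [hfun] at this
    exact ⟨hzM, this⟩

end Rules

def Ko (β : Ordinal.{0}) : V := F (J (0, β))

theorem mem_Ko {β : Ordinal.{0}} {x : V} : x ∈ Ko β ↔ ∃ ξ < J (0, β), x = F ξ := by
  refine mem_F_of_not ?_
  rintro ⟨k, hk⟩
  have := hk.pos
  rw [unJ_J] at this
  exact lt_irrefl _ this

theorem empty_mem_K : (∅ : V) ∈ KClass := by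
  have : op 1 (F 0) (F 0) ∈ KClass := op_mem_K (by norm_num) ⟨0, rfl⟩ ⟨0, rfl⟩
  have e : op 1 (F 0) (F 0) = ∅ := by
    rw [ZFSet.eq_empty]
    intro y hy
    simp [op] at hy
  rwa [e] at this

theorem Rules_K {M : V} (hM : M ∈ KClass) (hM0 : M ≠ ∅) : Rules M (fun N R => N ∈ KClass ∧ R ∈ KClass) where
  top := by
    have : op 0 ∅ ∅ ∈ KClass := op_mem_K (by norm_num) empty_mem_K empty_mem_K
    have e : op 0 ∅ ∅ = ({∅} : V) := by simp [op]
    rw [e] at this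
    exact ⟨this, this⟩
  memr N _ h := ⟨op_mem_K (k := 2) (by norm_num) hM (op_mem_K (k := 2) (by norm_num) hM h.1),
    op_mem_K (k := 4) (by norm_num) hM h.1⟩
  eqr N _ h := ⟨op_mem_K (k := 2) (by norm_num) hM (op_mem_K (k := 2) (by norm_num) hM h.1),
    op_mem_K (k := 5) (by norm_num) hM h.1⟩
  diff N R R' h h' := ⟨h.1, op_mem_K (k := 1) (by norm_num) h.2 h'.2⟩
  weak N R h := ⟨op_mem_K (k := 2) (by norm_num) hM h.1, op_mem_K (k := 2) (by norm_num) hM h.2⟩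
  swap N R h := ⟨h.1, op_mem_K (k := 6) (by norm_num) h.2 h.2⟩
  rng N R h := by
    have h3 := op_mem_K (k := 3) (by norm_num) h.2 h.2
    refine ⟨?_, h3⟩
    have h4 := op_mem_K (k := 3) (by norm_num) h.1 h.1
    have e : op 3 (M.prod N) (M.prod N) = N := by
      obtain ⟨m, hm⟩ := exists_mem_of_ne hM0
      ext y
      simp only [op, mem_rng, ZFSet.pair_mem_prod]
      exact ⟨fun ⟨_, h⟩ => h.2, fun h => ⟨m, hm, h⟩⟩
    rwa [e] at h4

theorem Def_sub_K {M : V} (hM : M ∈ KClass) {x : V} (hx : x ∈ DefSetA ∅ M) : x ∈ KClass := by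
  by_cases h : M = ∅
  · have := subset_of_mem_Def hx
    have : x = ∅ := by
      rw [ZFSet.eq_empty]
      intro y hy
      have := this hy
      rw [h] at this
      exact ZFSet.notMem_empty _ this
    rw [this]
    exact empty_mem_K
  · obtain ⟨N, R, p, h1, h2, rfl⟩ := (Rules_K hM h).exists_sec h hx
    have hN : N ∈ KClass := ((Rules_K hM h).rng N _ ⟨h1.1, h1.1⟩).1
    exact op_mem_K (k := 7) (by norm_num) h1.2 (K_trans hN h2)

theorem Ko_tower : Tower KClass Ko (fun _ => 0) where
  mem x := by
    constructor
    · rintro ⟨α, rfl⟩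
      exact ⟨Order.succ α, mem_Ko.2 ⟨α, (Order.lt_succ α).trans_le (le_J_zero _), rfl⟩⟩
    · rintro ⟨β, h⟩
      obtain ⟨ξ, -, rfl⟩ := mem_Ko.1 h
      exact ⟨ξ, rfl⟩
  mono β γ h x hx := by
    obtain ⟨ξ, hξ, rfl⟩ := mem_Ko.1 hx
    refine mem_Ko.2 ⟨ξ, hξ.trans_le ?_, rfl⟩
    rcases h.eq_or_lt with rfl | h
    · exact le_rfl
    · exact (J_lt (gLt_iff.2 (Or.inl (by simpa using h)))).le
  cont β hβ x hx := by
    obtain ⟨ξ, hξ, rfl⟩ := mem_Ko.1 hx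
    obtain ⟨q, hq, rfl⟩ := lt_J.1 hξ
    have hlt : max q.1 q.2 < β := by
      rcases gLt_iff.1 hq with h | ⟨h, h' | ⟨h', h''⟩⟩
      · simpa using h
      · exact absurd h' (not_lt_bot (α := Ordinal.{0}))
      · simp only at h' h''
        rw [h']
        exact max_lt hβ.bot_lt h''
    refine ⟨Order.succ (max q.1 q.2), hβ.succ_lt hlt, mem_Ko.2 ⟨_, J_lt (gLt_iff.2 (Or.inl ?_)), rfl⟩⟩
    simp
  closed β hβ _ := by
    refine ⟨⟨_, rfl⟩, fun P hP v hv => Def_sub_K ⟨_, rfl⟩ (mem_Def_of_dfn hP hv)⟩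
  trans x hx y hy := K_trans hx hy

instance good_K : Good KClass := Ko_tower.good

section Der
variable {W A : Set V} [hW : Good W] [hA : Par W A]

def DStep (W : Set V) (M C k N R : V) : Prop :=
  (N = {∅} ∧ R = {∅}) ∨ ∃ k' ∈ k, ∃ N' ∈ W, ∃ R' ∈ W, pair k' (pair N' R') ∈ C ∧
    ((N = M.prod (M.prod N') ∧ (R = op 4 M N' ∨ R = op 5 M N')) ∨
     (∃ k'' ∈ k, ∃ R'' ∈ W, pair k'' (pair N' R'') ∈ C ∧ N = N' ∧ R = R' \ R'') ∨
     (N = M.prod N' ∧ R = M.prod R') ∨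
     (∃ N₀ ∈ W, N = M.prod (M.prod N₀) ∧ N = N' ∧ R = op 6 R' R') ∨
     (N' = M.prod N ∧ R = SRPPaper.rng R'))

def Der (W : Set V) (M C : V) : Prop :=
  ∀ e ∈ C, ∃ k ∈ W, ∃ N ∈ W, ∃ R ∈ W, e = pair k (pair N R) ∧ DStep W M C k N R

set_option synthInstance.maxHeartbeats 400000 in
set_option synthInstance.maxSize 2000 in
theorem Der_dfn : Dfn W A (fun v => Der W (v 0) (v 1)) := by
  unfold Der DStep
  infer_instance

omit hW in
theorem DStep.mono {M C C' k N R : V} (h : DStep W M C k N R) (hC : C ⊆ C') :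
    DStep W M C' k N R := by
  rcases h with h | ⟨k', hk', N', hN', R', hR', hc, h⟩
  · exact Or.inl h
  · refine Or.inr ⟨k', hk', N', hN', R', hR', hC hc, ?_⟩
    rcases h with h | ⟨k'', hk'', R'', hR'', hc', h⟩ | h
    · exact Or.inl h
    · exact Or.inr (Or.inl ⟨k'', hk'', R'', hR'', hC hc', h⟩)
    · exact Or.inr (Or.inr h)

omit hW in
theorem Der.union {M C C' : V} (h : Der W M C) (h' : Der W M C') : Der W M (C ∪ C') := by
  intro e he
  rcases ZFSet.mem_union.1 he with he | he
  · obtain ⟨k, hk, N, hN, R, hR, e, hs⟩ := h e he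
    exact ⟨k, hk, N, hN, R, hR, e, hs.mono fun x hx => ZFSet.mem_union.2 (Or.inl hx)⟩
  · obtain ⟨k, hk, N, hN, R, hR, e, hs⟩ := h' e he
    exact ⟨k, hk, N, hN, R, hR, e, hs.mono fun x hx => ZFSet.mem_union.2 (Or.inr hx)⟩

omit hW in
theorem Der.insert {M C k N R : V} (h : Der W M C) (hk : k ∈ W) (hN : N ∈ W) (hR : R ∈ W)
    (hs : DStep W M C k N R) : Der W M (insert (pair k (pair N R)) C) := by
  have hsub : C ⊆ Insert.insert (pair k (pair N R)) C := fun x hx => ZFSet.mem_insert_iff.2 (Or.inr hx)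
  intro e he
  rcases ZFSet.mem_insert_iff.1 he with rfl | he
  · exact ⟨k, hk, N, hN, R, hR, rfl, hs.mono hsub⟩
  · obtain ⟨k, hk, N, hN, R, hR, e, hs⟩ := h e he
    exact ⟨k, hk, N, hN, R, hR, e, hs.mono hsub⟩

omit hW in
theorem Der.sound {M C : V} (h : Der W M C) {Q : V → V → Prop} (hQ : Rules M Q) :
    ∀ k N R : V, pair k (pair N R) ∈ C → Q N R := by
  intro k
  induction k using ZFSet.inductionOn with
  | _ k ih =>
    intro N R hc
    obtain ⟨k₁, _, N₁, _, R₁, _, e, hs⟩ := h _ hc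
    obtain ⟨e1, e⟩ := pair_inj.1 e
    obtain ⟨e2, e3⟩ := pair_inj.1 e
    subst e1 e2 e3
    rcases hs with ⟨rfl, rfl⟩ | ⟨k', hk', N', hN', R', hR', hc, hs⟩
    · exact hQ.top
    · have := ih k' hk' _ _ hc
      rcases hs with ⟨rfl, rfl | rfl⟩ | ⟨k'', hk'', R'', hR'', hc', rfl, rfl⟩ | ⟨rfl, rfl⟩ |
        ⟨N₀, _, rfl, rfl, rfl⟩ | ⟨rfl, rfl⟩
      · exact hQ.memr _ _ this
      · exact hQ.eqr _ _ this
      · exact hQ.diff _ _ _ this (ih k'' hk'' _ _ hc')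
      · exact hQ.weak _ _ this
      · exact hQ.swap _ _ this
      · exact hQ.rng _ _ this

def QDer (W : Set V) (M N R : V) : Prop :=
  N ∈ W ∧ R ∈ W ∧ ∃ C ∈ W, Der W M C ∧ ∃ k ∈ W, pair k (pair N R) ∈ C

theorem QDer.mk {M C k N R : V} (h : Der W M C) (hC : C ∈ W) (hk : k ∈ W) (hN : N ∈ W) (hR : R ∈ W)
    (hs : DStep W M C k N R) : QDer W M N R := by
  refine ⟨hN, hR, _, ?_, h.insert hk hN hR hs, k, hk, ZFSet.mem_insert_iff.2 (Or.inl rfl)⟩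
  exact (DfnF.insert_inst (W := W) (A := W) (s := fun v => v 0) (t := fun v => v 1)).mem'
    (cons (pair k (pair N R)) (cons C fun _ => C))
    (EIn.cons (hW.pair_mem hk (hW.pair_mem hN hR)) (EIn.cons hC fun _ => hC))

theorem QDer.rules {M : V} (hM : M ∈ W) (hM0 : M ≠ ∅) : Rules M (QDer W M) := by
  have sing : ∀ {k : V}, k ∈ W → ({k} : V) ∈ W := fun hk => by
    simpa using hW.upair _ hk _ hk
  have hr : ∀ {N}, M.prod N ∈ W → N ∈ W := by
    intro N hN
    have h4 := hW.op_mem (k := 3) hN hN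
    have e : op 3 (M.prod N) (M.prod N) = N := by
      obtain ⟨m, hm⟩ := exists_mem_of_ne hM0
      ext y
      simp only [op, mem_rng, ZFSet.pair_mem_prod]
      exact ⟨fun ⟨_, h⟩ => h.2, fun h => ⟨m, hm, h⟩⟩
    rwa [e] at h4
  have prod : ∀ {a b : V}, a ∈ W → b ∈ W → a.prod b ∈ W := fun ha hb => hW.op_mem (k := 2) ha hb
  refine ⟨?_, ?_, ?_, ?_, ?_, ?_, ?_⟩
  · exact QDer.mk (C := ∅) (k := ∅) (fun e he => absurd he (ZFSet.notMem_empty _)) hW.empty hW.empty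
      (sing hW.empty) (sing hW.empty) (Or.inl ⟨rfl, rfl⟩)
  · rintro N R ⟨hN, hR, C, hC, hd, k, hk, hc⟩
    exact QDer.mk hd hC (sing hk) (prod hM (prod hM hN)) (hW.op_mem (k := 4) hM hN)
      (Or.inr ⟨k, by simp, N, hN, R, hR, hc, Or.inl ⟨rfl, Or.inl rfl⟩⟩)
  · rintro N R ⟨hN, hR, C, hC, hd, k, hk, hc⟩
    exact QDer.mk hd hC (sing hk) (prod hM (prod hM hN)) (hW.op_mem (k := 5) hM hN)
      (Or.inr ⟨k, by simp, N, hN, R, hR, hc, Or.inl ⟨rfl, Or.inr rfl⟩⟩)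
  · rintro N R R' ⟨hN, hR, C, hC, hd, k, hk, hc⟩ ⟨_, hR', C', hC', hd', k', hk', hc'⟩
    exact QDer.mk (hd.union hd') (hW.union_mem hC hC') (hW.upair _ hk _ hk') hN
      (hW.op_mem (k := 1) hR hR')
      (Or.inr ⟨k, by simp, N, hN, R, hR, ZFSet.mem_union.2 (Or.inl hc), Or.inr (Or.inl
        ⟨k', by simp, R', hR', ZFSet.mem_union.2 (Or.inr hc'), rfl, rfl⟩)⟩)
  · rintro N R ⟨hN, hR, C, hC, hd, k, hk, hc⟩
    exact QDer.mk hd hC (sing hk) (prod hM hN) (prod hM hR)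
      (Or.inr ⟨k, by simp, N, hN, R, hR, hc, Or.inr (Or.inr (Or.inl ⟨rfl, rfl⟩))⟩)
  · rintro N R ⟨hN, hR, C, hC, hd, k, hk, hc⟩
    exact QDer.mk hd hC (sing hk) hN (hW.op_mem (k := 6) hR hR)
      (Or.inr ⟨k, by simp, _, hN, R, hR, hc, Or.inr (Or.inr (Or.inr (Or.inl
        ⟨N, hr (hr hN), rfl, rfl, rfl⟩)))⟩)
  · rintro N R ⟨hN, hR, C, hC, hd, k, hk, hc⟩
    exact QDer.mk hd hC (sing hk) (hr hN) (hW.op_mem (k := 3) hR hR)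
      (Or.inr ⟨k, by simp, _, hN, R, hR, hc, Or.inr (Or.inr (Or.inr (Or.inr ⟨rfl, rfl⟩)))⟩)

def IsDef (W : Set V) (M x : V) : Prop :=
  (M = ∅ ∧ x = ∅) ∨ (¬ M = ∅ ∧ ∃ N ∈ W, ∃ R ∈ W, ∃ p ∈ N, (∃ C ∈ W, Der W M C ∧
    ∃ k ∈ W, pair k (pair (M.prod N) R) ∈ C) ∧ x = op 7 R p)

theorem IsDef_dfn : Dfn W A (fun v => IsDef W (v 0) (v 1)) := by
  have : ∀ (m : Env → Env) (i j : ℕ) [EMap m], Dfn W A (fun v => Der W (m v i) (v j)) :=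
    fun m i j _ => Dfn.comp2 Der_dfn inferInstance inferInstance
  unfold IsDef
  infer_instance

end Der

theorem powZ_inj {M : V} (hM : M ≠ ∅) : ∀ {n m : ℕ}, powZ M n = powZ M m → n = m
  | 0, 0, _ => rfl
  | n, m + 1, h => by
      obtain ⟨l, rfl, h'⟩ := powZ_succ_inj hM h
      rw [powZ_inj hM h'.symm]
  | n + 1, 0, h => by
      obtain ⟨l, h', -⟩ := powZ_succ_inj hM h.symm
      omega

theorem Rules_sound (M : V) (hM0 : M ≠ ∅) :
    Rules M (fun N R => ∃ n P, N = powZ M n ∧ Dfn M.toSet ∅ P ∧ IsD M n R P) where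
  top := ⟨0, fun _ => True, rfl, inferInstance, IsD.full M 0⟩
  memr := by
    rintro _ R ⟨n, P, rfl, -, -⟩
    exact ⟨n + 2, fun v => v 0 ∈ v 1, rfl, inferInstance, IsD.E M n⟩
  eqr := by
    rintro _ R ⟨n, P, rfl, -, -⟩
    exact ⟨n + 2, fun v => v 0 = v 1, rfl, inferInstance, IsD.Eq M n⟩
  diff := by
    rintro _ R R' ⟨n, P, rfl, h1, h2⟩ ⟨n', P', e, h1', h2'⟩
    obtain rfl := powZ_inj hM0 e
    exact ⟨n, fun v => P v ∧ ¬ P' v, rfl, inferInstance, h2.diff h2'⟩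
  weak := by
    rintro _ R ⟨n, P, rfl, h1, h2⟩
    exact ⟨n + 1, fun v => P (tl v), rfl, h1.ren Nat.succ, h2.weak⟩
  swap := by
    rintro N R ⟨n, P, e, h1, h2⟩
    obtain ⟨m, rfl, e'⟩ := powZ_succ_inj hM0 e.symm
    obtain ⟨l, rfl, rfl⟩ := powZ_succ_inj hM0 e'.symm
    refine ⟨l + 2, fun v => P v.swap, rfl, ?_, h2.swap⟩
    refine (h1.ren (fun i => if i = 0 then 1 else if i = 1 then 0 else i)).of_iff fun v _ => ?_
    have : v.swap = fun i => v (if i = 0 then 1 else if i = 1 then 0 else i) := by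
      funext i
      rcases i with _ | _ | i <;> simp [Env.swap, Env.tl_apply]
    rw [this]
  rng := by
    rintro N R ⟨n, P, e, h1, h2⟩
    obtain ⟨m, rfl, rfl⟩ := powZ_succ_inj hM0 e.symm
    exact ⟨m, fun v => ∃ x ∈ M.toSet, P (cons x v), rfl, h1.ex, h2.rng⟩

theorem mem_Def_empty {x : V} : x ∈ DefSetA ∅ (∅ : V) ↔ x = ∅ := by
  constructor
  · intro h
    have := subset_of_mem_Def h
    rw [ZFSet.eq_empty]
    exact fun y hy => ZFSet.notMem_empty _ (this hy)
  · rintro rfl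
    refine mem_Def.2 ⟨0, .eq 0 0, fun i => i.elim0, fun i => i.elim0, ?_⟩
    rw [eq_comm, ZFSet.eq_empty]
    simp

theorem isDef_iff {W : Set V} [hW : Good W] {M : V} (hM : M ∈ W) {x : V} :
    IsDef W M x ↔ x ∈ DefSetA ∅ M := by
  by_cases h : M = ∅
  · subst h
    rw [mem_Def_empty]
    simp [IsDef]
  · have hp : ∀ {N : V}, N ∈ W → M.prod N ∈ W := fun hN => hW.op_mem (k := 2) hM hN
    constructor
    · rintro (⟨h', -⟩ | ⟨-, N, hN, R, hR, p, hp', ⟨C, hC, hd, k, hk, hc⟩, rfl⟩)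
      · exact absurd h' h
      · obtain ⟨n, P, e, h1, h2⟩ := hd.sound (Rules_sound M h) _ _ _ hc
        obtain ⟨m, rfl, rfl⟩ := powZ_succ_inj h e.symm
        obtain ⟨v, hv, rfl⟩ := exists_tup h hp'
        have := mem_Def_of_dfn (h1.mono (Set.empty_subset _)) hv
        convert this using 1
        ext z
        rw [ZFSet.mem_sep]
        change z ∈ opSec R _ ↔ _
        rw [mem_opSec]
        constructor
        · intro hz
          have hzM : z ∈ M := (ZFSet.pair_mem_prod.1 (h2.1 hz)).1
          exact ⟨hzM, (h2.2 _ (EIn.cons (show z ∈ M.toSet from hzM) hv)).1 hz⟩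
        · rintro ⟨hzM, hz⟩
          exact (h2.2 _ (EIn.cons (show z ∈ M.toSet from hzM) hv)).2 hz
    · intro hx
      obtain ⟨N, R, p, ⟨hN, hR, hC⟩, h2, rfl⟩ := (QDer.rules hM h).exists_sec h hx
      have hN' : N ∈ W := ((QDer.rules hM h).rng N R ⟨hN, hR, hC⟩).1
      exact Or.inr ⟨h, N, hN', R, hR, p, h2, hC, rfl⟩

theorem Lstage_K_aux : (∀ x ∈ KClass, IsOrd x → Lstage x ∈ KClass) ∧
    Dfn KClass ∅ (fun v => IsOrd (v 0) ∧ v 1 = Lstage (v 0)) := by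
  have hdd : ∀ (m m' : Env → Env) (i j : ℕ) [EMap m] [EMap m'],
      Dfn KClass ∅ (fun v => IsDef KClass (m v i) (m' v j)) :=
    fun m m' i j _ _ => Dfn.comp2 IsDef_dfn inferInstance inferInstance
  have hdd' : ∀ (m m' : Env → Env) (i j : ℕ) [EMap m] [EMap m'],
      Dfn KClass KClass (fun v => IsDef KClass (m v i) (m' v j)) :=
    fun m m' i j _ _ => Dfn.comp2 IsDef_dfn inferInstance inferInstance
  refine definable_recursion (C := IsOrd) (pred := fun x => x) (Φ := Lstage)
    (Γ := fun x g y => ∀ z ∈ KClass, (z ∈ y ↔ ∃ β ∈ x, ∃ M ∈ KClass, pair β M ∈ g ∧ IsDef KClass M z))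
    inferInstance inferInstance inferInstance (fun Q h => ord_induction h) ?_ ?_
  · intro x hx y hy
    obtain ⟨a, rfl⟩ := isOrd_iff.1 hx
    obtain ⟨b, hb, rfl⟩ := mem_oz.1 hy
    exact ⟨isOrd_oz b, oz_sub.2 hb.le⟩
  · intro x hx ho hg
    have hmem : ∀ β ∈ x, Lstage β ∈ KClass := fun β hβ =>
      (good_K.of_pair_mem (good_K.trans _ hg _ (pair_mem_grph.2 ⟨hβ, rfl⟩))).2
    have key : ∀ z, z ∈ Lstage x ↔
        ∃ β ∈ x, ∃ M ∈ KClass, pair β M ∈ grph Lstage x ∧ IsDef KClass M z := by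
      intro z
      rw [mem_Lstage]
      constructor
      · rintro ⟨β, hβ, h⟩
        exact ⟨β, hβ, _, hmem β hβ, pair_mem_grph.2 ⟨hβ, rfl⟩, (isDef_iff (hmem β hβ)).2 h⟩
      · rintro ⟨β, hβ, M, hM, h, h'⟩
        obtain ⟨-, rfl⟩ := pair_mem_grph.1 h
        exact ⟨β, hβ, (isDef_iff hM).1 h'⟩
    have hsub : ∀ z ∈ Lstage x, z ∈ KClass := by
      intro z hz
      obtain ⟨β, hβ, h⟩ := mem_Lstage.1 hz
      exact Def_sub_K (hmem β hβ) h
    refine ⟨?_, fun y hy => ?_⟩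
    · obtain ⟨c, hc, h⟩ := Ko_tower.cover (Lstage x) id hsub
      have := good_K.sep' (fun v => ∃ β ∈ v 1, ∃ M ∈ KClass, pair β M ∈ v 2 ∧ IsDef KClass M (v 0))
        inferInstance c hc (cons x (cons (grph Lstage x) fun _ => ∅))
        (EIn.cons hx (EIn.cons hg fun _ => empty_mem_K))
      convert this using 1
      ext z
      rw [ZFSet.mem_sep, key]
      refine (and_iff_right_of_imp fun hz => ?_).symm
      exact h z ((key z).2 hz)
    · constructor
      · intro h
        ext z
        constructor
        · intro hz
          exact (key z).2 ((h z (K_trans hy hz)).1 hz)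
        · intro hz
          exact (h z (hsub z hz)).2 ((key z).1 hz)
      · rintro rfl z -
        exact key z

theorem L_eq_K : LClass = KClass := by
  refine Set.Subset.antisymm (fun x hx => ?_) K_subset_L
  obtain ⟨α, h⟩ := mem_LClass.1 hx
  exact K_trans (Lstage_K_aux.1 _ (Ko_tower.oz_mem α) (isOrd_oz α)) h

theorem mem_L_iff {x : V} : x ∈ LClass ↔ ∃ α, x = F α := by
  rw [L_eq_K]
  exact ⟨fun ⟨α, h⟩ => ⟨α, h.symm⟩, fun ⟨α, h⟩ => ⟨α, h.symm⟩⟩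

/-! ## Cardinals of `L` -/

/-- `f` relates every element of `b` to an element of `a` that determines it. -/
def SurjR (f a b : V) : Prop :=
  ∀ y ∈ b, ∃ x ∈ a, pair x y ∈ f ∧ ∀ y' ∈ b, pair x y' ∈ f → y' = y

instance Dfn.SurjR_inst {W A : Set V} [Good W] [Par W A] {s t u : Env → V} [hs : DfnF W A s]
    [ht : DfnF W A t] [hu : DfnF W A u] : Dfn W A (fun v => SurjR (s v) (t v) (u v)) := by
  have h : Dfn W A (fun v => SurjR (v 0) (v 1) (v 2)) := by
    unfold SurjR
    infer_instance
  exact h.comp3 hs ht hu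

theorem IsSurjF.surjR {a b f : V} (h : IsSurjF a b f) : SurjR f a b := by
  intro y hy
  obtain ⟨x, hx, hxy⟩ := h.2 y hy
  exact ⟨x, hx, hxy, fun y' _ h' => (h.1.2 x hx).unique h' hxy⟩

theorem SurjR.exists_isSurjF {W : Set V} [hW : Good W] {a b f : V} (hf : f ∈ W) (ha : a ∈ W)
    (hb : b ∈ W) (h0 : ∅ ∈ b) (h : SurjR f a b) : ∃ g ∈ W, IsSurjF a b g := by
  set D : V → V → Prop := fun x y => pair x y ∈ f ∧ ∀ y' ∈ b, pair x y' ∈ f → y' = y with hD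
  have hfa : Fact (a ∈ W) := ⟨ha⟩
  have hfb : Fact (b ∈ W) := ⟨hb⟩
  have hff : Fact (f ∈ W) := ⟨hf⟩
  have hp : a.prod b ∈ W :=
    (inferInstance : DfnF W W (fun _ => a.prod b)).mem' (fun _ => a) fun _ => ha
  set g := ZFSet.sep (fun p => ∃ x ∈ a, ∃ y ∈ b, p = pair x y ∧
    (D x y ∨ (y = ∅ ∧ ¬ ∃ z ∈ b, D x z))) (a.prod b) with hg
  have mg : ∀ x y, pair x y ∈ g ↔ x ∈ a ∧ y ∈ b ∧ (D x y ∨ (y = ∅ ∧ ¬ ∃ z ∈ b, D x z)) := by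
    intro x y
    rw [hg, ZFSet.mem_sep, ZFSet.pair_mem_prod]
    constructor
    · rintro ⟨-, x', hx, y', hy, e, h⟩
      obtain ⟨rfl, rfl⟩ := ZFSet.pair_inj.1 e
      exact ⟨hx, hy, h⟩
    · rintro ⟨hx, hy, h⟩
      exact ⟨⟨hx, hy⟩, x, hx, y, hy, rfl, h⟩
  refine ⟨g, Good.sep (by simp only [hD]; infer_instance) hp, ⟨ZFSet.sep_subset, fun x hx => ?_⟩,
    fun y hy => ?_⟩
  · by_cases hz : ∃ z ∈ b, D x z
    · obtain ⟨z, hzb, hz⟩ := hz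
      refine ⟨z, (mg _ _).2 ⟨hx, hzb, .inl hz⟩, fun w hw => ?_⟩
      obtain ⟨-, hwb, hw | hw⟩ := (mg _ _).1 hw
      · exact hz.2 w hwb hw.1
      · exact absurd ⟨z, hzb, hz⟩ hw.2
    · refine ⟨∅, (mg _ _).2 ⟨hx, h0, .inr ⟨rfl, hz⟩⟩, fun w hw => ?_⟩
      obtain ⟨-, hwb, hw | hw⟩ := (mg _ _).1 hw
      · exact absurd ⟨w, hwb, hw⟩ hz
      · exact hw.1
  · obtain ⟨x, hx, h⟩ := h y hy
    exact ⟨x, hx, (mg _ _).2 ⟨hx, hy, .inl h⟩⟩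

theorem oz_mem_L (α : Ordinal.{0}) : oz α ∈ LClass := Lo_tower.oz_mem α

theorem F_mem_L (α : Ordinal.{0}) : F α ∈ LClass := Good.F_mem (oz_mem_L α)

theorem lCard_iff {γ : Ordinal.{0}} :
    LCard (oz γ) ↔ ∀ a < γ, ∀ ξ, ¬ SurjR (F ξ) (oz a) (oz γ) := by
  constructor
  · intro h a ha ξ hs
    obtain ⟨g, hg, hs⟩ := SurjR.exists_isSurjF (F_mem_L ξ) (oz_mem_L a) (oz_mem_L γ)
      (by rw [← oz_zero, oz_mem]; exact (zero_le).trans_lt ha) hs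
    exact h.2 _ (oz_mem.2 ha) g hg hs
  · refine fun h => ⟨isOrd_oz γ, fun α hα f hf hs => ?_⟩
    obtain ⟨a, ha, rfl⟩ := mem_oz.1 hα
    obtain ⟨ξ, rfl⟩ := mem_L_iff.1 hf
    exact h a ha ξ hs.surjR

/-! ## Collapses commuting with the basic operations -/

section
variable {M : Set V} {π : V → V}

/-- `M` is an extensional set closed under the basic operations and suitable witnesses. -/
structure OpClosed (M : Set V) : Prop where
  ext : ∀ x ∈ M, ∀ y ∈ M, x ≠ y → ∃ z ∈ M, ¬ (z ∈ x ↔ z ∈ y)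
  op : ∀ k < 8, ∀ x ∈ M, ∀ y ∈ M, op k x y ∈ M
  pair : ∀ x y, ZFSet.pair x y ∈ M → x ∈ M ∧ y ∈ M
  rng : ∀ a ∈ M, ∀ y ∈ M, (∃ x, ZFSet.pair x y ∈ a) → ∃ x ∈ M, ZFSet.pair x y ∈ a

/-- `π` is a transitive collapse of `M`. -/
def IsColl (M : Set V) (π : V → V) : Prop := ∀ x ∈ M, ∀ z, z ∈ π x ↔ ∃ y ∈ M, y ∈ x ∧ z = π y

theorem IsColl.inj (hM : OpClosed M) (hπ : IsColl M π) :
    ∀ x ∈ M, ∀ y ∈ M, π x = π y → x = y := by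
  intro x
  induction x using ZFSet.inductionOn with
  | _ x ih =>
  intro hx y hy h
  by_contra hne
  obtain ⟨z, hz, hzn⟩ := hM.ext x hx y hy hne
  apply hzn
  constructor
  · intro hzx
    have := (hπ x hx _).2 ⟨z, hz, hzx, rfl⟩
    rw [h, hπ y hy] at this
    obtain ⟨w, hw, hwy, e⟩ := this
    rwa [ih z hzx hz w hw e]
  · intro hzy
    have := (hπ y hy _).2 ⟨z, hz, hzy, rfl⟩
    rw [← h, hπ x hx] at this
    obtain ⟨w, hw, hwx, e⟩ := this
    rwa [← ih w hwx hw z hz e.symm]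

theorem IsColl.mem_iff (hM : OpClosed M) (hπ : IsColl M π) {x y : V} (hx : x ∈ M) (hy : y ∈ M) :
    π y ∈ π x ↔ y ∈ x := by
  rw [hπ x hx]
  constructor
  · rintro ⟨w, hw, hwx, e⟩
    rwa [hπ.inj hM y hy w hw e]
  · exact fun h => ⟨y, hy, h, rfl⟩

theorem OpClosed.upair (hM : OpClosed M) {x y : V} (hx : x ∈ M) (hy : y ∈ M) : ({x, y} : V) ∈ M :=
  hM.op 0 (by norm_num) x hx y hy

theorem OpClosed.pair_mem (hM : OpClosed M) {x y : V} (hx : x ∈ M) (hy : y ∈ M) :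
    ZFSet.pair x y ∈ M := by
  have h1 := hM.upair hx hx
  have h2 := hM.upair h1 (hM.upair hx hy)
  simpa [ZFSet.pair] using h2

theorem IsColl.upair (hM : OpClosed M) (hπ : IsColl M π) {x y : V} (hx : x ∈ M) (hy : y ∈ M) :
    π {x, y} = {π x, π y} := by
  ext z
  rw [hπ _ (hM.upair hx hy), ZFSet.mem_pair]
  constructor
  · rintro ⟨w, hw, h, rfl⟩
    rcases ZFSet.mem_pair.1 h with rfl | rfl <;> simp
  · rintro (rfl | rfl)
    exacts [⟨x, hx, by simp, rfl⟩, ⟨y, hy, by simp, rfl⟩]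

theorem IsColl.pair (hM : OpClosed M) (hπ : IsColl M π) {x y : V} (hx : x ∈ M) (hy : y ∈ M) :
    π (ZFSet.pair x y) = ZFSet.pair (π x) (π y) := by
  have h1 := hM.upair hx hx
  have h := hπ.upair hM h1 (hM.upair hx hy)
  rw [hπ.upair hM hx hx, hπ.upair hM hx hy] at h
  simpa [ZFSet.pair] using h

theorem IsColl.of_pair (hM : OpClosed M) (hπ : IsColl M π) {w x y : V} (hw : w ∈ M)
    (h : π w = ZFSet.pair x y) :
    ∃ x' ∈ M, ∃ y' ∈ M, w = ZFSet.pair x' y' ∧ x = π x' ∧ y = π y' := by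
  have h1 : ({x, y} : V) ∈ π w := by rw [h]; simp [ZFSet.pair]
  obtain ⟨u, hu, -, e⟩ := (hπ w hw _).1 h1
  have hx : x ∈ π u := by rw [← e]; simp
  have hy : y ∈ π u := by rw [← e]; simp
  obtain ⟨x', hx', -, rfl⟩ := (hπ u hu _).1 hx
  obtain ⟨y', hy', -, rfl⟩ := (hπ u hu _).1 hy
  refine ⟨x', hx', y', hy', ?_, rfl, rfl⟩
  apply hπ.inj hM _ hw _ (hM.pair_mem hx' hy')
  rw [h, hπ.pair hM hx' hy']

theorem IsColl.pair_mem_iff (hM : OpClosed M) (hπ : IsColl M π) {x y a : V} (hx : x ∈ M)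
    (hy : y ∈ M) (ha : a ∈ M) : ZFSet.pair (π x) (π y) ∈ π a ↔ ZFSet.pair x y ∈ a := by
  rw [← hπ.pair hM hx hy, hπ.mem_iff hM ha (hM.pair_mem hx hy)]

theorem IsColl.op (hM : OpClosed M) (hπ : IsColl M π) {k : ℕ} (hk : k < 8) {a b : V}
    (ha : a ∈ M) (hb : b ∈ M) : π (op k a b) = op k (π a) (π b) := by
  have hc := hM.op k hk a ha b hb
  ext z
  rw [hπ _ hc]
  have hA : ∀ {z}, z ∈ π a → ∃ x ∈ M, x ∈ a ∧ z = π x := fun h => (hπ a ha _).1 h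
  have hB : ∀ {z}, z ∈ π b → ∃ x ∈ M, x ∈ b ∧ z = π x := fun h => (hπ b hb _).1 h
  have hA' : ∀ {x}, x ∈ M → (π x ∈ π a ↔ x ∈ a) := fun h => hπ.mem_iff hM ha h
  have hB' : ∀ {x}, x ∈ M → (π x ∈ π b ↔ x ∈ b) := fun h => hπ.mem_iff hM hb h
  rcases k with _ | _ | _ | _ | _ | _ | _ | k
  · simp only [SRPPaper.op, ZFSet.mem_pair]
    constructor
    · rintro ⟨w, hw, rfl | rfl, rfl⟩ <;> simp
    · rintro (rfl | rfl)
      exacts [⟨a, ha, by simp, rfl⟩, ⟨b, hb, by simp, rfl⟩]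
  · simp only [SRPPaper.op, ZFSet.mem_sdiff]
    constructor
    · rintro ⟨w, hw, ⟨h1, h2⟩, rfl⟩
      exact ⟨(hA' hw).2 h1, fun h => h2 ((hB' hw).1 h)⟩
    · rintro ⟨h1, h2⟩
      obtain ⟨w, hw, h, rfl⟩ := hA h1
      exact ⟨w, hw, ⟨h, fun h' => h2 ((hB' hw).2 h')⟩, rfl⟩
  · simp only [SRPPaper.op, ZFSet.mem_prod]
    constructor
    · rintro ⟨w, hw, ⟨u, hu, v, hv, rfl⟩, rfl⟩
      obtain ⟨h1, h2⟩ := hM.pair _ _ hw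
      exact ⟨_, (hA' h1).2 hu, _, (hB' h2).2 hv, hπ.pair hM h1 h2⟩
    · rintro ⟨u', hu', v', hv', rfl⟩
      obtain ⟨u, hu, h1, rfl⟩ := hA hu'
      obtain ⟨v, hv, h2, rfl⟩ := hB hv'
      exact ⟨_, hM.pair_mem hu hv, ⟨u, h1, v, h2, rfl⟩, (hπ.pair hM hu hv).symm⟩
  · simp only [SRPPaper.op, mem_rng]
    constructor
    · rintro ⟨w, hw, h, rfl⟩
      obtain ⟨x, hx, h⟩ := hM.rng a ha w hw h
      exact ⟨π x, (hπ.pair_mem_iff hM hx hw ha).2 h⟩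
    · rintro ⟨x, h'⟩
      obtain ⟨w, hw, h, e⟩ := hA h'
      obtain ⟨x', hx', z', hz', rfl, rfl, rfl⟩ := hπ.of_pair hM hw e.symm
      exact ⟨z', hz', ⟨x', h⟩, rfl⟩
  · simp only [SRPPaper.op, mem_opE]
    constructor
    · rintro ⟨p, hp, ⟨x, hx, y, hy, w, hw, rfl, h⟩, rfl⟩
      obtain ⟨h1, h2⟩ := hM.pair _ _ hp
      obtain ⟨h2, h3⟩ := hM.pair _ _ h2
      exact ⟨_, (hA' h1).2 hx, _, (hA' h2).2 hy, _, (hB' h3).2 hw,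
        by rw [hπ.pair hM h1 (hM.pair_mem h2 h3), hπ.pair hM h2 h3], (hπ.mem_iff hM h2 h1).2 h⟩
    · rintro ⟨x', hx', y', hy', w', hw', rfl, h⟩
      obtain ⟨x, h1, hx, rfl⟩ := hA hx'
      obtain ⟨y, h2, hy, rfl⟩ := hA hy'
      obtain ⟨w, h3, hw, rfl⟩ := hB hw'
      exact ⟨_, hM.pair_mem h1 (hM.pair_mem h2 h3),
        ⟨x, hx, y, hy, w, hw, rfl, (hπ.mem_iff hM h2 h1).1 h⟩,
        by rw [hπ.pair hM h1 (hM.pair_mem h2 h3), hπ.pair hM h2 h3]⟩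
  · simp only [SRPPaper.op, mem_opEq]
    constructor
    · rintro ⟨p, hp, ⟨x, hx, w, hw, rfl⟩, rfl⟩
      obtain ⟨h1, h2⟩ := hM.pair _ _ hp
      obtain ⟨h2, h3⟩ := hM.pair _ _ h2
      exact ⟨_, (hA' h1).2 hx, _, (hB' h3).2 hw,
        by rw [hπ.pair hM h1 (hM.pair_mem h2 h3), hπ.pair hM h2 h3]⟩
    · rintro ⟨x', hx', w', hw', rfl⟩
      obtain ⟨x, h1, hx, rfl⟩ := hA hx'
      obtain ⟨w, h3, hw, rfl⟩ := hB hw'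
      exact ⟨_, hM.pair_mem h1 (hM.pair_mem h1 h3), ⟨x, hx, w, hw, rfl⟩,
        by rw [hπ.pair hM h1 (hM.pair_mem h1 h3), hπ.pair hM h1 h3]⟩
  · simp only [SRPPaper.op, mem_opSwap]
    constructor
    · rintro ⟨p, hp, ⟨x, y, w, rfl, h⟩, rfl⟩
      obtain ⟨h1, h2⟩ := hM.pair _ _ hp
      obtain ⟨h2, h3⟩ := hM.pair _ _ h2
      refine ⟨π x, π y, π w, by rw [hπ.pair hM h1 (hM.pair_mem h2 h3), hπ.pair hM h2 h3], ?_⟩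
      rw [← hπ.pair hM h1 h3, hπ.pair_mem_iff hM h2 (hM.pair_mem h1 h3) ha]
      exact h
    · rintro ⟨x', y', w', rfl, h'⟩
      obtain ⟨p, hp, h, e⟩ := hA h'
      obtain ⟨y, hy, q, hq, rfl, rfl, e'⟩ := hπ.of_pair hM hp e.symm
      obtain ⟨x, hx, w, hw, rfl, rfl, rfl⟩ := hπ.of_pair hM hq e'.symm
      exact ⟨_, hM.pair_mem hx (hM.pair_mem hy hw), ⟨x, y, w, rfl, h⟩,
        by rw [hπ.pair hM hx (hM.pair_mem hy hw), hπ.pair hM hy hw]⟩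
  · simp only [SRPPaper.op, mem_opSec]
    constructor
    · rintro ⟨w, hw, h, rfl⟩
      exact (hπ.pair_mem_iff hM hw hb ha).2 h
    · intro h
      obtain ⟨w, hw, h', e⟩ := hA h
      obtain ⟨x', hx', z', hz', rfl, rfl, e'⟩ := hπ.of_pair hM hw e.symm
      obtain rfl := hπ.inj hM _ hb _ hz' e'
      exact ⟨x', hx', h', rfl⟩

end

/-! ## The order type function of a set of ordinals -/

section
variable {H : Set Ordinal.{0}}

/-- The order type of `H ∩ α`. -/
def G (H : Set Ordinal.{0}) : Ordinal.{0} → Ordinal.{0} :=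
  WellFounded.fix (C := fun _ => Ordinal.{0}) wellFounded_lt fun α ih =>
    sInf {c | ∀ ξ, ∀ h : ξ < α, ξ ∈ H → ih ξ h < c}

theorem G_eq (α : Ordinal.{0}) : G H α = sInf {c | ∀ ξ, ξ < α → ξ ∈ H → G H ξ < c} := by
  rw [G, WellFounded.fix_eq]

theorem G_lt {α ξ : Ordinal.{0}} (h : ξ < α) (hξ : ξ ∈ H) : G H ξ < G H α := by
  have hne : {c | ∀ ξ, ξ < α → ξ ∈ H → G H ξ < c}.Nonempty := by
    obtain ⟨b, hb⟩ := Ordinal.bddAbove_of_small (s := (G H) '' Set.Iio α)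
    exact ⟨Order.succ b, fun ξ hξ _ => Order.lt_succ_of_le (hb ⟨ξ, hξ, rfl⟩)⟩
  have := csInf_mem hne
  rw [← G_eq] at this
  exact this ξ h hξ

theorem lt_G {α c : Ordinal.{0}} : c < G H α ↔ ∃ ξ ∈ H, ξ < α ∧ G H ξ = c := by
  constructor
  · induction α using WellFoundedLT.induction with
    | ind α ih =>
      intro h
      have h' := h
      rw [G_eq] at h'
      have := notMem_of_lt_csInf h' (OrderBot.bddBelow _)
      simp only [Set.mem_ofPred_eq, not_forall, not_lt] at this
      obtain ⟨ξ, hξ, hH, hc⟩ := this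
      rcases hc.eq_or_lt with rfl | hc
      · exact ⟨ξ, hH, hξ, rfl⟩
      · obtain ⟨ζ, h1, h2, h3⟩ := ih ξ hξ hc
        exact ⟨ζ, h1, h2.trans hξ, h3⟩
  · rintro ⟨ξ, hξ, h, rfl⟩
    exact G_lt h hξ

theorem G_lt_iff {α ξ : Ordinal.{0}} (hα : α ∈ H) (hξ : ξ ∈ H) : G H ξ < G H α ↔ ξ < α := by
  refine ⟨fun h => ?_, fun h => G_lt h hξ⟩
  by_contra h'
  rcases (not_lt.1 h').eq_or_lt with rfl | h'
  · exact lt_irrefl _ h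
  · exact lt_asymm h (G_lt h' hα)

theorem G_inj {α ξ : Ordinal.{0}} (hα : α ∈ H) (hξ : ξ ∈ H) (h : G H ξ = G H α) : ξ = α := by
  rcases lt_trichotomy ξ α with h' | h' | h'
  · exact absurd h (G_lt h' hξ).ne
  · exact h'
  · exact absurd h (G_lt h' hα).ne'

theorem G_of_subset {α : Ordinal.{0}} (h : ∀ ξ < α, ξ ∈ H) : G H α = α := by
  induction α using WellFoundedLT.induction with
  | ind α ih =>
    refine eq_of_forall_lt_iff fun c => ?_
    rw [lt_G]
    constructor
    · rintro ⟨ξ, -, hξ, rfl⟩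
      rwa [ih ξ hξ fun z hz => h z (hz.trans hξ)]
    · exact fun hc => ⟨c, h c hc, hc, ih c hc fun z hz => h z (hz.trans hc)⟩

theorem G_J (hJ : ∀ a ∈ H, ∀ b ∈ H, J (a, b) ∈ H)
    (hU : ∀ a ∈ H, (unJ a).1 ∈ H ∧ (unJ a).2 ∈ H) {a b : Ordinal.{0}} (ha : a ∈ H) (hb : b ∈ H) :
    G H (J (a, b)) = J (G H a, G H b) := by
  have key : ∀ ξ, ξ ∈ H → G H ξ = J (G H (unJ ξ).1, G H (unJ ξ).2) := by
    intro ξ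
    induction ξ using WellFoundedLT.induction with
    | ind ξ ih =>
      intro hξ
      have hlt : ∀ {a b}, a ∈ H → b ∈ H → (G H a < G H b ↔ a < b) := fun ha hb => G_lt_iff hb ha
      have hmax : ∀ {a b}, a ∈ H → b ∈ H → max (G H a) (G H b) = G H (max a b) := by
        intro a b ha hb
        rcases lt_trichotomy a b with h | rfl | h
        · rw [max_eq_right h.le, max_eq_right (G_lt h ha).le]
        · simp
        · rw [max_eq_left h.le, max_eq_left (G_lt h hb).le]
      have hmaxm : ∀ {a b}, a ∈ H → b ∈ H → max a b ∈ H := by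
        intro a b ha hb
        rcases max_choice a b with h | h <;> rw [h] <;> assumption
      have hG : ∀ {a b c d}, a ∈ H → b ∈ H → c ∈ H → d ∈ H →
          (GLt (G H a, G H b) (G H c, G H d) ↔ GLt (a, b) (c, d)) := by
        intro a b c d ha hb hc hd
        have e : ∀ {a b}, a ∈ H → b ∈ H → (G H a = G H b ↔ a = b) :=
          fun ha hb => ⟨fun h => G_inj hb ha h, fun h => by rw [h]⟩
        simp only [gLt_iff, hmax ha hb, hmax hc hd, hlt (hmaxm ha hb) (hmaxm hc hd),
          e (hmaxm ha hb) (hmaxm hc hd), hlt ha hc, e ha hc, hlt hb hd]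
      refine eq_of_forall_lt_iff fun c => ?_
      rw [lt_G, lt_J]
      constructor
      · rintro ⟨ζ, hζ, h, rfl⟩
        refine ⟨_, (hG (hU ζ hζ).1 (hU ζ hζ).2 (hU ξ hξ).1 (hU ξ hξ).2).2 ?_, (ih ζ h hζ).symm⟩
        rw [← J_lt_iff]
        exact (J_unJ ζ).trans_lt (h.trans_eq (J_unJ ξ).symm)
      · rintro ⟨⟨p, q⟩, h, rfl⟩
        have hb : ∀ r, r ≤ max p q → ∃ r' ∈ H, G H r' = r := by
          intro r hr
          have h1 : r ≤ max (G H (unJ ξ).1) (G H (unJ ξ).2) := by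
            refine hr.trans ?_
            rw [gLt_iff] at h
            rcases h with h | h
            · exact h.le
            · exact h.1.le
          rw [hmax (hU ξ hξ).1 (hU ξ hξ).2] at h1
          rcases h1.eq_or_lt with rfl | h1
          · exact ⟨_, hmaxm (hU ξ hξ).1 (hU ξ hξ).2, rfl⟩
          · obtain ⟨r', h2, -, h3⟩ := lt_G.1 h1
            exact ⟨r', h2, h3⟩
        obtain ⟨p, hp, rfl⟩ := hb p (le_max_left _ _)
        obtain ⟨q, hq, rfl⟩ := hb q (le_max_right _ _)
        have h2 : J (p, q) < ξ := by
          rw [← J_unJ ξ, J_lt_iff]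
          exact (hG hp hq (hU ξ hξ).1 (hU ξ hξ).2).1 h
        refine ⟨J (p, q), hJ p hp q hq, h2, ?_⟩
        rw [ih _ h2 (hJ p hp q hq), unJ_J]
  rw [key _ (hJ a ha b hb), unJ_J]

/-- Closure conditions on a set of ordinals under which the set of values of `F` condenses. -/
structure Clos (H : Set Ordinal.{0}) : Prop where
  nat : ∀ n : ℕ, (n : Ordinal.{0}) ∈ H
  J : ∀ a ∈ H, ∀ b ∈ H, J (a, b) ∈ H
  unJ : ∀ a ∈ H, (unJ a).1 ∈ H ∧ (unJ a).2 ∈ H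
  ext : ∀ a ∈ H, ∀ b ∈ H, F a ≠ F b → ∃ ξ ∈ H, ¬ (F ξ ∈ F a ↔ F ξ ∈ F b)
  idx : ∀ a ∈ H, ∀ b ∈ H, (∃ ξ < a, F ξ = F b) → ∃ ξ ∈ H, ξ < a ∧ F ξ = F b
  rng : ∀ a ∈ H, ∀ b ∈ H, (∃ x, pair x (F b) ∈ F a) → ∃ ξ ∈ H, pair (F ξ) (F b) ∈ F a
  pair : ∀ a ∈ H, ∀ x y, F a = pair x y → ∃ ξ ∈ H, ∃ ζ ∈ H, x = F ξ ∧ y = F ζ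

theorem Clos.opClosed (hH : Clos H) : OpClosed (F '' H) where
  ext := by
    rintro _ ⟨a, ha, rfl⟩ _ ⟨b, hb, rfl⟩ h
    obtain ⟨ξ, hξ, h⟩ := hH.ext a ha b hb h
    exact ⟨_, ⟨ξ, hξ, rfl⟩, h⟩
  op := by
    rintro k hk _ ⟨a, ha, rfl⟩ _ ⟨b, hb, rfl⟩
    exact ⟨_, hH.J _ (hH.nat (k + 1)) _ (hH.J a ha b hb), F_op hk a b⟩
  pair := by
    rintro x y ⟨a, ha, e⟩
    obtain ⟨ξ, hξ, ζ, hζ, rfl, rfl⟩ := hH.pair a ha x y e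
    exact ⟨⟨ξ, hξ, rfl⟩, ⟨ζ, hζ, rfl⟩⟩
  rng := by
    rintro _ ⟨a, ha, rfl⟩ _ ⟨b, hb, rfl⟩ h
    obtain ⟨ξ, hξ, h⟩ := hH.rng a ha b hb h
    exact ⟨_, ⟨ξ, hξ, rfl⟩, h⟩

theorem Clos.G_J (hH : Clos H) {a b : Ordinal.{0}} (ha : a ∈ H) (hb : b ∈ H) :
    G H (SRPPaper.J (a, b)) = SRPPaper.J (G H a, G H b) := SRPPaper.G_J hH.J hH.unJ ha hb

theorem Clos.G_nat (hH : Clos H) (n : ℕ) : G H n = n :=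
  G_of_subset fun ξ hξ => by
    obtain ⟨m, rfl⟩ := Ordinal.lt_omega0.1 (hξ.trans (Ordinal.natCast_lt_omega0 n))
    exact hH.nat m

theorem Clos.collapse_F (hH : Clos H) {π : V → V} (hπ : IsColl (F '' H) π) {α : Ordinal.{0}}
    (hα : α ∈ H) : π (F α) = F (G H α) := by
  have hM := hH.opClosed
  induction α using WellFoundedLT.induction with
  | ind α ih =>
    obtain ⟨h1, h2⟩ := hH.unJ α hα
    obtain ⟨h3, h4⟩ := hH.unJ _ h2
    have hG : G H α = SRPPaper.J (G H (SRPPaper.unJ α).1, G H (SRPPaper.unJ α).2) := by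
      rw [← hH.G_J h1 h2, J_unJ]
    have hG2 : G H (SRPPaper.unJ α).2 = SRPPaper.J (G H (SRPPaper.unJ (SRPPaper.unJ α).2).1,
        G H (SRPPaper.unJ (SRPPaper.unJ α).2).2) := by
      rw [← hH.G_J h3 h4, J_unJ]
    have hop : ∀ k, HasOp (G H α) k ↔ HasOp α k := by
      intro k
      unfold HasOp
      rw [hG, unJ_J]
      refine and_congr_right fun _ => ?_
      exact ⟨fun h => G_inj (hH.nat _) h1 (h.trans (hH.G_nat (k + 1)).symm),
        fun h => (congrArg (G H) h).trans (hH.G_nat (k + 1))⟩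
    by_cases h : ∃ k, HasOp α k
    · obtain ⟨k, hk⟩ := h
      rw [F_op' hk, F_op' ((hop k).2 hk), hπ.op hM hk.1 ⟨_, h3, rfl⟩ ⟨_, h4, rfl⟩,
        ih _ hk.lt_fst h3, ih _ hk.lt_snd h4, hG, unJ_J, hG2, unJ_J]
    · ext z
      rw [hπ _ ⟨α, hα, rfl⟩, mem_F_of_not (α := G H α) (by simpa only [hop] using h)]
      constructor
      · rintro ⟨_, ⟨ξ, hξ, rfl⟩, hm, rfl⟩
        obtain ⟨ξ₀, h0, e⟩ := (mem_F_of_not h).1 hm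
        obtain ⟨ξ', h5, h6, h7⟩ := hH.idx α hα ξ hξ ⟨ξ₀, h0, e.symm⟩
        exact ⟨_, G_lt h6 h5, by rw [← h7, ih _ h6 h5]⟩
      · rintro ⟨c, hc, rfl⟩
        obtain ⟨ξ, hξ, hlt, rfl⟩ := lt_G.1 hc
        exact ⟨_, ⟨ξ, hξ, rfl⟩, (mem_F_of_not h).2 ⟨ξ, hlt, rfl⟩, (ih ξ hlt hξ).symm⟩

end

theorem jr_oz {a b : Ordinal.{0}} {c : V} : Jr (oz a) (oz b) c ↔ c = oz (J (a, b)) := by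
  constructor
  · rintro ⟨α, β, h1, h2, rfl⟩
    rw [oz_inj.1 h1, oz_inj.1 h2]
  · rintro rfl
    exact ⟨a, b, rfl, rfl, rfl⟩

theorem jr_oz' {a b : V} {c : Ordinal.{0}} :
    Jr a b (oz c) ↔ a = oz (unJ c).1 ∧ b = oz (unJ c).2 := by
  constructor
  · rintro ⟨α, β, rfl, rfl, h⟩
    rw [oz_inj.1 h, unJ_J]
    exact ⟨rfl, rfl⟩
  · rintro ⟨rfl, rfl⟩
    rw [jr_oz, J_unJ]

theorem fr_oz {a : Ordinal.{0}} {c : V} : Fr (oz a) c ↔ c = F a := by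
  constructor
  · rintro ⟨α, h1, rfl⟩
    rw [oz_inj.1 h1]
  · rintro rfl
    exact ⟨a, rfl, rfl⟩

/-- The value of `F` at a von Neumann ordinal. -/
def Fv (x : V) : V := if IsOrd x then F x.rank else ∅

@[simp] theorem Fv_oz (a : Ordinal.{0}) : Fv (oz a) = F a := by
  rw [Fv, if_pos (isOrd_oz a), rank_oz]

/-- The value of the pairing function at von Neumann ordinals. -/
def Jt (x y : V) : V := if IsOrd x ∧ IsOrd y then oz (J (x.rank, y.rank)) else ∅

@[simp] theorem Jt_oz (a b : Ordinal.{0}) : Jt (oz a) (oz b) = oz (J (a, b)) := by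
  rw [Jt, if_pos ⟨isOrd_oz a, isOrd_oz b⟩, rank_oz, rank_oz]

instance DfnF.Fv_inst {W A : Set V} [hW : Good W] [Par W A] {s : Env → V} [hs : DfnF W A s] :
    DfnF W A (fun v => Fv (s v)) where
  mem' v hv := by
    have h := hs.mem' v hv
    by_cases ho : IsOrd (s v)
    · obtain ⟨a, ha⟩ := isOrd_iff.1 ho
      simp only [ha] at h ⊢
      rw [Fv_oz]
      exact Good.F_mem h
    · simp only [Fv, if_neg ho]
      exact hW.empty
  graph := by
    have h' := hs.shift
    refine Dfn.of_iff (P := fun v => Fr (s (tl v)) (v 0) ∨ (¬ IsOrd (s (tl v)) ∧ v 0 = ∅))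
      inferInstance fun v _ => ?_
    by_cases ho : IsOrd (s (tl v))
    · obtain ⟨a, ha⟩ := isOrd_iff.1 ho
      simp [ha, fr_oz, isOrd_oz]
    · have : ¬ Fr (s (tl v)) (v 0) := fun ⟨a, ha, _⟩ => ho (ha ▸ isOrd_oz a)
      simp [Fv, ho, this]

instance DfnF.Jt_inst {W A : Set V} [hW : Good W] [Par W A] {s t : Env → V} [hs : DfnF W A s]
    [ht : DfnF W A t] : DfnF W A (fun v => Jt (s v) (t v)) where
  mem' v hv := by
    have h := hs.mem' v hv
    have h' := ht.mem' v hv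
    by_cases ho : IsOrd (s v) ∧ IsOrd (t v)
    · obtain ⟨a, ha⟩ := isOrd_iff.1 ho.1
      obtain ⟨b, hb⟩ := isOrd_iff.1 ho.2
      simp only [ha, hb] at h h' ⊢
      rw [Jt_oz]
      exact Good.J_mem h h'
    · simp only [Jt, if_neg ho]
      exact hW.empty
  graph := by
    have h' := hs.shift
    have h'' := ht.shift
    refine Dfn.of_iff (P := fun v => Jr (s (tl v)) (t (tl v)) (v 0) ∨
      (¬ (IsOrd (s (tl v)) ∧ IsOrd (t (tl v))) ∧ v 0 = ∅))
      inferInstance fun v _ => ?_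
    by_cases ho : IsOrd (s (tl v)) ∧ IsOrd (t (tl v))
    · obtain ⟨a, ha⟩ := isOrd_iff.1 ho.1
      obtain ⟨b, hb⟩ := isOrd_iff.1 ho.2
      simp [ha, hb, jr_oz, isOrd_oz]
    · have : ¬ Jr (s (tl v)) (t (tl v)) (v 0) :=
        fun ⟨a, b, ha, hb, _⟩ => ho ⟨ha ▸ isOrd_oz a, hb ▸ isOrd_oz b⟩
      simp [Jt, ho, this]

/-! ## Definable hulls in `L` -/

section
variable (T : V → V → V → V → V → Prop)

/-- The least ordinal satisfying `Q`, or `0`. -/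
def lst (Q : Ordinal.{0} → Prop) : Ordinal.{0} := sInf {ξ | Q ξ}

theorem lst_spec {Q : Ordinal.{0} → Prop} (h : ∃ ξ, Q ξ) : Q (lst Q) := csInf_mem (s := {ξ | Q ξ}) h

theorem lst_zero {Q : Ordinal.{0} → Prop} (h : ¬ ∃ ξ, Q ξ) : lst Q = 0 := by
  have : {ξ | Q ξ} = ∅ := by
    ext ξ
    exact ⟨fun hξ => h ⟨ξ, hξ⟩, fun h => h.elim⟩
  rw [lst, this, Ordinal.sInf_empty]

theorem lst_min {Q : Ordinal.{0} → Prop} {ξ : Ordinal.{0}} (h : ξ < lst Q) : ¬ Q ξ := fun hQ =>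
  notMem_of_lt_csInf h (OrderBot.bddBelow _) hQ

/-- The enumeration of the hull generated by least witnesses for `T`. -/
def Hl : Ordinal.{0} → Ordinal.{0} :=
  WellFounded.fix (C := fun _ => Ordinal.{0}) wellFounded_lt fun c ih =>
    lst fun ξ => T (oz (unJ c).1) (oz (unJ c).2)
      (oz (if h : (unJ (unJ c).2).1 < c then ih _ h else 0))
      (oz (if h : (unJ (unJ c).2).2 < c then ih _ h else 0)) (oz ξ)

theorem Hl_eq (c : Ordinal.{0}) : Hl T c = lst fun ξ => T (oz (unJ c).1) (oz (unJ c).2)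
      (oz (if (unJ (unJ c).2).1 < c then Hl T (unJ (unJ c).2).1 else 0))
      (oz (if (unJ (unJ c).2).2 < c then Hl T (unJ (unJ c).2).2 else 0)) (oz ξ) := by
  conv_lhs => rw [Hl, WellFounded.fix_eq]
  rfl

theorem Hl_J {i : Ordinal.{0}} (hi : 0 < i) (a b : Ordinal.{0}) :
    Hl T (J (i, J (a, b))) =
      lst fun ξ => T (oz i) (oz (J (a, b))) (oz (Hl T a)) (oz (Hl T b)) (oz ξ) := by
  have h := lt_J_of_pos (c := J (a, b)) hi
  rw [Hl_eq]
  simp only [unJ_J, if_pos ((left_le_J a b).trans_lt h), if_pos ((right_le_J a b).trans_lt h)]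

set_option synthInstance.maxHeartbeats 400000 in
set_option synthInstance.maxSize 2000 in
theorem Hl_dfn (hT : Dfn LClass LClass (fun v => T (v 0) (v 1) (v 2) (v 3) (v 4))) :
    Dfn LClass LClass (fun v => IsOrd (v 0) ∧ v 1 = oz (Hl T (v 0).rank)) := by
  have hT' : ∀ (m₀ m₁ m₂ m₃ m₄ : Env → Env) (i₀ i₁ i₂ i₃ i₄ : ℕ)
      [EMap m₀] [EMap m₁] [EMap m₂] [EMap m₃] [EMap m₄],
      Dfn LClass LClass (fun v => T (m₀ v i₀) (m₁ v i₁) (m₂ v i₂) (m₃ v i₃) (m₄ v i₄)) := by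
    intro m₀ m₁ m₂ m₃ m₄ i₀ i₁ i₂ i₃ i₄ h₀ h₁ h₂ h₃ h₄
    obtain ⟨k₀, h₀⟩ := h₀.out
    obtain ⟨k₁, h₁⟩ := h₁.out
    obtain ⟨k₂, h₂⟩ := h₂.out
    obtain ⟨k₃, h₃⟩ := h₃.out
    obtain ⟨k₄, h₄⟩ := h₄.out
    refine (hT.ren (fun n => match n with
      | 0 => i₀ + k₀
      | 1 => i₁ + k₁
      | 2 => i₂ + k₂
      | 3 => i₃ + k₃
      | _ => i₄ + k₄)).of_iff fun v _ => ?_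
    simp only [h₀, h₁, h₂, h₃, h₄]
  have key : ∀ c : Ordinal.{0}, ∀ a A, (pair a A ∈ grph (fun x => oz (Hl T x.rank)) (oz c) ∨
      (a ∉ oz c ∧ A = ∅)) ∧ IsOrd a ↔ ∃ α, a = oz α ∧ A = oz (if α < c then Hl T α else 0) := by
    intro c a A
    rw [pair_mem_grph]
    constructor
    · rintro ⟨h, ho⟩
      obtain ⟨α, rfl⟩ := isOrd_iff.1 ho
      refine ⟨α, rfl, ?_⟩
      rw [oz_mem, rank_oz] at h
      rcases h with ⟨h, rfl⟩ | ⟨h, rfl⟩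
      · rw [if_pos h]
      · rw [if_neg h, oz_zero]
    · rintro ⟨α, rfl, rfl⟩
      refine ⟨?_, isOrd_oz α⟩
      rw [oz_mem, rank_oz]
      by_cases h : α < c
      · exact .inl ⟨h, by rw [if_pos h]⟩
      · exact .inr ⟨h, by rw [if_neg h, oz_zero]⟩
  refine (definable_recursion (W := LClass) (A := LClass) (C := IsOrd) (pred := fun x => x)
    (Φ := fun x => oz (Hl T x.rank))
    (Γ := fun x g y => ∃ i ∈ LClass, ∃ d ∈ LClass, Jr i d x ∧ ∃ a ∈ LClass, ∃ b ∈ LClass, Jr a b d ∧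
      ∃ A ∈ LClass, ∃ B ∈ LClass, ((pair a A ∈ g ∨ (¬ a ∈ x ∧ A = ∅)) ∧ IsOrd a) ∧
        ((pair b B ∈ g ∨ (¬ b ∈ x ∧ B = ∅)) ∧ IsOrd b) ∧ IsOrd y ∧
        ((T i d A B y ∧ ∀ z ∈ y, ¬ T i d A B z) ∨
          (y = ∅ ∧ ¬ ∃ z ∈ LClass, IsOrd z ∧ T i d A B z)))
    inferInstance inferInstance inferInstance (fun Q h => ord_induction h) ?_ ?_).2
  · intro x hx y hy
    obtain ⟨a, rfl⟩ := isOrd_iff.1 hx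
    obtain ⟨b, hb, rfl⟩ := mem_oz.1 hy
    exact ⟨isOrd_oz b, oz_sub.2 hb.le⟩
  · intro x hx ho hg
    obtain ⟨c, rfl⟩ := isOrd_iff.1 ho
    refine ⟨oz_mem_L _, fun y hy => ?_⟩
    simp only [key, rank_oz]
    rw [Hl_eq T c]
    set Q : Ordinal.{0} → Prop := fun ξ => T (oz (unJ c).1) (oz (unJ c).2)
      (oz (if (unJ (unJ c).2).1 < c then Hl T (unJ (unJ c).2).1 else 0))
      (oz (if (unJ (unJ c).2).2 < c then Hl T (unJ (unJ c).2).2 else 0)) (oz ξ) with hQ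
    constructor
    · rintro ⟨i, -, d, -, hid, a, -, b, -, hab, A, -, B, -, ⟨α, rfl, rfl⟩, ⟨β, rfl, rfl⟩, hyo, h⟩
      obtain ⟨rfl, rfl⟩ := jr_oz'.1 hid
      obtain ⟨h1, h2⟩ := jr_oz'.1 hab
      obtain rfl := oz_inj.1 h1
      obtain rfl := oz_inj.1 h2
      obtain ⟨η, rfl⟩ := isOrd_iff.1 hyo
      rw [oz_inj]
      rcases h with ⟨h1, h2⟩ | ⟨h1, h2⟩
      · rcases lt_trichotomy η (lst Q) with h | h | h
        · exact absurd h1 (lst_min h)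
        · exact h
        · exact absurd (lst_spec (Q := Q) ⟨η, h1⟩) (h2 _ (oz_mem.2 h))
      · rw [lst_zero]
        · rwa [← oz_inj, oz_zero]
        · rintro ⟨ξ, hξ⟩
          exact h2 ⟨oz ξ, oz_mem_L ξ, isOrd_oz ξ, hξ⟩
    · rintro rfl
      refine ⟨_, oz_mem_L _, _, oz_mem_L _, jr_oz'.2 ⟨rfl, rfl⟩, _, oz_mem_L _, _, oz_mem_L _,
        jr_oz'.2 ⟨rfl, rfl⟩, _, oz_mem_L _, _, oz_mem_L _, ⟨_, rfl, rfl⟩, ⟨_, rfl, rfl⟩,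
        isOrd_oz _, ?_⟩
      by_cases h : ∃ ξ, Q ξ
      · refine .inl ⟨lst_spec h, fun z hz hT => ?_⟩
        obtain ⟨ζ, hζ, rfl⟩ := mem_oz.1 hz
        exact lst_min hζ hT
      · refine .inr ⟨by rw [lst_zero h, oz_zero], ?_⟩
        rintro ⟨z, -, ho, hz⟩
        obtain ⟨ξ, rfl⟩ := isOrd_iff.1 ho
        exact h ⟨ξ, hz⟩

theorem G_dfn {H : Set Ordinal.{0}}
    (hH : Dfn LClass LClass (fun v => ∃ ξ ∈ H, v 0 = oz ξ)) :
    Dfn LClass LClass (fun v => IsOrd (v 0) ∧ v 1 = oz (G H (v 0).rank)) := by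
  have hH' : ∀ (m : Env → Env) (i : ℕ) [EMap m],
      Dfn LClass LClass (fun v => ∃ ξ ∈ H, m v i = oz ξ) :=
    fun m i _ => Dfn.comp1 (R := fun x => ∃ ξ ∈ H, x = oz ξ) hH inferInstance
  refine (definable_recursion (W := LClass) (A := LClass) (C := IsOrd) (pred := fun x => x)
    (Φ := fun x => oz (G H x.rank))
    (Γ := fun x g y => ∀ z ∈ LClass, (z ∈ y ↔ ∃ u ∈ x, (∃ ξ ∈ H, u = oz ξ) ∧ pair u z ∈ g))
    inferInstance inferInstance inferInstance (fun Q h => ord_induction h) ?_ ?_).2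
  · intro x hx y hy
    obtain ⟨a, rfl⟩ := isOrd_iff.1 hx
    obtain ⟨b, hb, rfl⟩ := mem_oz.1 hy
    exact ⟨isOrd_oz b, oz_sub.2 hb.le⟩
  · intro x hx ho hg
    obtain ⟨c, rfl⟩ := isOrd_iff.1 ho
    refine ⟨oz_mem_L _, fun y hy => ?_⟩
    have key : ∀ z, z ∈ oz (G H c) ↔
        ∃ u ∈ oz c, (∃ ξ ∈ H, u = oz ξ) ∧ pair u z ∈ grph (fun x => oz (G H x.rank)) (oz c) := by
      intro z
      rw [mem_oz]
      constructor
      · rintro ⟨e, he, rfl⟩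
        obtain ⟨ξ, h1, h2, rfl⟩ := lt_G.1 he
        exact ⟨_, oz_mem.2 h2, ⟨ξ, h1, rfl⟩, pair_mem_grph.2 ⟨oz_mem.2 h2, by rw [rank_oz]⟩⟩
      · rintro ⟨_, h1, ⟨ξ, h2, rfl⟩, h3⟩
        obtain ⟨-, rfl⟩ := pair_mem_grph.1 h3
        rw [rank_oz]
        exact ⟨_, G_lt (oz_mem.1 h1) h2, rfl⟩
    rw [rank_oz]
    constructor
    · intro h
      ext z
      constructor
      · intro hz
        exact (key z).2 ((h z (good_L.trans _ hy _ hz)).1 hz)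
      · intro hz
        exact (h z (good_L.trans _ (oz_mem_L _) _ hz)).2 ((key z).1 hz)
    · rintro rfl z -
      exact key z

theorem G_hull_lt (hT : Dfn LClass LClass (fun v => T (v 0) (v 1) (v 2) (v 3) (v 4)))
    {lam γ : Ordinal.{0}} (hlam : LCard (oz lam)) (hγ : γ < lam) (ξ : Ordinal.{0}) :
    G (Hl T '' Set.Iio γ) ξ < lam := by
  set H := Hl T '' Set.Iio γ with hH
  by_contra hle
  rw [not_lt] at hle
  have hE : ∀ (m m' : Env → Env) (i j : ℕ) [EMap m] [EMap m'],
      Dfn LClass LClass (fun v => IsOrd (m v i) ∧ m' v j = oz (Hl T (m v i).rank)) :=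
    fun m m' i j _ _ => Dfn.comp2 (R := fun x y => IsOrd x ∧ y = oz (Hl T x.rank))
      (Hl_dfn T hT) inferInstance inferInstance
  have hγL : Fact (oz γ ∈ LClass) := ⟨oz_mem_L γ⟩
  have hHd : Dfn LClass LClass (fun v => ∃ ξ ∈ H, v 0 = oz ξ) := by
    refine Dfn.of_iff (P := fun v => ∃ c ∈ oz γ, IsOrd c ∧ v 0 = oz (Hl T c.rank)) inferInstance
      fun v _ => ?_
    constructor
    · rintro ⟨_, ⟨c, hc, rfl⟩, h⟩
      exact ⟨oz c, oz_mem.2 hc, isOrd_oz c, by rw [rank_oz, h]⟩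
    · rintro ⟨_, hc', -, h⟩
      obtain ⟨c, hc, rfl⟩ := mem_oz.1 hc'
      rw [rank_oz] at h
      exact ⟨_, ⟨c, hc, rfl⟩, h⟩
  have hG : ∀ (m m' : Env → Env) (i j : ℕ) [EMap m] [EMap m'],
      Dfn LClass LClass (fun v => IsOrd (m v i) ∧ m' v j = oz (G H (m v i).rank)) :=
    fun m m' i j _ _ => Dfn.comp2 (R := fun x y => IsOrd x ∧ y = oz (G H x.rank))
      (G_dfn hHd) inferInstance inferInstance
  have hlL : Fact (oz lam ∈ LClass) := ⟨oz_mem_L lam⟩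
  set f : V := ZFSet.sep (fun p => ∃ c ∈ oz γ, ∃ y ∈ oz lam, p = pair c y ∧
    ∃ e ∈ LClass, (IsOrd c ∧ e = oz (Hl T c.rank)) ∧ IsOrd e ∧ y = oz (G H e.rank))
    ((oz γ).prod (oz lam)) with hf
  have hfL : f ∈ LClass :=
    Good.sep inferInstance ((inferInstance : DfnF LClass LClass
      (fun _ => (oz γ).prod (oz lam))).mem' (fun _ => oz γ) fun _ => oz_mem_L γ)
  obtain ⟨ζ, hζ⟩ := mem_L_iff.1 hfL
  have mf : ∀ x y, pair x y ∈ f ↔ ∃ c < γ, x = oz c ∧ y ∈ oz lam ∧ y = oz (G H (Hl T c)) := by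
    intro x y
    rw [hf, ZFSet.mem_sep, ZFSet.pair_mem_prod]
    constructor
    · rintro ⟨-, x', hx, y', hy, h, e, he, ⟨ho, rfl⟩, ho', rfl⟩
      obtain ⟨c, hc, rfl⟩ := mem_oz.1 hx
      obtain ⟨rfl, rfl⟩ := ZFSet.pair_inj.1 h
      simp only [rank_oz] at hy ⊢
      exact ⟨c, hc, rfl, hy, rfl⟩
    · rintro ⟨c, hc, rfl, hy, rfl⟩
      exact ⟨⟨oz_mem.2 hc, hy⟩, _, oz_mem.2 hc, _, hy, rfl, _, oz_mem_L _,
        ⟨isOrd_oz c, by rw [rank_oz]⟩, isOrd_oz _, by rw [rank_oz]⟩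
  refine lCard_iff.1 hlam γ hγ ζ ?_
  rw [← hζ]
  intro y hy
  obtain ⟨b, hb, rfl⟩ := mem_oz.1 hy
  obtain ⟨_, ⟨c, hc, rfl⟩, -, he⟩ := lt_G.1 (hb.trans_le hle)
  refine ⟨oz c, oz_mem.2 hc, (mf _ _).2 ⟨c, hc, rfl, hy, by rw [he]⟩, fun y' hy' h => ?_⟩
  obtain ⟨c', -, h1, -, rfl⟩ := (mf _ _).1 h
  rw [← oz_inj.1 h1, he]

end

theorem mem_collapse {X y z : V} : z ∈ collapse X y ↔ ∃ w ∈ X, w ∈ y ∧ z = collapse X w := by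
  rw [collapse, WellFounded.fix_eq]
  simp only [mem_img, ZFSet.mem_sep]
  constructor
  · rintro ⟨w, ⟨h1, h2⟩, rfl⟩
    exact ⟨w, h2, h1, by rw [dif_pos h1]⟩
  · rintro ⟨w, h2, h1, rfl⟩
    exact ⟨w, ⟨h1, h2⟩, by rw [dif_pos h1]⟩

theorem natZ_inj {m n : ℕ} : natZ m = natZ n ↔ m = n := by
  rw [natZ_eq, natZ_eq, oz_inj, Nat.cast_inj]

/-- The relations whose least witnesses generate the hull. -/
def Tk (c : V) : ℕ → V → V → V → V → Prop
  | 0, d, _, _, x => x = d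
  | 1, _, _, _, x => x = c
  | 2, _, a, b, x => x = Jt a b
  | 3, _, a, _, x => ∃ y ∈ LClass, IsOrd y ∧ Jt x y = a
  | 4, _, a, _, x => ∃ y ∈ LClass, IsOrd y ∧ Jt y x = a
  | 5, _, a, b, x => ¬ (Fv x ∈ Fv a ↔ Fv x ∈ Fv b)
  | 6, _, a, b, x => x ∈ a ∧ Fv x = Fv b
  | 7, _, a, b, x => pair (Fv x) (Fv b) ∈ Fv a
  | 8, _, a, _, x => ∃ y ∈ LClass, Fv a = pair (Fv x) y
  | 9, _, a, _, x => ∃ y ∈ LClass, Fv a = pair y (Fv x)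
  | _, _, a, _, x => Fv x = a

/-- All the relations `Tk`, with the index as the first argument. -/
def TT (c i d a b x : V) : Prop := ∃ k, k < 11 ∧ i = natZ (k + 1) ∧ Tk c k d a b x

theorem TT_natZ {c d a b x : V} {k : ℕ} (hk : k < 11) :
    TT c (oz ((k + 1 : ℕ) : Ordinal.{0})) d a b x ↔ Tk c k d a b x := by
  rw [← natZ_eq]
  constructor
  · rintro ⟨l, -, h, h'⟩
    obtain rfl : k = l := by simpa using natZ_inj.1 h
    exact h'
  · exact fun h => ⟨k, hk, rfl, h⟩

theorem TT_dfn {c : V} (hc : c ∈ LClass) :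
    Dfn LClass LClass (fun v => TT c (v 0) (v 1) (v 2) (v 3) (v 4)) := by
  have : Fact (c ∈ LClass) := ⟨hc⟩
  refine Dfn.exLt 11 fun k => ?_
  have : Dfn LClass LClass (fun v => Tk c k (v 1) (v 2) (v 3) (v 4)) := by
    rcases k with _ | _ | _ | _ | _ | _ | _ | _ | _ | _ | k <;> simp only [Tk] <;> infer_instance
  infer_instance

section
variable {c : V} {γ : Ordinal.{0}} (hγ : JCl γ)
include hγ

theorem hull_wit {k : ℕ} (hk : k < 11) {d : Ordinal.{0}} (hd : d < γ) :
    (∃ ξ, Tk c k (oz d) (oz (Hl (TT c) (unJ d).1)) (oz (Hl (TT c) (unJ d).2)) (oz ξ)) →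
    ∃ ξ ∈ Hl (TT c) '' Set.Iio γ,
      Tk c k (oz d) (oz (Hl (TT c) (unJ d).1)) (oz (Hl (TT c) (unJ d).2)) (oz ξ) := by
  intro h
  refine ⟨_, ⟨J (((k + 1 : ℕ) : Ordinal.{0}), d), hγ.pair _ (hγ.nat _) _ hd, rfl⟩, ?_⟩
  have h2 := Hl_J (TT c) (i := ((k + 1 : ℕ) : Ordinal.{0})) (by exact_mod_cast Nat.succ_pos k)
    (unJ d).1 (unJ d).2
  rw [show (((unJ d).1, (unJ d).2) : Ordinal.{0} × Ordinal.{0}) = unJ d from rfl, J_unJ] at h2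
  rw [h2]
  simp only [TT_natZ hk]
  exact lst_spec h

theorem hull_wit₂ {k : ℕ} (hk : k < 11) {a b : Ordinal.{0}} (ha : a ∈ Hl (TT c) '' Set.Iio γ)
    (hb : b ∈ Hl (TT c) '' Set.Iio γ) (h : ∃ ξ, ∀ d, Tk c k d (oz a) (oz b) (oz ξ)) :
    ∃ ξ ∈ Hl (TT c) '' Set.Iio γ, ∃ d, Tk c k d (oz a) (oz b) (oz ξ) := by
  obtain ⟨a, ha, rfl⟩ := ha
  obtain ⟨b, hb, rfl⟩ := hb
  have := hull_wit hγ (c := c) hk (hγ.pair a ha b hb)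
  rw [unJ_J] at this
  obtain ⟨ξ, h1, h2⟩ := this (h.imp fun ξ h => h _)
  exact ⟨ξ, h1, _, h2⟩

theorem hull_of_lt {d : Ordinal.{0}} (hd : d < γ) : d ∈ Hl (TT c) '' Set.Iio γ := by
  obtain ⟨ξ, h1, h2⟩ := hull_wit hγ (c := c) (k := 0) (by norm_num) hd ⟨d, rfl⟩
  rwa [oz_inj.1 h2] at h1

theorem hull_param {ξ₀ : Ordinal.{0}} : ξ₀ ∈ Hl (TT (oz ξ₀)) '' Set.Iio γ := by
  obtain ⟨ξ, h1, h2⟩ := hull_wit hγ (c := oz ξ₀) (k := 1) (by norm_num) (hγ.nat 0) ⟨ξ₀, rfl⟩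
  rwa [oz_inj.1 h2] at h1

theorem hull_oz {a : Ordinal.{0}} (ha : a < γ) : ∃ ξ ∈ Hl (TT c) '' Set.Iio γ, F ξ = oz a := by
  obtain ⟨ξ, hξ⟩ := mem_L_iff.1 (oz_mem_L a)
  obtain ⟨ζ, h1, d, h2⟩ := hull_wit₂ hγ (c := c) (k := 10) (by norm_num) (hull_of_lt hγ ha)
    (hull_of_lt hγ ha) ⟨ξ, fun d => by simp [Tk, hξ]⟩
  exact ⟨ζ, h1, by simpa [Tk] using h2⟩

theorem hull_clos : Clos (Hl (TT c) '' Set.Iio γ) where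
  nat n := hull_of_lt hγ (hγ.nat n)
  J a ha b hb := by
    obtain ⟨ζ, h1, d, h2⟩ := hull_wit₂ hγ (c := c) (k := 2) (by norm_num) ha hb
      ⟨SRPPaper.J (a, b), fun d => by simp [Tk]⟩
    simp only [Tk, Jt_oz, oz_inj] at h2
    rwa [h2] at h1
  unJ a ha := by
    constructor
    · obtain ⟨ζ, h1, d, h2⟩ := hull_wit₂ hγ (c := c) (k := 3) (by norm_num) ha ha
        ⟨(SRPPaper.unJ a).1, fun d => ⟨oz (SRPPaper.unJ a).2, oz_mem_L _, isOrd_oz _, by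
          rw [Jt_oz, Prod.mk.eta, J_unJ]⟩⟩
      obtain ⟨y, -, hy, h⟩ := h2
      obtain ⟨y, rfl⟩ := isOrd_iff.1 hy
      rw [Jt_oz, oz_inj] at h
      rwa [← h, unJ_J]
    · obtain ⟨ζ, h1, d, h2⟩ := hull_wit₂ hγ (c := c) (k := 4) (by norm_num) ha ha
        ⟨(SRPPaper.unJ a).2, fun d => ⟨oz (SRPPaper.unJ a).1, oz_mem_L _, isOrd_oz _, by
          rw [Jt_oz, Prod.mk.eta, J_unJ]⟩⟩
      obtain ⟨y, -, hy, h⟩ := h2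
      obtain ⟨y, rfl⟩ := isOrd_iff.1 hy
      rw [Jt_oz, oz_inj] at h
      rwa [← h, unJ_J]
  ext a ha b hb hne := by
    have : ∃ ξ, ¬ (F ξ ∈ F a ↔ F ξ ∈ F b) := by
      by_contra h
      push Not at h
      apply hne
      ext z
      constructor
      · intro hz
        obtain ⟨ξ, rfl⟩ := mem_L_iff.1 (good_L.trans _ (F_mem_L a) _ hz)
        exact (h ξ).1 hz
      · intro hz
        obtain ⟨ξ, rfl⟩ := mem_L_iff.1 (good_L.trans _ (F_mem_L b) _ hz)
        exact (h ξ).2 hz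
    obtain ⟨ξ, h⟩ := this
    obtain ⟨ζ, h1, d, h2⟩ := hull_wit₂ hγ (c := c) (k := 5) (by norm_num) ha hb
      ⟨ξ, fun d => by simpa only [Tk, Fv_oz] using h⟩
    exact ⟨ζ, h1, by simpa only [Tk, Fv_oz] using h2⟩
  idx a ha b hb h := by
    obtain ⟨ξ, h⟩ := h
    obtain ⟨ζ, h1, d, h2⟩ := hull_wit₂ hγ (c := c) (k := 6) (by norm_num) ha hb
      ⟨ξ, fun d => by simpa only [Tk, Fv_oz, oz_mem] using h⟩
    exact ⟨ζ, h1, by simpa only [Tk, Fv_oz, oz_mem] using h2⟩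
  rng a ha b hb h := by
    obtain ⟨x, h⟩ := h
    obtain ⟨ξ, rfl⟩ := mem_L_iff.1 (good_L.of_pair_mem (good_L.trans _ (F_mem_L a) _ h)).1
    obtain ⟨ζ, h1, d, h2⟩ := hull_wit₂ hγ (c := c) (k := 7) (by norm_num) ha hb
      ⟨ξ, fun d => by simpa only [Tk, Fv_oz] using h⟩
    exact ⟨ζ, h1, by simpa only [Tk, Fv_oz] using h2⟩
  pair a ha x y h := by
    have hxy := good_L.of_pair_mem (h ▸ F_mem_L a)
    obtain ⟨ξ, rfl⟩ := mem_L_iff.1 hxy.1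
    obtain ⟨ζ, rfl⟩ := mem_L_iff.1 hxy.2
    obtain ⟨ξ', h1, d, y, -, h2⟩ := hull_wit₂ hγ (c := c) (k := 8) (by norm_num) ha ha
      ⟨ξ, fun d => ⟨F ζ, hxy.2, by simpa only [Fv_oz] using h⟩⟩
    obtain ⟨ζ', h3, d, y', -, h4⟩ := hull_wit₂ hγ (c := c) (k := 9) (by norm_num) ha ha
      ⟨ζ, fun d => ⟨F ξ, hxy.1, by simpa only [Fv_oz] using h⟩⟩
    simp only [Fv_oz, h, ZFSet.pair_inj] at h2 h4
    exact ⟨ξ', h1, ζ', h3, h2.1, h4.2⟩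

end

/-- Constructible relations on an ordinal below an `L`-cardinal `λ` have an index below `λ`. -/
theorem exists_index_lt {lam γ ξ₀ : Ordinal.{0}} (hlam : LCard (oz lam)) (hγ : JCl γ)
    (hlt : γ < lam) (hf : ∀ z ∈ F ξ₀, ∃ a < γ, ∃ b < γ, z = pair (oz a) (oz b)) :
    ∃ ξ < lam, F ξ = F ξ₀ := by
  set H := Hl (TT (oz ξ₀)) '' Set.Iio γ with hH
  have hC : Clos H := hull_clos hγ
  have hM := hC.opClosed
  obtain ⟨X, hX⟩ : ∃ X : V, ∀ x, x ∈ X ↔ x ∈ F '' H := by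
    refine ⟨ZFSet.range (fun c : Set.Iio γ => F (Hl (TT (oz ξ₀)) c.1)), fun x => ?_⟩
    simp [hH]
  have hπ : IsColl (F '' H) (collapse X) := fun x _ z => by simp only [mem_collapse, hX]
  have hmem : ∀ a < γ, oz a ∈ F '' H := fun a ha => by
    obtain ⟨ξ, h1, h2⟩ := hull_oz hγ (c := oz ξ₀) ha
    exact ⟨ξ, h1, h2⟩
  have hfix : ∀ a < γ, collapse X (oz a) = oz a := by
    intro a
    induction a using WellFoundedLT.induction with
    | ind a ih =>
      intro ha
      ext z
      rw [hπ _ (hmem a ha), mem_oz]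
      constructor
      · rintro ⟨y, -, hy, rfl⟩
        obtain ⟨b, hb, rfl⟩ := mem_oz.1 hy
        exact ⟨b, hb, ih b hb (hb.trans ha)⟩
      · rintro ⟨b, hb, rfl⟩
        exact ⟨oz b, hmem b (hb.trans ha), oz_mem.2 hb, (ih b hb (hb.trans ha)).symm⟩
  have hξ : ξ₀ ∈ H := hull_param hγ
  have hp : ∀ a < γ, ∀ b < γ, collapse X (pair (oz a) (oz b)) = pair (oz a) (oz b) := by
    intro a ha b hb
    rw [hπ.pair hM (hmem a ha) (hmem b hb), hfix a ha, hfix b hb]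
  refine ⟨G H ξ₀, G_hull_lt _ (TT_dfn (oz_mem_L _)) hlam hlt ξ₀, ?_⟩
  rw [← hC.collapse_F hπ hξ]
  ext z
  rw [hπ _ ⟨_, hξ, rfl⟩]
  constructor
  · rintro ⟨y, -, hy, rfl⟩
    obtain ⟨a, ha, b, hb, rfl⟩ := hf y hy
    rwa [hp a ha b hb]
  · intro hz
    obtain ⟨a, ha, b, hb, rfl⟩ := hf z hz
    exact ⟨_, hM.pair_mem (hmem a ha) (hmem b hb), hz, (hp a ha b hb).symm⟩

/-! ## Cardinals -/

theorem eqNum_iff {x y : V} : EqNum x y ↔ x.card = y.card := by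
  rw [← Cardinal.lift_inj.{0, 1}, ← cardinalMk_coe_sort, ← cardinalMk_coe_sort, Cardinal.eq]
  rfl

theorem cardLE_iff {x y : V} : CardLE x y ↔ x.card ≤ y.card := by
  rw [← Cardinal.lift_le.{1, 0}, ← cardinalMk_coe_sort, ← cardinalMk_coe_sort, Cardinal.le_def]
  rfl

theorem card_oz (o : Ordinal.{0}) : (oz o).card = o.card := Ordinal.card_toZFSet o

theorem isCard_oz {o : Ordinal.{0}} : IsCard (oz o) ↔ o.card.ord = o := by
  constructor
  · rintro ⟨-, h⟩
    by_contra hne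
    have hlt := lt_of_le_of_ne (Cardinal.ord_card_le o) hne
    exact h _ (oz_mem.2 hlt) (eqNum_iff.2 (by simp))
  · intro h
    refine ⟨isOrd_oz o, fun α hα he => ?_⟩
    obtain ⟨a, ha, rfl⟩ := mem_oz.1 hα
    rw [eqNum_iff, card_oz, card_oz] at he
    rw [← h, Cardinal.lt_ord, he] at ha
    exact lt_irrefl _ ha

theorem leastOrd_oz {p : V → Prop} {o : Ordinal.{0}} (h : p (oz o)) (hmin : ∀ a < o, ¬ p (oz a)) :
    leastOrd p = oz o := by
  have hex : ∃ α, (IsOrd α ∧ p α) ∧ ∀ β ∈ α, ¬ (IsOrd β ∧ p β) := by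
    refine ⟨oz o, ⟨isOrd_oz o, h⟩, fun β hβ hp => ?_⟩
    obtain ⟨b, hb, rfl⟩ := mem_oz.1 hβ
    exact hmin b hb hp.2
  rw [leastOrd, dif_pos hex]
  obtain ⟨⟨h1, h2⟩, h3⟩ := hex.choose_spec
  obtain ⟨a, ha⟩ := isOrd_iff.1 h1
  rw [ha] at h2 h3 ⊢
  rcases lt_trichotomy a o with hlt | rfl | hlt
  · exact absurd h2 (hmin a hlt)
  · rfl
  · exact absurd ⟨isOrd_oz o, h⟩ (h3 _ (oz_mem.2 hlt))

theorem omega_eq : ZFSet.omega = oz Ordinal.omega0 := by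
  have hn : ∀ n : ℕ, natZ n ∈ ZFSet.omega := by
    intro n
    induction n with
    | zero => exact ZFSet.omega_zero
    | succ n ih => exact ZFSet.omega_succ ih
  ext x
  rw [mem_oz]
  constructor
  · intro hx
    have hmk : ∀ n : ℕ, ZFSet.mk (PSet.ofNat n) = natZ n := by
      intro n
      induction n with
      | zero => rfl
      | succ n ih =>
        rw [natZ, ← ih]
        rfl
    have : ∃ n : ℕ, x = natZ n := by
      revert hx
      refine Quotient.inductionOn x fun y hy => ?_
      obtain ⟨⟨n⟩, h⟩ := hy
      exact ⟨n, (ZFSet.sound h).trans (hmk n)⟩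
    obtain ⟨n, rfl⟩ := this
    exact ⟨n, Ordinal.natCast_lt_omega0 n, natZ_eq n⟩
  · rintro ⟨a, ha, rfl⟩
    obtain ⟨n, rfl⟩ := Ordinal.lt_omega0.1 ha
    rw [← natZ_eq]
    exact hn n

theorem aleph_eq (n : ℕ) : Aleph n = oz (Ordinal.omega n) := by
  induction n with
  | zero => simpa [Aleph] using omega_eq
  | succ n ih =>
    rw [Aleph, ih]
    apply leastOrd_oz
    · refine ⟨isCard_oz.2 (by simp), oz_mem.2 (Ordinal.omega_lt_omega.2 (by simp))⟩
    · rintro a ha ⟨h1, h2⟩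
      rw [isCard_oz] at h1
      rw [oz_mem] at h2
      rw [← h1, ← Cardinal.ord_aleph, Cardinal.ord_lt_ord] at h2 ha
      have := Order.succ_le_of_lt h2
      rw [Cardinal.succ_aleph] at this
      refine absurd ha (not_lt.2 ?_)
      simpa using this

theorem isRegular_of {k : Ordinal.{0}} (h : IsRegular (oz k)) (hk : Ordinal.omega0 < k) :
    ∃ c : Cardinal.{0}, c.IsRegular ∧ Cardinal.aleph0 < c ∧ k = c.ord := by
  have hc := isCard_oz.1 h.1
  have h0 : Cardinal.aleph0 < k.card := by
    rw [← hc, ← Cardinal.ord_aleph0, Cardinal.ord_lt_ord] at hk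
    exact hk
  refine ⟨k.card, ⟨h0.le, ?_⟩, h0, hc.symm⟩
  rw [hc]
  obtain ⟨s, hs, hcard⟩ := Order.exists_cof_eq (α := Set.Iio k)
  set x : V := ZFSet.sep (fun y => ∃ b ∈ s, y = oz b) (oz k) with hx
  have hmem : ∀ y, y ∈ x ↔ ∃ b ∈ s, y = oz b := by
    intro y
    rw [hx, ZFSet.mem_sep]
    refine ⟨fun h => h.2, fun h => ⟨?_, h⟩⟩
    obtain ⟨b, -, rfl⟩ := h
    exact oz_mem.2 b.2
  have he := h.2 x ZFSet.sep_subset (by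
    intro β hβ
    obtain ⟨b, hb, rfl⟩ := mem_oz.1 hβ
    obtain ⟨d, hd, hle⟩ := hs ⟨b, hb⟩
    refine ⟨oz d, (hmem _).2 ⟨d, hd, rfl⟩, ?_⟩
    rw [oz_mem, oz_inj]
    exact lt_or_eq_of_le hle)
  rw [eqNum_iff, card_oz] at he
  have h2 : Cardinal.lift.{1} x.card = Cardinal.mk s := by
    rw [← cardinalMk_coe_sort]
    have : (x : Set V) = (fun b : Set.Iio k => oz b) '' s := by
      ext y
      simp only [SetLike.mem_coe, hmem, Set.mem_image]
      exact ⟨fun ⟨b, hb, e⟩ => ⟨b, hb, e.symm⟩, fun ⟨b, hb, e⟩ => ⟨b, hb, e.symm⟩⟩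
    have hi : Function.Injective (fun b : Set.Iio k => oz b) :=
      fun a b hab => Subtype.ext (oz_inj.1 hab)
    exact (Cardinal.mk_congr (Equiv.setCongr this)).trans (Cardinal.mk_image_eq hi)
  rw [hcard, Ordinal.cof_Iio, ← Ordinal.lift_cof, Cardinal.lift_inj, he] at h2
  exact h2.le

theorem isRegular_ord {c : Cardinal.{0}} (hc : c.IsRegular) : IsRegular (oz c.ord) := by
  refine ⟨isCard_oz.2 (by simp), fun x hx hu => ?_⟩
  rw [eqNum_iff]
  refine le_antisymm (card_mono hx) ?_
  set s : Set (Set.Iio c.ord) := {b | oz b ∈ x} with hs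
  have hcof : IsCofinal s := by
    intro b
    obtain ⟨y, hy, hle⟩ := hu _ (oz_mem.2 b.2)
    obtain ⟨d, hd, rfl⟩ := mem_oz.1 (hx hy)
    refine ⟨⟨d, hd⟩, hy, ?_⟩
    rw [oz_mem, oz_inj] at hle
    exact hle.elim le_of_lt le_of_eq
  have h1 := Order.cof_le hcof
  rw [Ordinal.cof_Iio, ← Ordinal.lift_cof, hc.cof_ord] at h1
  rw [← Cardinal.lift_le.{1, 0}, card_oz, Cardinal.card_ord, ← cardinalMk_coe_sort]
  refine h1.trans ?_
  exact Cardinal.mk_le_of_injective (f := fun b : s => (⟨oz b.1, b.2⟩ : x))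
    fun a b hab => Subtype.ext (Subtype.ext (oz_inj.1 (congrArg Subtype.val hab)))

/-! ## Hereditarily small sets -/

def HH (c : Cardinal.{0}) : Set V := {x | ∃ t : V, t.IsTransitive ∧ x ∈ t ∧ t.card < c}

theorem hset_eq (c : Cardinal.{0}) : Hset (oz c.ord) = HH c := by
  ext x
  refine exists_congr fun t => and_congr_right fun _ => and_congr_right fun _ => ?_
  constructor
  · rintro ⟨α, hα, h⟩
    obtain ⟨a, ha, rfl⟩ := mem_oz.1 hα
    rw [cardLE_iff, card_oz] at h
    exact h.trans_lt (Cardinal.lt_ord.1 ha)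
  · intro h
    refine ⟨oz t.card.ord, oz_mem.2 (Cardinal.ord_lt_ord.2 h), ?_⟩
    rw [cardLE_iff, card_oz, Cardinal.card_ord]

class RegC (c : Cardinal.{0}) : Prop where
  reg : c.IsRegular
  unc : Cardinal.aleph0 < c

section HH
variable {c : Cardinal.{0}}

theorem HH_trans {x y : V} (hx : x ∈ HH c) (hy : y ∈ x) : y ∈ HH c := by
  obtain ⟨t, h1, h2, h3⟩ := hx
  exact ⟨t, h1, h1 x h2 hy, h3⟩

theorem HH_card {x : V} (hx : x ∈ HH c) : x.card < c := by
  obtain ⟨t, h1, h2, h3⟩ := hx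
  exact (card_mono (h1 x h2)).trans_lt h3

theorem card_iUnion_lt [hc : RegC c] {ι : Type} {f : ι → V} (hι : Cardinal.mk ι < c)
    (hf : ∀ i, (f i).card < c) : (ZFSet.iUnion f).card < c := by
  have := lift_card_iUnion_le_sum_card (f := f)
  rw [Cardinal.lift_id] at this
  exact this.trans_lt (Cardinal.sum_lt_of_isRegular hc.reg hι hf)

theorem card_range_lt {ι : Type} {f : ι → V} (hι : Cardinal.mk ι < c) :
    (ZFSet.range f).card < c := by
  have := lift_card_range_le (f := f)
  rw [Cardinal.lift_id, Cardinal.lift_id] at this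
  exact this.trans_lt hι

theorem mem_HH [hc : RegC c] {x : V} (h : ∀ y ∈ x, y ∈ HH c) (hx : x.card < c) : x ∈ HH c := by
  choose! t h1 h2 h3 using h
  set T : V := ZFSet.iUnion fun i : Shrink.{0} x => t ((equivShrink x).symm i) with hT
  have hmT : ∀ z, z ∈ T ↔ ∃ y ∈ x, z ∈ t y := by
    intro z
    rw [hT, ZFSet.mem_iUnion]
    constructor
    · rintro ⟨i, hi⟩
      exact ⟨_, ((equivShrink x).symm i).2, hi⟩
    · rintro ⟨y, hy, hz⟩
      refine ⟨equivShrink x ⟨y, hy⟩, ?_⟩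
      rwa [Equiv.symm_apply_apply]
  refine ⟨insert x T, fun y hy z hz => ?_, ZFSet.mem_insert _ _, ?_⟩
  · rw [ZFSet.mem_insert_iff] at hy ⊢
    right
    rw [hmT]
    rcases hy with rfl | hy
    · exact ⟨z, hz, h2 z hz⟩
    · obtain ⟨w, hw, hyw⟩ := (hmT y).1 hy
      exact ⟨w, hw, h1 w hw y hyw hz⟩
  · refine card_insert_le.trans_lt ?_
    refine Cardinal.add_lt_of_lt hc.reg.1 ?_ (Cardinal.one_lt_aleph0.trans hc.unc)
    exact card_iUnion_lt hx fun i => h3 _ ((equivShrink x).symm i).2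

theorem HH_subset [RegC c] {x y : V} (hx : x ∈ HH c) (hy : y ⊆ x) : y ∈ HH c :=
  mem_HH (fun _ hz => HH_trans hx (hy hz)) ((card_mono hy).trans_lt (HH_card hx))

theorem range_mem_HH [RegC c] {ι : Type} {f : ι → V} (hι : Cardinal.mk ι < c)
    (hf : ∀ i, f i ∈ HH c) : ZFSet.range f ∈ HH c :=
  mem_HH (fun y hy => by
    obtain ⟨i, rfl⟩ := ZFSet.mem_range.1 hy
    exact hf i) (card_range_lt hι)

instance good_HH [hc : RegC c] : Good (HH c) where
  trans _ hx _ hy := HH_trans hx hy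
  empty := mem_HH (fun y hy => absurd hy (ZFSet.notMem_empty y)) (by
    rw [card_empty]; exact hc.reg.pos)
  upair a ha b hb := by
    refine mem_HH (fun y hy => ?_) ?_
    · rcases ZFSet.mem_pair.1 hy with rfl | rfl <;> assumption
    · refine card_insert_le.trans_lt ?_
      rw [card_singleton]
      exact (Cardinal.add_lt_aleph0 Cardinal.one_lt_aleph0 Cardinal.one_lt_aleph0).trans hc.unc
  sUnion a ha := by
    refine mem_HH (fun y hy => ?_) ?_
    · obtain ⟨z, hz, hy⟩ := ZFSet.mem_sUnion.1 hy
      exact HH_trans (HH_trans ha hz) hy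
    · have : (⋃₀ a : V) = ZFSet.iUnion fun i : Shrink.{0} a => ((equivShrink a).symm i : V) := by
        ext z
        rw [ZFSet.mem_sUnion, ZFSet.mem_iUnion]
        constructor
        · rintro ⟨y, hy, hz⟩
          refine ⟨equivShrink a ⟨y, hy⟩, ?_⟩
          rwa [Equiv.symm_apply_apply]
        · rintro ⟨i, hi⟩
          exact ⟨_, ((equivShrink a).symm i).2, hi⟩
      rw [this]
      exact card_iUnion_lt (HH_card ha) fun i => HH_card (HH_trans ha ((equivShrink a).symm i).2)
  sep' P _ a ha v _ := HH_subset ha ZFSet.sep_subset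
  coll a ha b hb f hf := by
    refine ⟨ZFSet.range fun i : Shrink.{0} a × Shrink.{0} b =>
      f ((equivShrink a).symm i.1) ((equivShrink b).symm i.2), range_mem_HH ?_ fun i => ?_, ?_⟩
    · rw [← Cardinal.mul_def]
      exact Cardinal.mul_lt_of_lt hc.reg.1 (HH_card ha) (HH_card hb)
    · exact hf _ ((equivShrink a).symm i.1).2 _ ((equivShrink b).symm i.2).2
    · intro x hx y hy
      rw [ZFSet.mem_range]
      refine ⟨(equivShrink a ⟨x, hx⟩, equivShrink b ⟨y, hy⟩), ?_⟩
      simp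

theorem oz_mem_HH [hc : RegC c] {a : Ordinal.{0}} : oz a ∈ HH c ↔ a < c.ord := by
  constructor
  · intro h
    have := HH_card h
    rw [card_oz] at this
    exact Cardinal.lt_ord.2 this
  · intro h
    induction a using WellFoundedLT.induction with
    | _ a ih =>
    refine mem_HH (fun y hy => ?_) (by rw [card_oz]; exact Cardinal.lt_ord.1 h)
    obtain ⟨b, hb, rfl⟩ := mem_oz.1 hy
    exact ih b hb (hb.trans h)

end HH

/-! ## Elementary submodels -/

theorem ElemSub.par {X : V} {W : Set V} (hX : ElemSub X W) : Par W X.toSet := ⟨hX.1⟩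

theorem ElemSub.wit {X : V} {W : Set V} (hX : ElemSub X W) {P : V → Prop}
    (hP : Dfn W X.toSet (fun v => P (v 0))) (h : ∃ x ∈ W, P x) : ∃ x ∈ X, P x := by
  obtain ⟨x, hx, hPx⟩ := h
  have hne : ∃ x, x ∈ X := by
    have := (hX.2 (.ex (.eq 0 0) : Fml 0) Fin.elim0 fun i => i.elim0).2 ⟨x, hx, rfl⟩
    exact ⟨this.choose, this.choose_spec.1⟩
  obtain ⟨x₀, hx₀⟩ := hne
  obtain ⟨n, φ, e, H⟩ := hP.out
  set ρ : Fin n → Fin (n + 1) := fun i => Sum.elim (fun _ => 0) (fun _ => i.succ) (e i) with hρ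
  set w : Fin n → V := fun i => Sum.elim (fun _ => x₀) (fun a : X.toSet => (a : V)) (e i) with hw
  have key : ∀ y : V, (fun i => (Fin.cons y w : Fin (n + 1) → V) (ρ i)) =
      fun i => aval (fun _ => y) (e i) := by
    intro y
    funext i
    simp only [hρ, hw]
    rcases he : e i with k | a
    · rfl
    · simp [aval, he]
  have hwX : ∀ i, w i ∈ X := by
    intro i
    simp only [hw]
    rcases e i with k | a
    · exact hx₀
    · exact a.2
  have hsat : ∀ y ∈ W, (Sat W (φ.ren ρ) (Fin.cons y w) ↔ P y) := fun y hy => by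
    rw [Fml.sat_ren, key, ← H _ fun _ => hy]
  have h1 : Sat W (.ex (φ.ren ρ)) w := ⟨x, hx, (hsat x hx).2 hPx⟩
  obtain ⟨y, hy, h2⟩ := (hX.2 _ w hwX).2 h1
  refine ⟨y, hy, (hsat y (hX.1 hy)).1 ?_⟩
  refine (hX.2 (φ.ren ρ) _ fun i => ?_).1 h2
  refine Fin.cases hy (fun j => ?_) i
  exact hwX j

theorem elemSub_of_sat {X : V} {W : Set V} (hXW : X.toSet ⊆ W)
    (h : ∀ {n : ℕ} (φ : Fml (n + 1)) (v : Fin n → V), (∀ i, v i ∈ X) →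
      (∃ x ∈ W, Sat W φ (Fin.cons x v)) → ∃ x ∈ X, Sat W φ (Fin.cons x v)) : ElemSub X W := by
  refine ⟨hXW, fun {n} φ => ?_⟩
  induction φ with
  | mem i j => exact fun v _ => Iff.rfl
  | eq i j => exact fun v _ => Iff.rfl
  | inA i => exact fun v _ => Iff.rfl
  | inB i => exact fun v _ => Iff.rfl
  | not φ ih => exact fun v hv => not_congr (ih v hv)
  | and φ ψ ih ih' => exact fun v hv => and_congr (ih v hv) (ih' v hv)
  | ex φ ih =>
    intro v hv
    have hc : ∀ x ∈ X, ∀ i, (Fin.cons x v : Fin _ → V) i ∈ X := fun x hx i =>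
      Fin.cases hx (fun j => hv j) i
    constructor
    · rintro ⟨x, hx, hs⟩
      exact ⟨x, hXW hx, (ih _ (hc x hx)).1 hs⟩
    · intro hs
      obtain ⟨x, hx, hs'⟩ := h φ v hv hs
      exact ⟨x, hx, (ih _ (hc x hx)).2 hs'⟩

theorem elemSub_of_wit {X : V} {W : Set V} (hXW : X.toSet ⊆ W)
    (h : ∀ P : V → Prop, Dfn W X.toSet (fun v => P (v 0)) → (∃ x ∈ W, P x) → ∃ x ∈ X, P x) :
    ElemSub X W := by
  refine elemSub_of_sat hXW fun {n} φ v hv hs => h _ ⟨n + 1, φ,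
    Fin.cons (.inl 0) (fun i => .inr ⟨v i, hv i⟩), fun w _ => ?_⟩ hs
  have : (fun i => aval w ((Fin.cons (.inl 0) (fun i => .inr ⟨v i, hv i⟩) :
      Fin (n + 1) → ℕ ⊕ X.toSet) i)) = Fin.cons (w 0) v := by
    funext i
    refine Fin.cases rfl (fun j => rfl) i
  rw [this]

theorem ElemSub.inter {Y Z : V} {W : Set V} (hY : ElemSub Y W) (hZ : ElemSub Z W) (hZY : Z ∈ Y) :
    ElemSub (Y ∩ Z) W := by
  have := hY.par
  have : Fact (Z ∈ Y.toSet) := ⟨hZY⟩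
  refine elemSub_of_wit (fun x hx => hY.1 (ZFSet.mem_inter.1 hx).1) fun P hP h => ?_
  have hPY := hP.mono (B := Y.toSet) fun x hx => (ZFSet.mem_inter.1 hx).1
  have hPZ := hP.mono (B := Z.toSet) fun x hx => (ZFSet.mem_inter.1 hx).2
  obtain ⟨x, hx, hPx⟩ := hZ.wit hPZ h
  obtain ⟨y, hy, hyZ, hPy⟩ := hY.wit (P := fun x => x ∈ Z ∧ P x) inferInstance
    ⟨x, hZ.1 hx, hx, hPx⟩
  exact ⟨y, ZFSet.mem_inter.2 ⟨hy, hyZ⟩, hPy⟩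

theorem ElemSub.term {X t : V} {W : Set V} [hW : Good W] (hX : ElemSub X W)
    (ht : DfnF W X.toSet (fun _ => t)) : t ∈ X := by
  have htW := ht.mem' (fun _ => ∅) fun _ => hW.empty
  obtain ⟨y, hy, rfl⟩ := hX.wit (P := fun x => x = t) ht.graph ⟨t, htW, rfl⟩
  exact hy

def Od (X : V) : Set Ordinal.{0} := {a | oz a ∈ X}

theorem collapse_oz (X : V) (a : Ordinal.{0}) : collapse X (oz a) = oz (G (Od X) a) := by
  induction a using WellFoundedLT.induction with
  | _ a ih =>
  ext z
  rw [mem_collapse, mem_oz]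
  constructor
  · rintro ⟨w, hw, hwa, rfl⟩
    obtain ⟨b, hb, rfl⟩ := mem_oz.1 hwa
    exact ⟨_, G_lt hb hw, ih b hb⟩
  · rintro ⟨d, hd, rfl⟩
    obtain ⟨b, hb, hba, rfl⟩ := lt_G.1 hd
    exact ⟨oz b, hb, oz_mem.2 hba, (ih b hba).symm⟩

theorem jCl_ord {c : Cardinal.{0}} [hc : RegC c] : JCl c.ord where
  nat n := by
    rw [← oz_mem_HH (c := c), ← natZ_eq]
    exact natZ_mem_good n
  pair a ha b hb := oz_mem_HH.1 (Good.J_mem (oz_mem_HH.2 ha) (oz_mem_HH.2 hb))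

section Elem
variable {c : Cardinal.{0}} [hc : RegC c] {X : V} (hX : ElemSub X (HH c))
include hX

theorem ElemSub.natZ_mem (n : ℕ) : natZ n ∈ X := hX.term inferInstance

theorem ElemSub.Fv_mem {a : Ordinal.{0}} (ha : a ∈ Od X) : F a ∈ X := by
  have := hX.par
  have : Fact (oz a ∈ X.toSet) := ⟨ha⟩
  rw [← Fv_oz]
  exact hX.term inferInstance

theorem ElemSub.ord_wit {P : V → Prop} (hP : Dfn (HH c) X.toSet (fun v => P (v 0)))
    (h : ∃ ξ < c.ord, P (oz ξ)) : ∃ ξ ∈ Od X, P (oz ξ) := by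
  have := hX.par
  obtain ⟨ξ, hξ, h⟩ := h
  obtain ⟨x, hx, ho, h'⟩ := hX.wit (P := fun x => IsOrd x ∧ P x) inferInstance
    ⟨oz ξ, oz_mem_HH.2 hξ, isOrd_oz ξ, h⟩
  obtain ⟨ζ, rfl⟩ := isOrd_iff.1 ho
  exact ⟨ζ, hx, h'⟩

theorem ElemSub.lt_ord {a : Ordinal.{0}} (ha : a ∈ Od X) : a < c.ord := oz_mem_HH.1 (hX.1 ha)

theorem ElemSub.clos : Clos (Od X) where
  nat n := by
    have := hX.natZ_mem n
    rwa [natZ_eq] at this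
  J a ha b hb := by
    have := hX.par
    have : Fact (oz a ∈ X.toSet) := ⟨ha⟩
    have : Fact (oz b ∈ X.toSet) := ⟨hb⟩
    show oz _ ∈ X
    rw [← Jt_oz]
    exact hX.term inferInstance
  unJ a ha := by
    have := hX.par
    have : Fact (oz a ∈ X.toSet) := ⟨ha⟩
    have hlt := hX.lt_ord ha
    obtain ⟨u, hu, v, -, hv, h⟩ := hX.ord_wit
      (P := fun x => ∃ v ∈ HH c, IsOrd v ∧ Jt x v = oz a) inferInstance
      ⟨(unJ a).1, (unJ_fst_le a).trans_lt hlt, oz (unJ a).2,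
        oz_mem_HH.2 ((unJ_snd_le a).trans_lt hlt), isOrd_oz _, by rw [Jt_oz]; exact congrArg oz (J_unJ a)⟩
    obtain ⟨v', rfl⟩ := isOrd_iff.1 hv
    obtain ⟨u₂, hu₂, v₂, -, hv₂, h₂⟩ := hX.ord_wit
      (P := fun x => ∃ v ∈ HH c, IsOrd v ∧ Jt v x = oz a) inferInstance
      ⟨(unJ a).2, (unJ_snd_le a).trans_lt hlt, oz (unJ a).1,
        oz_mem_HH.2 ((unJ_fst_le a).trans_lt hlt), isOrd_oz _, by rw [Jt_oz]; exact congrArg oz (J_unJ a)⟩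
    obtain ⟨v₃, rfl⟩ := isOrd_iff.1 hv₂
    rw [Jt_oz, oz_inj] at h h₂
    constructor
    · rw [← h, unJ_J]; exact hu
    · rw [← h₂, unJ_J]; exact hu₂
  ext a ha b hb hne := by
    have := hX.par
    have : Fact (oz a ∈ X.toSet) := ⟨ha⟩
    have : Fact (oz b ∈ X.toSet) := ⟨hb⟩
    have h1 : ∃ x, ¬ (x ∈ F a ↔ x ∈ F b) := by
      by_contra h
      push Not at h
      exact hne (ZFSet.ext h)
    obtain ⟨x, hx⟩ := h1
    have hK : x ∈ Kb c.ord := by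
      by_cases hxa : x ∈ F a
      · exact JCl.trans (jCl_ord) ⟨a, hX.lt_ord ha, rfl⟩ hxa
      · have hxb : x ∈ F b := by tauto
        exact JCl.trans (jCl_ord) ⟨b, hX.lt_ord hb, rfl⟩ hxb
    obtain ⟨ξ, hξ, rfl⟩ := hK
    obtain ⟨ζ, hζ, h⟩ := hX.ord_wit (P := fun x => ¬ (Fv x ∈ Fv (oz a) ↔ Fv x ∈ Fv (oz b)))
      inferInstance ⟨ξ, hξ, by simpa only [Fv_oz] using hx⟩
    exact ⟨ζ, hζ, by simpa only [Fv_oz] using h⟩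
  idx a ha b hb h := by
    have := hX.par
    have : Fact (oz a ∈ X.toSet) := ⟨ha⟩
    have : Fact (oz b ∈ X.toSet) := ⟨hb⟩
    obtain ⟨ξ, hξ, h⟩ := h
    obtain ⟨ζ, hζ, h⟩ := hX.ord_wit (P := fun x => x ∈ oz a ∧ Fv x = Fv (oz b))
      inferInstance ⟨ξ, hξ.trans (hX.lt_ord ha), oz_mem.2 hξ, by simpa only [Fv_oz] using h⟩
    exact ⟨ζ, hζ, oz_mem.1 h.1, by simpa only [Fv_oz] using h.2⟩
  rng a ha b hb h := by
    have := hX.par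
    have : Fact (oz a ∈ X.toSet) := ⟨ha⟩
    have : Fact (oz b ∈ X.toSet) := ⟨hb⟩
    obtain ⟨x, hx⟩ := h
    have hK : pair x (F b) ∈ Kb c.ord := JCl.trans (jCl_ord) ⟨a, hX.lt_ord ha, rfl⟩ hx
    have hK : x ∈ Kb c.ord := by
      refine JCl.trans (jCl_ord) (JCl.trans (jCl_ord) (y := {x}) hK ?_) (ZFSet.mem_singleton.2 rfl)
      simp [ZFSet.pair]
    obtain ⟨ξ, hξ, rfl⟩ := hK
    obtain ⟨ζ, hζ, h⟩ := hX.ord_wit (P := fun x => pair (Fv x) (Fv (oz b)) ∈ Fv (oz a))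
      inferInstance ⟨ξ, hξ, by simpa only [Fv_oz] using hx⟩
    exact ⟨ζ, hζ, by simpa only [Fv_oz] using h⟩
  pair a ha x y hxy := by
    have := hX.par
    have : Fact (oz a ∈ X.toSet) := ⟨ha⟩
    have hK : F a ∈ Kb c.ord := ⟨a, hX.lt_ord ha, rfl⟩
    have hK2 : ({x, y} : V) ∈ Kb c.ord := by
      refine JCl.trans (jCl_ord) hK ?_
      rw [hxy]
      simp [ZFSet.pair]
    obtain ⟨ξ, hξ, rfl⟩ := JCl.trans (jCl_ord) hK2 (y := x) (by simp)
    obtain ⟨ζ, hζ, rfl⟩ := JCl.trans (jCl_ord) hK2 (y := y) (by simp)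
    obtain ⟨ξ', h1, z, -, h2⟩ := hX.ord_wit (P := fun x => ∃ z ∈ HH c, Fv (oz a) = pair (Fv x) z)
      inferInstance ⟨ξ, hξ, F ζ, Good.F_mem (oz_mem_HH.2 hζ), by simpa only [Fv_oz] using hxy⟩
    obtain ⟨ζ', h3, z', -, h4⟩ := hX.ord_wit (P := fun x => ∃ z ∈ HH c, Fv (oz a) = pair z (Fv x))
      inferInstance ⟨ζ, hζ, F ξ, Good.F_mem (oz_mem_HH.2 hξ), by simpa only [Fv_oz] using hxy⟩
    rw [Fv_oz, Fv_oz, hxy, ZFSet.pair_inj] at h2 h4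
    exact ⟨ξ', h1, ζ', h3, h2.1, h4.2⟩

theorem ElemSub.collapse_F {a : Ordinal.{0}} (ha : a ∈ Od X) :
    collapse X (F a) = F (G (Od X) a) := by
  refine hX.clos.collapse_F (π := collapse X) ?_ ha
  rintro x ⟨a, ha, rfl⟩ z
  rw [mem_collapse]
  constructor
  · rintro ⟨w, hw, hwa, rfl⟩
    refine ⟨w, ?_, hwa, rfl⟩
    have := hX.par
    have : Fact (w ∈ X.toSet) := ⟨hw⟩
    obtain ⟨ξ, hξ, hξw⟩ := JCl.trans (jCl_ord) ⟨a, hX.lt_ord ha, rfl⟩ hwa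
    obtain ⟨ζ, hζ, h⟩ := hX.ord_wit (P := fun x => w = Fv x) inferInstance
      ⟨ξ, hξ, by rw [Fv_oz, hξw]⟩
    exact ⟨ζ, hζ, by rw [h, Fv_oz]⟩
  · rintro ⟨y, ⟨b, hb, rfl⟩, hy, rfl⟩
    exact ⟨F b, hX.Fv_mem hb, hy, rfl⟩

end Elem

section Elem
variable {c : Cardinal.{0}} [hc : RegC c] {X : V} (hX : ElemSub X (HH c))
include hX

theorem ElemSub.opClosed : OpClosed X.toSet where
  ext x hx y hy hne := by
    have := hX.par
    have : Fact (x ∈ X.toSet) := ⟨hx⟩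
    have : Fact (y ∈ X.toSet) := ⟨hy⟩
    have h1 : ∃ z, ¬ (z ∈ x ↔ z ∈ y) := by
      by_contra h
      push Not at h
      exact hne (ZFSet.ext h)
    obtain ⟨z, hz⟩ := h1
    refine hX.wit (P := fun z => ¬ (z ∈ x ↔ z ∈ y)) inferInstance ⟨z, ?_, hz⟩
    by_cases hzx : z ∈ x
    · exact HH_trans (hX.1 hx) hzx
    · exact HH_trans (hX.1 hy) (by tauto)
  op k hk x hx y hy := by
    have := hX.par
    have : Fact (x ∈ X.toSet) := ⟨hx⟩
    have : Fact (y ∈ X.toSet) := ⟨hy⟩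
    exact hX.term inferInstance
  pair x y h := by
    have := hX.par
    have : Fact (pair x y ∈ X.toSet) := ⟨h⟩
    have hW := Good.of_pair_mem (hX.1 h)
    obtain ⟨u, hu, v, -, h1⟩ := hX.wit (P := fun u => ∃ v ∈ HH c, pair x y = pair u v)
      inferInstance ⟨x, hW.1, y, hW.2, rfl⟩
    obtain ⟨v', hv, u', -, h2⟩ := hX.wit (P := fun v => ∃ u ∈ HH c, pair x y = pair u v)
      inferInstance ⟨y, hW.2, x, hW.1, rfl⟩
    rw [ZFSet.pair_inj] at h1 h2
    exact ⟨h1.1 ▸ hu, h2.2 ▸ hv⟩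
  rng a ha y hy h := by
    have := hX.par
    have : Fact (a ∈ X.toSet) := ⟨ha⟩
    have : Fact (y ∈ X.toSet) := ⟨hy⟩
    obtain ⟨x, hx⟩ := h
    exact hX.wit (P := fun x => pair x y ∈ a) inferInstance
      ⟨x, (Good.of_pair_mem (HH_trans (hX.1 ha) hx)).1, hx⟩

omit hX in
theorem isColl_collapse (X : V) : IsColl X.toSet (collapse X) := fun _ _ _ => mem_collapse

theorem ElemSub.surjR_iff {ξ a b : Ordinal.{0}} (hξ : ξ ∈ Od X) (ha : a ∈ Od X) (hb : b ∈ Od X) :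
    SurjR (F (G (Od X) ξ)) (oz (G (Od X) a)) (oz (G (Od X) b)) ↔ SurjR (F ξ) (oz a) (oz b) := by
  have := hX.par
  have hF := hX.Fv_mem hξ
  have : Fact (F ξ ∈ X.toSet) := ⟨hF⟩
  have : Fact (oz a ∈ X.toSet) := ⟨ha⟩
  have : Fact (oz b ∈ X.toSet) := ⟨hb⟩
  have key : ∀ x ∈ X, ∀ y ∈ X, pair (collapse X x) (collapse X y) ∈ F (G (Od X) ξ) ↔
      pair x y ∈ F ξ := fun x hx y hy => by
    rw [← hX.collapse_F hξ]
    exact (isColl_collapse X).pair_mem_iff hX.opClosed hx hy hF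
  have hinj : ∀ x ∈ X, ∀ y ∈ X, collapse X x = collapse X y → x = y := fun x hx y hy h =>
    (isColl_collapse X).inj hX.opClosed x hx y hy h
  rw [← collapse_oz, ← collapse_oz]
  have hW : ∀ y ∈ oz b, y ∈ HH c := fun y hy => HH_trans (hX.1 hb) hy
  have hWa : ∀ y ∈ oz a, y ∈ HH c := fun y hy => HH_trans (hX.1 ha) hy
  constructor
  · intro h
    by_contra hn
    have hn' : ∃ y ∈ HH c, y ∈ oz b ∧ ¬ ∃ x ∈ oz a, pair x y ∈ F ξ ∧ ∀ y' ∈ oz b,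
        pair x y' ∈ F ξ → y' = y := by
      by_contra h'
      refine hn fun y hy => ?_
      by_contra h''
      exact h' ⟨y, hW y hy, hy, h''⟩
    obtain ⟨y, hy, hyb, h1⟩ := hX.wit (P := fun y => y ∈ oz b ∧ ¬ ∃ x ∈ oz a, pair x y ∈ F ξ ∧
      ∀ y' ∈ oz b, pair x y' ∈ F ξ → y' = y) inferInstance hn'
    obtain ⟨x', hx', hxy, h2⟩ := h _ (mem_collapse.2 ⟨y, hy, hyb, rfl⟩)
    obtain ⟨x, hx, hxa, rfl⟩ := mem_collapse.1 hx'
    refine h1 ⟨x, hxa, (key x hx y hy).1 hxy, ?_⟩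
    by_contra h3
    have : Fact (x ∈ X.toSet) := ⟨hx⟩
    have : Fact (y ∈ X.toSet) := ⟨hy⟩
    push Not at h3
    obtain ⟨z, hzb, hz, hne⟩ := h3
    obtain ⟨z, hz, hzb, hz', hne⟩ := hX.wit (P := fun z => z ∈ oz b ∧ pair x z ∈ F ξ ∧ ¬ z = y)
      inferInstance ⟨z, hW z hzb, hzb, hz, hne⟩
    exact hne (hinj z hz y hy (h2 _ (mem_collapse.2 ⟨z, hz, hzb, rfl⟩) ((key x hx z hz).2 hz')))
  · intro h y' hy'
    obtain ⟨y, hy, hyb, rfl⟩ := mem_collapse.1 hy'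
    have : Fact (y ∈ X.toSet) := ⟨hy⟩
    obtain ⟨x, hxa, h'⟩ := h y hyb
    obtain ⟨x, hx, hxa, h1, h2⟩ := hX.wit (P := fun x => x ∈ oz a ∧ pair x y ∈ F ξ ∧
      ∀ y' ∈ oz b, pair x y' ∈ F ξ → y' = y) inferInstance ⟨x, hWa x hxa, hxa, h'⟩
    refine ⟨_, mem_collapse.2 ⟨x, hx, hxa, rfl⟩, (key x hx y hy).2 h1, fun z' hz' hz'' => ?_⟩
    obtain ⟨z, hz, hzb, rfl⟩ := mem_collapse.1 hz'
    rw [h2 z hzb ((key x hx z hz).1 hz'')]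

end Elem

theorem Good.prod_mem {W : Set V} [hW : Good W] {a b : V} (ha : a ∈ W) (hb : b ∈ W) :
    a.prod b ∈ W := by
  have : Par W W := ⟨subset_rfl⟩
  have : Fact (a ∈ W) := ⟨ha⟩
  have : Fact (b ∈ W) := ⟨hb⟩
  have h : DfnF W W (fun _ => a.prod b) := inferInstance
  exact h.mem' (fun _ => ∅) fun _ => hW.empty

/-- `W` has a relation witnessing that `b` is not larger than `a`. -/
def CsIn (W : Set V) (a b : V) : Prop := ∃ f ∈ W, SurjR f a b

instance Dfn.CsIn_inst {W A : Set V} [Good W] [Par W A] {s t : Env → V} [hs : DfnF W A s]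
    [ht : DfnF W A t] : Dfn W A (fun v => CsIn W (s v) (t v)) := by
  have h : Dfn W A (fun v => CsIn W (v 0) (v 1)) := by
    unfold CsIn
    infer_instance
  exact h.comp2 hs ht

theorem SurjR.card_le {f a b : V} (h : SurjR f a b) : b.card ≤ a.card := by
  rw [← cardLE_iff]
  choose! g hg h1 h2 using h
  exact ⟨⟨fun y => ⟨g y.1, hg _ y.2⟩, fun y z hyz => by
    have e : g y.1 = g z.1 := congrArg Subtype.val hyz
    have := h1 y.1 y.2
    rw [e] at this
    exact Subtype.ext (h2 _ z.2 _ y.2 this)⟩⟩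

theorem csIn_iff {c : Cardinal.{0}} [hc : RegC c] {a b : V} (ha : a ∈ HH c) (hb : b ∈ HH c) :
    CsIn (HH c) a b ↔ b.card ≤ a.card := by
  constructor
  · rintro ⟨f, -, h⟩
    exact h.card_le
  · intro h
    rw [← cardLE_iff] at h
    obtain ⟨g⟩ := h
    refine ⟨ZFSet.sep (fun p => ∃ y : b.toSet, p = pair (g y) y) (a.prod b),
      HH_subset (Good.prod_mem ha hb) ZFSet.sep_subset, fun y hy => ?_⟩
    refine ⟨g ⟨y, hy⟩, (g ⟨y, hy⟩).2, ?_, fun y' hy' h => ?_⟩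
    · exact ZFSet.mem_sep.2 ⟨ZFSet.pair_mem_prod.2 ⟨(g ⟨y, hy⟩).2, hy⟩, ⟨y, hy⟩, rfl⟩
    · obtain ⟨z, hz⟩ := (ZFSet.mem_sep.1 h).2
      rw [ZFSet.pair_inj] at hz
      have := g.injective (Subtype.ext hz.1)
      rw [hz.2, ← this]

section Elem
variable {c : Cardinal.{0}} [hc : RegC c] {X : V} (hX : ElemSub X (HH c))
include hX

theorem ElemSub.subset_of_card {a b : V} (ha : a ∈ X) (hb : b ∈ X) (h : b.card ≤ a.card)
    (haX : a ⊆ X) : b ⊆ X := by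
  intro y hy
  have := hX.par
  have : Fact (a ∈ X.toSet) := ⟨ha⟩
  have : Fact (b ∈ X.toSet) := ⟨hb⟩
  obtain ⟨f, hf, hs⟩ := hX.wit (P := fun f => SurjR f a b) inferInstance
    ((csIn_iff (hX.1 ha) (hX.1 hb)).2 h)
  obtain ⟨x, hx, h1, h2⟩ := hs y hy
  have : Fact (f ∈ X.toSet) := ⟨hf⟩
  have : Fact (x ∈ X.toSet) := ⟨haX hx⟩
  obtain ⟨z, hz, hzb, hz'⟩ := hX.wit (P := fun y => y ∈ b ∧ pair x y ∈ f) inferInstance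
    ⟨y, HH_trans (hX.1 hb) hy, hy, h1⟩
  rwa [h2 z hzb hz'] at hz

theorem ElemSub.omega_pred {n : ℕ} (h : Ordinal.omega (n + 1) ∈ Od X) :
    Ordinal.omega n ∈ Od X := by
  have := hX.par
  have : Fact (oz (Ordinal.omega (n + 1)) ∈ X.toSet) := ⟨h⟩
  have hlt := hX.lt_ord h
  have hcs : ∀ a b, a < c.ord → b < c.ord → (CsIn (HH c) (oz a) (oz b) ↔ b.card ≤ a.card) :=
    fun a b ha hb => by
      rw [csIn_iff (oz_mem_HH.2 ha) (oz_mem_HH.2 hb), card_oz, card_oz]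
  have hnn : Ordinal.omega (n : Ordinal.{0}) < Ordinal.omega (n + 1) :=
    Ordinal.omega_lt_omega.2 (lt_add_one _)
  have hl : ∀ b < Ordinal.omega ((n : Ordinal.{0}) + 1), b.card ≤ Cardinal.aleph n := by
    intro b hb
    rw [← Cardinal.ord_aleph, Cardinal.lt_ord, ← Cardinal.succ_aleph,
      Order.lt_succ_iff] at hb
    exact hb
  have : Dfn (HH c) X.toSet (fun v => ∀ w ∈ oz (Ordinal.omega (n + 1)), CsIn (HH c) (v 0) w) :=
    inferInstance
  obtain ⟨ξ, hξ, h1, h2, h3⟩ := hX.ord_wit (P := fun w => w ∈ oz (Ordinal.omega (n + 1)) ∧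
      (∀ β ∈ oz (Ordinal.omega (n + 1)), CsIn (HH c) w β) ∧ ∀ w' ∈ w, ¬ CsIn (HH c) w' w)
    inferInstance (by
      refine ⟨Ordinal.omega n, hnn.trans hlt, oz_mem.2 hnn, fun β hβ => ?_, fun w hw => ?_⟩
      · obtain ⟨b, hb, rfl⟩ := mem_oz.1 hβ
        rw [hcs _ _ (hnn.trans hlt) (hb.trans hlt), Ordinal.card_omega]
        exact hl b hb
      · obtain ⟨b, hb, rfl⟩ := mem_oz.1 hw
        rw [hcs _ _ (hb.trans (hnn.trans hlt)) (hnn.trans hlt), Ordinal.card_omega, not_le]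
        rwa [← Cardinal.ord_aleph, Cardinal.lt_ord] at hb)
  · obtain hb := h2 _ (oz_mem.2 hnn)
    have hξ' := oz_mem.1 h1
    rw [hcs _ _ (hξ'.trans hlt) (hnn.trans hlt), Ordinal.card_omega] at hb
    have : ξ = Ordinal.omega n := by
      refine le_antisymm ?_ ?_
      · by_contra hlt'
        push Not at hlt'
        refine h3 _ (oz_mem.2 hlt') ?_
        rw [hcs _ _ (hnn.trans hlt) (hξ'.trans hlt), Ordinal.card_omega]
        exact hl _ hξ'
      · rw [← Cardinal.ord_aleph]
        exact Cardinal.ord_le.2 hb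
    rwa [← this]

theorem ElemSub.omega_succ {γ : Ordinal.{0}} {n : ℕ} (hγ : γ ∈ Od X)
    (hγn : γ.card = Cardinal.aleph n)
    (hlt : Ordinal.omega (n + 1) < c.ord) : Ordinal.omega (n + 1) ∈ Od X := by
  have := hX.par
  have : Fact (oz γ ∈ X.toSet) := ⟨hγ⟩
  have hγc := hX.lt_ord hγ
  have hcs : ∀ b, b < c.ord → (CsIn (HH c) (oz γ) (oz b) ↔ b.card ≤ Cardinal.aleph n) :=
    fun b hb => by
      rw [csIn_iff (oz_mem_HH.2 hγc) (oz_mem_HH.2 hb), card_oz, card_oz, hγn]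
  have hl : ∀ b, b < Ordinal.omega ((n : Ordinal.{0}) + 1) ↔ b.card ≤ Cardinal.aleph n := by
    intro b
    rw [← Cardinal.ord_aleph, Cardinal.lt_ord, ← Cardinal.succ_aleph,
      Order.lt_succ_iff]
  obtain ⟨ξ, hξ, h1, h2⟩ := hX.ord_wit (P := fun x => ¬ CsIn (HH c) (oz γ) x ∧
      ∀ β ∈ x, CsIn (HH c) (oz γ) β) inferInstance
    (by
      refine ⟨Ordinal.omega (n + 1), hlt, ?_, fun β hβ => ?_⟩
      · rw [hcs _ hlt, ← hl]
        exact lt_irrefl _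
      · obtain ⟨b, hb, rfl⟩ := mem_oz.1 hβ
        rw [hcs _ (hb.trans hlt), ← hl]
        exact hb)
  · have hξ' := hX.lt_ord hξ
    rw [hcs _ hξ', ← hl, not_lt] at h1
    have : ξ = Ordinal.omega (n + 1) := by
      refine le_antisymm ?_ h1
      by_contra hlt'
      push Not at hlt'
      have := h2 _ (oz_mem.2 hlt')
      rw [hcs _ hlt, ← hl] at this
      exact lt_irrefl _ this
    rwa [← this]

end Elem

/-! ## Downward Löwenheim–Skolem -/

theorem codeF_injective {n : ℕ} : Function.Injective (codeF (n := n)) := by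
  intro φ
  induction φ <;> intro ψ h <;> cases ψ <;>
    simp_all [codeF, Nat.pair_eq_pair, Fin.ext_iff]
  · rename_i ih
    exact ih rfl
  · rename_i ih ih'
    exact ⟨ih rfl, ih' rfl⟩
  · rename_i ih
    exact ih rfl

instance (n : ℕ) : Countable (Fml n) := codeF_injective.countable

theorem exists_elemSub {W : Set V} [hW : Good W] {X₀ : V} (hX₀ : X₀.toSet ⊆ W) {d : Cardinal.{0}}
    (hd : Cardinal.aleph0 ≤ d) (hX₀d : X₀.card ≤ d) :
    ∃ Z : V, X₀ ⊆ Z ∧ ElemSub Z W ∧ Z.card ≤ d := by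
  let 𝓛 : FirstOrder.Language.{0, 0} := ⟨fun n => Fml (n + 1), fun _ => Empty⟩
  let sk : ∀ {n : ℕ}, Fml (n + 1) → (Fin n → V) → V := fun φ v =>
    if h : ∃ x ∈ W, Sat W φ (Fin.cons x v) then h.choose else ∅
  have hsk : ∀ {n : ℕ} (φ : Fml (n + 1)) (v : Fin n → V), sk φ v ∈ W := by
    intro n φ v
    by_cases h : ∃ x ∈ W, Sat W φ (Fin.cons x v)
    · simp only [sk, dif_pos h]
      exact h.choose_spec.1
    · simp only [sk, dif_neg h]
      exact hW.empty
  let _ : 𝓛.Structure V := ⟨fun φ v => sk φ v, fun r => r.elim⟩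
  set C := FirstOrder.Language.Substructure.closure 𝓛 X₀.toSet with hC
  have hCW : (C : Set V) ⊆ W := by
    let D : 𝓛.Substructure V := ⟨W, fun {n} φ v _ => hsk φ v⟩
    exact (FirstOrder.Language.Substructure.closure_le (S := D)).2 hX₀
  have hcard : Cardinal.mk C ≤ Cardinal.lift.{1, 0} d := by
    have h := FirstOrder.Language.Substructure.lift_card_closure_le (L := 𝓛) (s := X₀.toSet)
    rw [Cardinal.lift_id'.{0, 1}] at h
    refine h.trans (max_le (by simpa using hd) ?_)
    refine Cardinal.add_le_of_le (by simpa using hd) ?_ ?_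
    · rw [Cardinal.lift_id'.{0, 1}]
      exact (cardinalMk_coe_sort (x := X₀)).trans_le (Cardinal.lift_le.2 hX₀d)
    · refine Cardinal.lift_le.2 (le_trans ?_ hd)
      have : Countable (Σ n, 𝓛.Functions n) := by
        have : ∀ n, Countable (𝓛.Functions n) := fun n => inferInstanceAs (Countable (Fml (n + 1)))
        infer_instance
      exact Cardinal.mk_le_aleph0
  have hsm : Small.{0} C := by
    rw [← Cardinal.mk_out d, ← Cardinal.mk_uLift] at hcard
    obtain ⟨e⟩ := Cardinal.le_def _ _ |>.1 hcard
    exact small_of_injective e.injective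
  set Z : V := ZFSet.range fun i : Shrink.{0} C => (((equivShrink C).symm i : C) : V) with hZ
  have hm : ∀ x, x ∈ Z ↔ x ∈ C := by
    intro x
    rw [hZ, ZFSet.mem_range]
    constructor
    · rintro ⟨i, rfl⟩
      exact ((equivShrink C).symm i).2
    · intro hx
      exact ⟨equivShrink C ⟨x, hx⟩, by rw [Equiv.symm_apply_apply]⟩
  refine ⟨Z, fun x hx => (hm x).2 (FirstOrder.Language.Substructure.subset_closure hx),
    elemSub_of_sat (fun x hx => hCW ((hm x).1 hx)) fun {n} φ v hv h => ?_, ?_⟩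
  · refine ⟨sk φ v, (hm _).2 ?_, ?_⟩
    · exact C.fun_mem (n := n) (show 𝓛.Functions n from φ) v fun i => (hm _).1 (hv i)
    · simp only [sk, dif_pos h]
      exact h.choose_spec.2
  · rw [← Cardinal.lift_le.{1, 0}, ← cardinalMk_coe_sort]
    refine le_trans ?_ hcard
    exact Cardinal.mk_le_of_injective (f := fun z : Z => (⟨z.1, (hm _).1 z.2⟩ : C)) fun a b h =>
      Subtype.ext (congrArg (fun x : C => (x : V)) h)

/-- Below an `L`-cardinal in which the pairing-closed ordinals are cofinal, failure of being an
`L`-cardinal is witnessed with a small index. -/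
theorem lCard_iff_lt {lam δ : Ordinal.{0}} (hlam : LCard (oz lam))
    (hcof : ∀ a < lam, ∃ γ < lam, a < γ ∧ JCl γ) (hδ : δ < lam) :
    LCard (oz δ) ↔ ∀ a < δ, ∀ ξ < lam, ¬ SurjR (F ξ) (oz a) (oz δ) := by
  rw [lCard_iff]
  refine ⟨fun h a ha ξ _ => h a ha ξ, fun h a ha ξ₀ hs => ?_⟩
  have hmem : F ξ₀ ∩ (oz a).prod (oz δ) ∈ LClass := by
    have hG := good_L
    have : Par LClass LClass := ⟨subset_rfl⟩
    have : Fact (F ξ₀ ∈ LClass) := ⟨F_mem_L ξ₀⟩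
    have : Fact (oz a ∈ LClass) := ⟨oz_mem_L a⟩
    have : Fact (oz δ ∈ LClass) := ⟨oz_mem_L δ⟩
    have h : DfnF LClass LClass (fun _ => F ξ₀ ∩ (oz a).prod (oz δ)) := inferInstance
    exact h.mem' (fun _ => ∅) fun _ => hG.empty
  obtain ⟨ξ₁, h₁⟩ := mem_L_iff.1 hmem
  obtain ⟨γ, hγ, hδγ, hJ⟩ := hcof δ hδ
  obtain ⟨ξ, hξ, h₂⟩ := exists_index_lt (ξ₀ := ξ₁) hlam hJ hγ (by
    intro z hz
    rw [← h₁, ZFSet.mem_inter, ZFSet.mem_prod] at hz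
    obtain ⟨-, x, hx, y, hy, rfl⟩ := hz
    obtain ⟨u, hu, rfl⟩ := mem_oz.1 hx
    obtain ⟨v, hv, rfl⟩ := mem_oz.1 hy
    exact ⟨u, hu.trans (ha.trans hδγ), v, hv.trans hδγ, rfl⟩)
  refine h a ha ξ hξ ?_
  rw [h₂, ← h₁]
  intro y hy
  obtain ⟨x, hx, h3, h4⟩ := hs y hy
  exact ⟨x, hx, ZFSet.mem_inter.2 ⟨h3, ZFSet.pair_mem_prod.2 ⟨hx, hy⟩⟩,
    fun y' hy' h => h4 y' hy' (ZFSet.mem_inter.1 h).1⟩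

/-- The set-theoretic form of `JCl`. -/
def JC (x : V) : Prop := ∅ ∈ x ∧ (∀ y ∈ x, insert y y ∈ x) ∧ ∀ a ∈ x, ∀ b ∈ x, Jt a b ∈ x

instance Dfn.JC_inst {W A : Set V} [Good W] [Par W A] {s : Env → V} [hs : DfnF W A s] :
    Dfn W A (fun v => JC (s v)) := by
  have h : Dfn W A (fun v => JC (v 0)) := by
    unfold JC
    infer_instance
  exact h.comp1 hs

theorem jC_of {γ : Ordinal.{0}} (h : JC (oz γ)) : JCl γ where
  nat n := by
    induction n with
    | zero => exact oz_mem.1 (by simpa [oz_zero] using h.1)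
    | succ n ih =>
      have := h.2.1 _ (oz_mem.2 ih)
      rw [← oz_succ, oz_mem] at this
      simpa using this
  pair a ha b hb := by
    have := h.2.2 _ (oz_mem.2 ha) _ (oz_mem.2 hb)
    rwa [Jt_oz, oz_mem] at this

theorem JCl.jC {γ : Ordinal.{0}} (h : JCl γ) (hl : Order.IsSuccLimit γ) : JC (oz γ) := by
  refine ⟨?_, fun y hy => ?_, fun a ha b hb => ?_⟩
  · rw [← oz_zero, oz_mem]
    simpa using h.nat 0
  · obtain ⟨a, ha, rfl⟩ := mem_oz.1 hy
    rw [← oz_succ, oz_mem]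
    exact hl.succ_lt ha
  · obtain ⟨a, ha', rfl⟩ := mem_oz.1 ha
    obtain ⟨b, hb', rfl⟩ := mem_oz.1 hb
    rw [Jt_oz, oz_mem]
    exact h.pair a ha' b hb'

instance (n : ℕ) : RegC (Cardinal.aleph ((n : Ordinal.{0}) + 1)) where
  reg := Cardinal.isRegular_aleph_add_one _
  unc := by
    rw [← Cardinal.aleph_zero, Cardinal.aleph_lt_aleph]
    exact pos_iff_ne_zero.2 (by simp)

theorem jCl_omega_succ (n : ℕ) : JCl (Ordinal.omega ((n : Ordinal.{0}) + 1)) := by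
  rw [← Cardinal.ord_aleph]
  exact jCl_ord

theorem lt_omega_succ {n : ℕ} {b : Ordinal.{0}} :
    b < Ordinal.omega ((n : Ordinal.{0}) + 1) ↔ b.card ≤ Cardinal.aleph n := by
  rw [← Cardinal.ord_aleph, Cardinal.lt_ord, ← Cardinal.succ_aleph, Order.lt_succ_iff]

theorem omega_lt_omega_succ (n : ℕ) :
    Ordinal.omega (n : Ordinal.{0}) < Ordinal.omega (n + 1) :=
  Ordinal.omega_lt_omega.2 (lt_add_one _)

section Elem
variable {c : Cardinal.{0}} [hc : RegC c]

theorem exists_elemSub_of_mem {n : ℕ} (hn : Ordinal.omega ((n : Ordinal.{0}) + 1) < c.ord)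
    {x y : V} (hx : x ∈ HH c) (hy : y ∈ HH c) :
    ∃ Z : V, oz (Ordinal.omega n) ⊆ Z ∧ x ∈ Z ∧ y ∈ Z ∧ ElemSub Z (HH c) ∧
      Z.card ≤ Cardinal.aleph n ∧ Z ∈ HH c := by
  have hle : Cardinal.aleph0 ≤ Cardinal.aleph (n : Ordinal.{0}) := Cardinal.aleph0_le_aleph _
  have h1 : (1 : Cardinal.{0}) ≤ Cardinal.aleph (n : Ordinal.{0}) :=
    Cardinal.one_lt_aleph0.le.trans hle
  obtain ⟨Z, hZ1, hZ2, hZ3⟩ := exists_elemSub (W := HH c)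
    (X₀ := insert x (insert y (oz (Ordinal.omega n)))) (d := Cardinal.aleph n) (by
      intro z hz
      rcases ZFSet.mem_insert_iff.1 hz with rfl | hz
      · exact hx
      rcases ZFSet.mem_insert_iff.1 hz with rfl | hz
      · exact hy
      · obtain ⟨a, ha, rfl⟩ := mem_oz.1 hz
        exact oz_mem_HH.2 (ha.trans ((omega_lt_omega_succ n).trans hn))) hle (by
      refine card_insert_le.trans (Cardinal.add_le_of_le hle ?_ h1)
      refine card_insert_le.trans (Cardinal.add_le_of_le hle ?_ h1)
      rw [card_oz, Ordinal.card_omega])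
  refine ⟨Z, fun z hz => hZ1 (by simp [hz]), hZ1 (by simp), hZ1 (by simp), hZ2, hZ3,
    mem_HH (fun z hz => hZ2.1 hz) (hZ3.trans_lt ?_)⟩
  rw [← Cardinal.lt_ord.trans (Iff.of_eq (congrArg (· < c) (Ordinal.card_omega n)))]
  exact (omega_lt_omega_succ n).trans hn

theorem ElemSub.exists_segment {n : ℕ} {Z : V} (hZ : ElemSub Z (HH c))
    (h1 : oz (Ordinal.omega n) ⊆ Z) (h3 : Ordinal.omega ((n : Ordinal.{0}) + 1) ∈ Od Z)
    (h5 : Z.card ≤ Cardinal.aleph n) :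
    ∃ ζ < Ordinal.omega ((n : Ordinal.{0}) + 1),
      ∀ a < Ordinal.omega ((n : Ordinal.{0}) + 1), a ∈ Od Z ↔ a < ζ := by
  have hseg : ∀ a < Ordinal.omega ((n : Ordinal.{0}) + 1), a ∈ Od Z → ∀ a' < a, a' ∈ Od Z := by
    intro a ha haZ a' ha'
    refine hZ.subset_of_card (hZ.omega_pred h3) haZ ?_ h1 (oz_mem.2 ha')
    rw [card_oz, card_oz, Ordinal.card_omega]
    exact lt_omega_succ.1 ha
  have hex : ∃ a < Ordinal.omega ((n : Ordinal.{0}) + 1), a ∉ Od Z := by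
    by_contra h
    push Not at h
    have : oz (Ordinal.omega ((n : Ordinal.{0}) + 1)) ⊆ Z := by
      intro z hz
      obtain ⟨a, ha, rfl⟩ := mem_oz.1 hz
      exact h a ha
    have := (card_mono this).trans h5
    rw [card_oz, ← lt_omega_succ] at this
    exact lt_irrefl _ this
  obtain ⟨a₀, h7, h8⟩ := hex
  have hζ := csInf_mem (s := {a | a ∉ Od Z}) ⟨a₀, h8⟩
  set ζ := sInf {a | a ∉ Od Z}
  have hζlt : ζ < Ordinal.omega ((n : Ordinal.{0}) + 1) := (csInf_le' h8).trans_lt h7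
  have hiff : ∀ a < Ordinal.omega ((n : Ordinal.{0}) + 1), a ∈ Od Z ↔ a < ζ := by
    intro a ha
    constructor
    · intro haZ
      by_contra hlt
      rcases (not_lt.1 hlt).lt_or_eq with h | h
      · exact hζ (hseg a ha haZ _ h)
      · exact hζ (h ▸ haZ)
    · intro hlt
      by_contra h
      exact notMem_of_lt_csInf' hlt h
  exact ⟨ζ, hζlt, hiff⟩

theorem exists_elemSub_segment {n : ℕ} (hn : Ordinal.omega ((n : Ordinal.{0}) + 1) < c.ord)
    {b : Ordinal.{0}} (hb : b < Ordinal.omega ((n : Ordinal.{0}) + 1)) :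
    ∃ Z : V, ∃ ζ < Ordinal.omega ((n : Ordinal.{0}) + 1), b < ζ ∧ ElemSub Z (HH c) ∧ Z ∈ HH c ∧
      Ordinal.omega ((n : Ordinal.{0}) + 1) ∈ Od Z ∧
      (∀ a < Ordinal.omega ((n : Ordinal.{0}) + 1), a ∈ Od Z ↔ a < ζ) := by
  obtain ⟨Z, h1, h2, h3, hZ, h5, h6⟩ := exists_elemSub_of_mem hn (oz_mem_HH.2 (hb.trans hn))
    (oz_mem_HH.2 hn)
  obtain ⟨ζ, hζlt, hiff⟩ := hZ.exists_segment h1 h3 h5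
  exact ⟨Z, ζ, hζlt, (hiff b hb).1 h2, hZ, h6, h3, hiff⟩

theorem jCl_cofinal (n : ℕ) {b : Ordinal.{0}} (hb : b < Ordinal.omega ((n : Ordinal.{0}) + 1)) :
    ∃ ζ < Ordinal.omega ((n : Ordinal.{0}) + 1), b < ζ ∧ JCl ζ ∧ Order.IsSuccLimit ζ := by
  have hlt := omega_lt_omega_succ (n + 1)
  rw [← Cardinal.ord_aleph (((n + 1 : ℕ) : Ordinal.{0}) + 1), Nat.cast_succ] at hlt
  have : RegC (Cardinal.aleph ((n : Ordinal.{0}) + 1 + 1)) := by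
    have : RegC (Cardinal.aleph (((n + 1 : ℕ) : Ordinal.{0}) + 1)) := inferInstance
    rwa [Nat.cast_succ] at this
  obtain ⟨Z, ζ, h1, h2, hZ, -, h3, h4⟩ := exists_elemSub_segment hlt hb
  have hJ := jCl_omega_succ n
  refine ⟨ζ, h1, h2, ⟨fun m => ?_, fun a ha a' ha' => ?_⟩, Ordinal.isSuccLimit_iff.2 ⟨?_,
    Order.isSuccPrelimit_of_succ_lt fun a ha => ?_⟩⟩
  · exact (h4 _ (hJ.nat m)).1 (hZ.clos.nat m)
  · have hb := ha.trans h1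
    have hb' := ha'.trans h1
    exact (h4 _ (hJ.pair _ hb _ hb')).1
      (hZ.clos.J _ ((h4 _ hb).2 ha) _ ((h4 _ hb').2 ha'))
  · exact ((zero_le).trans_lt h2).ne'
  · have hb := ha.trans h1
    refine (h4 _ ((Cardinal.isSuccLimit_omega _).succ_lt hb)).1 ?_
    have := hZ.par
    have : Fact (oz a ∈ Z.toSet) := ⟨(h4 _ hb).2 ha⟩
    show oz _ ∈ Z
    rw [oz_succ]
    exact hZ.term inferInstance

theorem ElemSub.jCl_cofinal {X : V} (hX : ElemSub X (HH c)) {n : ℕ}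
    (h : Ordinal.omega ((n : Ordinal.{0}) + 1) ∈ Od X) {d : Ordinal.{0}}
    (hd : d < G (Od X) (Ordinal.omega (n + 1))) :
    ∃ γ < G (Od X) (Ordinal.omega (n + 1)), d < γ ∧ JCl γ := by
  have := hX.par
  obtain ⟨b, hb, hbn, rfl⟩ := lt_G.1 hd
  have : Fact (oz b ∈ X.toSet) := ⟨hb⟩
  obtain ⟨K, hK⟩ : ∃ K, K = oz (Ordinal.omega ((n : Ordinal.{0}) + 1)) := ⟨_, rfl⟩
  have : Fact (K ∈ X.toSet) := ⟨hK ▸ h⟩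
  obtain ⟨ζ, h1, h2, h3, h4⟩ := SRPPaper.jCl_cofinal n hbn
  obtain ⟨γ, hγ, h5, h6, h7⟩ := hX.ord_wit (P := fun x =>
    x ∈ K ∧ oz b ∈ x ∧ JC x) inferInstance
    ⟨ζ, h1.trans (hX.lt_ord h), hK ▸ oz_mem.2 h1, oz_mem.2 h2, h3.jC h4⟩
  have hJ := jC_of h7
  rw [hK] at h5
  refine ⟨_, G_lt (oz_mem.1 h5) hγ, G_lt (oz_mem.1 h6) hb, fun m => ?_, fun a ha a' ha' => ?_⟩
  · rw [← hX.clos.G_nat m]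
    exact G_lt (hJ.nat m) (hX.clos.nat m)
  · obtain ⟨a, h8, h9, rfl⟩ := lt_G.1 ha
    obtain ⟨a', h8', h9', rfl⟩ := lt_G.1 ha'
    rw [← hX.clos.G_J h8 h8']
    exact G_lt (hJ.pair _ h9 _ h9') (hX.clos.J _ h8 _ h8')

end Elem

theorem aleph_succ_eq (n : ℕ) :
    Aleph (n + 1) = oz (Ordinal.omega ((n : Ordinal.{0}) + 1)) := by
  rw [aleph_eq, Nat.cast_succ]

theorem lCard_omega (n : ℕ) : LCard (oz (Ordinal.omega n)) := by
  rw [lCard_iff]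
  intro a ha ξ h
  have := h.card_le
  rw [card_oz, card_oz, Ordinal.card_omega] at this
  rw [← Cardinal.ord_aleph, Cardinal.lt_ord] at ha
  exact absurd this (not_le.2 ha)

theorem countable_iff {x : V} : x.toSet.Countable ↔ x.card ≤ Cardinal.aleph0 := by
  rw [← Cardinal.lift_le.{1, 0}, ← cardinalMk_coe_sort, Cardinal.lift_aleph0,
    Cardinal.mk_le_aleph0_iff]
  rfl

theorem ElemSub.infinite {c : Cardinal.{0}} [RegC c] {X : V} (hX : ElemSub X (HH c)) :
    X.toSet.Infinite :=
  Set.infinite_of_injective_forall_mem (f := natZ) (fun _ _ h => natZ_inj.1 h) hX.natZ_mem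

theorem srpl_iff {γ : Ordinal.{0}} (hγ : Ordinal.omega0 < γ) :
    SRPL (oz γ) ↔ ∃ c : Cardinal.{0}, RegC c ∧ γ < c.ord ∧ ∀ X, ElemSub X (HH c) →
      X.card ≤ Cardinal.aleph0 → γ ∈ Od X → LCard (oz (G (Od X) γ)) := by
  constructor
  · rintro ⟨κ, hκ, hγκ, h⟩
    obtain ⟨k, rfl⟩ := isOrd_iff.1 hκ.1.1
    have hγk := oz_mem.1 hγκ
    obtain ⟨c, hc, hc', rfl⟩ := isRegular_of hκ (hγ.trans hγk)
    have : RegC c := ⟨hc, hc'⟩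
    rw [hset_eq] at h
    refine ⟨c, this, hγk, fun X hX hXc hγX => ?_⟩
    rw [← collapse_oz]
    exact h X hX ⟨countable_iff.2 hXc, hX.infinite⟩ hγX
  · rintro ⟨c, hc, hγc, h⟩
    refine ⟨oz c.ord, ?_, oz_mem.2 hγc, fun X hX hXc hγX => ?_⟩
    · exact isRegular_ord hc.reg
    · rw [hset_eq] at hX
      have := h X hX (countable_iff.1 hXc.1) hγX
      rwa [← collapse_oz] at this

theorem G_congr {H H' : Set Ordinal.{0}} {α : Ordinal.{0}} (h : ∀ ξ < α, ξ ∈ H ↔ ξ ∈ H') :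
    G H α = G H' α := by
  induction α using WellFoundedLT.induction with
  | _ α ih =>
  refine eq_of_forall_lt_iff fun d => ?_
  rw [lt_G, lt_G]
  constructor
  · rintro ⟨ξ, hξ, hlt, rfl⟩
    exact ⟨ξ, (h ξ hlt).1 hξ, hlt, (ih ξ hlt fun ζ hζ => h ζ (hζ.trans hlt)).symm⟩
  · rintro ⟨ξ, hξ, hlt, rfl⟩
    exact ⟨ξ, (h ξ hlt).2 hξ, hlt, ih ξ hlt fun ζ hζ => h ζ (hζ.trans hlt)⟩

theorem G_congr' {H H' : Set Ordinal.{0}} {α β : Ordinal.{0}} (hαβ : α ≤ β)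
    (h : ∀ ξ < β, ξ ∈ H' ↔ ξ ∈ H ∧ ξ < α) : G H' β = G H α := by
  rw [G_congr (H' := H ∩ Set.Iio α) h, ← G_congr (H := H ∩ Set.Iio α) (H' := H)]
  · refine eq_of_forall_lt_iff fun d => ?_
    rw [lt_G, lt_G]
    constructor
    · rintro ⟨ξ, hξ, hlt, rfl⟩
      exact ⟨ξ, hξ, hξ.2, rfl⟩
    · rintro ⟨ξ, hξ, hlt, rfl⟩
      exact ⟨ξ, hξ, hlt.trans_le hαβ, rfl⟩
  · exact fun ξ hξ => ⟨fun h => h.1, fun h => ⟨h, hξ⟩⟩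

theorem omega0_lt_omega_one : Ordinal.omega0 < Ordinal.omega ((1 : ℕ) : Ordinal.{0}) := by
  rw [← Ordinal.omega_zero, Ordinal.omega_lt_omega]
  simp

theorem card_of_segment {n : ℕ} {γ : Ordinal.{0}} (h : Ordinal.omega (n : Ordinal.{0}) ≤ γ)
    (h' : γ < Ordinal.omega ((n : Ordinal.{0}) + 1)) : γ.card = Cardinal.aleph n := by
  refine le_antisymm (lt_omega_succ.1 h') ?_
  rw [← Ordinal.card_omega]
  exact Ordinal.card_le_card h

/-- The strong reflecting property of `ω₂` passes to smaller `L`-cardinals. -/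
theorem srpl_of_omega_two (h : SRPL (oz (Ordinal.omega (((1 : ℕ) : Ordinal.{0}) + 1))))
    {γ : Ordinal.{0}} (hγ : LCard (oz γ)) (h1 : Ordinal.omega ((1 : ℕ) : Ordinal.{0}) ≤ γ)
    (h2 : γ < Ordinal.omega (((1 : ℕ) : Ordinal.{0}) + 1)) : SRPL (oz γ) := by
  have hω := omega0_lt_omega_one.trans_le h1
  rw [srpl_iff (hω.trans h2)] at h
  rw [srpl_iff hω]
  obtain ⟨c, hc, hlt, h⟩ := h
  refine ⟨c, hc, h2.trans hlt, fun X hX hXc hγX => ?_⟩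
  have h2X := hX.omega_succ hγX (card_of_segment h1 h2) hlt
  rw [lCard_iff_lt (h X hX hXc h2X) (fun d hd => hX.jCl_cofinal h2X hd) (G_lt h2 hγX)]
  intro a ha ξ hξ hs
  obtain ⟨a', haX, ha', rfl⟩ := lt_G.1 ha
  obtain ⟨ξ₁, hξX, hξ₁, rfl⟩ := lt_G.1 hξ
  rw [hX.surjR_iff hξX haX hγX] at hs
  exact lCard_iff.1 hγ a' ha' ξ₁ hs

/-- If `ω₂` has the strong reflecting property then it is a limit cardinal in `L`. -/
theorem exists_lCard_of_srpl (h : SRPL (oz (Ordinal.omega (((1 : ℕ) : Ordinal.{0}) + 1))))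
    {b : Ordinal.{0}} (hb : b < Ordinal.omega (((1 : ℕ) : Ordinal.{0}) + 1)) :
    ∃ ζ < Ordinal.omega (((1 : ℕ) : Ordinal.{0}) + 1), b < ζ ∧ LCard (oz ζ) := by
  rw [srpl_iff (omega0_lt_omega_one.trans (omega_lt_omega_succ 1))] at h
  obtain ⟨c, hc, hlt, h⟩ := h
  obtain ⟨Z, ζ, hζ, hbζ, hZ, hZH, h2Z, hiff⟩ := exists_elemSub_segment hlt hb
  refine ⟨ζ, hζ, hbζ, ?_⟩
  have hL : LCard (oz (Ordinal.omega (((1 : ℕ) : Ordinal.{0}) + 1))) := by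
    have := lCard_omega (1 + 1)
    rwa [Nat.cast_succ] at this
  rw [lCard_iff_lt hL (fun a ha => ?_) hζ]
  swap
  · obtain ⟨γ, h1, h2, h3, -⟩ := jCl_cofinal 1 ha
    exact ⟨γ, h1, h2, h3⟩
  intro a ha ξ hξ hs
  generalize hK : Ordinal.omega (((1 : ℕ) : Ordinal.{0}) + 1) = K at *
  have hm : ∀ z, z ∈ ({Z, oz ζ, oz K, oz ξ, oz a} : V) ↔
      z ∈ ({Z, oz ζ, oz K, oz ξ, oz a} : Set V) := fun z => by
    simp only [ZFSet.mem_insert_iff, ZFSet.mem_singleton, Set.mem_insert_iff,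
      Set.mem_singleton_iff]
  obtain ⟨Y, hXY, hY, hYc⟩ := exists_elemSub (W := HH c)
    (X₀ := {Z, oz ζ, oz K, oz ξ, oz a}) (by
      intro z hz
      rcases (hm z).1 hz with rfl | rfl | rfl | rfl | rfl
      · exact hZH
      all_goals apply oz_mem_HH.2
      · exact hζ.trans hlt
      · exact hlt
      · exact hξ.trans hlt
      · exact ha.trans (hζ.trans hlt)) le_rfl (by
      rw [← countable_iff]
      exact (Set.to_countable ({Z, oz ζ, oz K, oz ξ, oz a} : Set V)).mono fun z hz => (hm z).1 hz)
  have hZY : Z ∈ Y := hXY ((hm Z).2 (by simp))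
  have hX := hY.inter hZ hZY
  have hζY : ζ ∈ Od Y := hXY ((hm (oz ζ)).2 (by simp))
  have haY : a ∈ Od Y := hXY ((hm (oz a)).2 (by simp))
  have hξY : ξ ∈ Od Y := hXY ((hm (oz ξ)).2 (by simp))
  have hKY : K ∈ Od Y := hXY ((hm (oz K)).2 (by simp))
  have hLX := h (Y ∩ Z) hX ((card_mono fun z hz => (ZFSet.mem_inter.1 hz).1).trans hYc)
    (show oz K ∈ Y ∩ Z from ZFSet.mem_inter.2 ⟨hKY, h2Z⟩)
  rw [G_congr' (H := Od Y) (α := ζ) hζ.le fun ξ hξ => ?_] at hLX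
  · exact lCard_iff.1 hLX _ (G_lt ha haY) _ ((hY.surjR_iff hξY haY hζY).2 hs)
  · rw [← hiff ξ hξ]
    show oz ξ ∈ Y ∩ Z ↔ _
    exact ZFSet.mem_inter

theorem exists_toSet_eq {s : Set V} (hs : s.Countable) :
    ∃ x : V, x.toSet = s ∧ x.card ≤ Cardinal.aleph0 := by
  have h : ∃ x : V, x.toSet = s := by
    rcases s.eq_empty_or_nonempty with rfl | hne
    · exact ⟨∅, by ext z; exact iff_of_false (ZFSet.notMem_empty z) id⟩
    · obtain ⟨f, rfl⟩ := hs.exists_eq_range hne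
      exact ⟨ZFSet.range f, by ext z; exact ZFSet.mem_range⟩
  obtain ⟨x, rfl⟩ := h
  exact ⟨x, rfl, countable_iff.1 hs⟩

/-- A countable elementary submodel of `W` containing the countable set `s`. -/
def hull (W : Set V) (s : Set V) : V :=
  if h : ∃ Z : V, s ⊆ Z.toSet ∧ ElemSub Z W ∧ Z.card ≤ Cardinal.aleph0 then h.choose else ∅

theorem hull_spec {W : Set V} [Good W] {s : Set V} (hsW : s ⊆ W) (hs : s.Countable) :
    s ⊆ (hull W s).toSet ∧ ElemSub (hull W s) W ∧ (hull W s).card ≤ Cardinal.aleph0 := by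
  obtain ⟨x, rfl, hx⟩ := exists_toSet_eq hs
  have h := exists_elemSub (W := W) hsW le_rfl hx
  have h' : ∃ Z : V, x.toSet ⊆ Z.toSet ∧ ElemSub Z W ∧ Z.card ≤ Cardinal.aleph0 := h
  rw [hull, dif_pos h']
  exact h'.choose_spec

/-- An increasing chain of countable elementary submodels of `W` picking up the values of `g`. -/
def chain (W : Set V) (x : V) (g : Ordinal.{0} → V) : Ordinal.{0} → V :=
  WellFounded.fix (C := fun _ => V) wellFounded_lt fun i ih =>
    hull W ({y | ∃ j, ∃ h : j < i, y ∈ ih j h} ∪ {x, g i})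

theorem chain_eq (W : Set V) (x : V) (g : Ordinal.{0} → V) (i : Ordinal.{0}) :
    chain W x g i = hull W ((⋃ j : Set.Iio i, (chain W x g j).toSet) ∪ {x, g i}) := by
  rw [chain, WellFounded.fix_eq]
  congr 2
  ext y
  simp only [Set.mem_iUnion, Subtype.exists, Set.mem_Iio]
  rfl

theorem countable_Iio {i : Ordinal.{0}} (hi : i < Ordinal.omega (((0 : ℕ) : Ordinal.{0}) + 1)) :
    Countable (Set.Iio i) := by
  rw [← Cardinal.mk_le_aleph0_iff, Cardinal.mk_Iio_ordinal, ← Cardinal.lift_aleph0.{1, 0},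
    Cardinal.lift_le]
  have := lt_omega_succ.1 hi
  simpa using this

theorem chain_spec {W : Set V} [Good W] {x : V} {g : Ordinal.{0} → V} (hx : x ∈ W)
    (hg : ∀ i, g i ∈ W) {i : Ordinal.{0}}
    (hi : i < Ordinal.omega (((0 : ℕ) : Ordinal.{0}) + 1)) :
    (⋃ j : Set.Iio i, (chain W x g j).toSet) ∪ {x, g i} ⊆ (chain W x g i).toSet ∧
      ElemSub (chain W x g i) W ∧ (chain W x g i).card ≤ Cardinal.aleph0 := by
  induction i using WellFoundedLT.induction with
  | _ i ih =>
  rw [chain_eq]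
  have := countable_Iio hi
  refine hull_spec ?_ ?_
  · refine Set.union_subset (Set.iUnion_subset fun j => (ih j j.2 (j.2.trans hi)).2.1.1) ?_
    rintro z (rfl | rfl)
    exacts [hx, hg i]
  · refine (Set.countable_iUnion fun j => ?_).union (Set.to_countable _)
    exact countable_iff.2 (ih j j.2 (j.2.trans hi)).2.2

theorem elemSub_of_directed {W : Set V} {U : V} {ι : Type*} [LinearOrder ι] [Nonempty ι]
    {Y : ι → V} (hY : ∀ i, ElemSub (Y i) W) (hmono : Monotone Y)
    (hU : ∀ x, x ∈ U ↔ ∃ i, x ∈ Y i) : ElemSub U W := by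
  refine elemSub_of_sat (fun x hx => ?_) fun {n} φ v hv hs => ?_
  · obtain ⟨i, hi⟩ := (hU x).1 hx
    exact (hY i).1 hi
  · have : ∀ k, ∃ i, v k ∈ Y i := fun k => (hU _).1 (hv k)
    choose f hf using this
    obtain ⟨m, hm⟩ : ∃ m, ∀ k, f k ≤ m := by
      obtain ⟨m, hm⟩ := Finite.bddAbove_range f
      exact ⟨m, fun k => hm ⟨k, rfl⟩⟩
    have hvm : ∀ k, v k ∈ Y m := fun k => hmono (hm k) (hf k)
    have h1 := ((hY m).2 (.ex φ) v hvm).2 hs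
    obtain ⟨x, hx, hx'⟩ := h1
    refine ⟨x, (hU x).2 ⟨m, hx⟩, ?_⟩
    refine ((hY m).2 φ (Fin.cons x v) fun k => ?_).1 hx'
    refine Fin.cases hx (fun j => hvm j) k

/-- `e` is an isomorphism of the set `A` of ordinals with the ordinal `l`. -/
def OtR (e A l : V) : Prop :=
  (∀ ξ ∈ A, ∃ η ∈ l, pair ξ η ∈ e) ∧ (∀ η ∈ l, ∃ ξ ∈ A, pair ξ η ∈ e) ∧
    ∀ ξ ∈ A, ∀ ζ ∈ A, ∀ η ∈ l, ∀ θ ∈ l, pair ξ η ∈ e → pair ζ θ ∈ e → (ξ ∈ ζ ↔ η ∈ θ)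

instance Dfn.OtR_inst {W A : Set V} [Good W] [Par W A] {s t u : Env → V} [hs : DfnF W A s]
    [ht : DfnF W A t] [hu : DfnF W A u] : Dfn W A (fun v => OtR (s v) (t v) (u v)) := by
  have h : Dfn W A (fun v => OtR (v 0) (v 1) (v 2)) := by
    unfold OtR
    infer_instance
  exact h.comp3 hs ht hu

theorem OtR.eq_G {e A : V} {α l : Ordinal.{0}} (h : OtR e A (oz l)) (hA : A ⊆ oz α) :
    l = G (Od A) α := by
  obtain ⟨h1, h2, h3⟩ := h
  have key : ∀ ξ ∈ Od A, ∀ η < l, pair (oz ξ) (oz η) ∈ e → η = G (Od A) ξ := by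
    intro ξ
    induction ξ using WellFoundedLT.induction with
    | _ ξ ih =>
    intro hξ η hη he
    refine eq_of_forall_lt_iff fun d => ?_
    rw [lt_G]
    constructor
    · intro hd
      obtain ⟨z, hz, hze⟩ := h2 _ (oz_mem.2 (hd.trans hη))
      obtain ⟨ζ, -, rfl⟩ := mem_oz.1 (hA hz)
      have hlt := oz_mem.1 ((h3 _ hz _ hξ _ (oz_mem.2 (hd.trans hη)) _ (oz_mem.2 hη) hze he).2
        (oz_mem.2 hd))
      exact ⟨ζ, hz, hlt, (ih ζ hlt hz d (hd.trans hη) hze).symm⟩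
    · rintro ⟨ζ, hζ, hlt, rfl⟩
      obtain ⟨z, hz, hze⟩ := h1 (oz ζ) hζ
      obtain ⟨d, hd, rfl⟩ := mem_oz.1 hz
      rw [← ih ζ hlt hζ d hd hze]
      exact oz_mem.1 ((h3 _ hζ _ hξ _ hz _ (oz_mem.2 hη) hze he).1 (oz_mem.2 hlt))
  refine eq_of_forall_lt_iff fun d => ?_
  rw [lt_G]
  constructor
  · intro hd
    obtain ⟨z, hz, hze⟩ := h2 _ (oz_mem.2 hd)
    obtain ⟨ζ, hζ, rfl⟩ := mem_oz.1 (hA hz)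
    exact ⟨ζ, hz, hζ, (key ζ hz d hd hze).symm⟩
  · rintro ⟨ζ, hζ, hlt, rfl⟩
    obtain ⟨z, hz, hze⟩ := h1 (oz ζ) hζ
    obtain ⟨d, hd, rfl⟩ := mem_oz.1 hz
    rwa [← key ζ hζ d hd hze]

theorem exists_otR {c : Cardinal.{0}} [hc : RegC c] {A : V} {α : Ordinal.{0}} (hA : A ⊆ oz α)
    (hα : α < c.ord) (hG : G (Od A) α < c.ord) : ∃ e ∈ HH c, OtR e A (oz (G (Od A) α)) := by
  refine ⟨ZFSet.sep (fun p => ∃ ξ, p = pair (oz ξ) (oz (G (Od A) ξ)))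
    ((oz α).prod (oz (G (Od A) α))), HH_subset (Good.prod_mem (oz_mem_HH.2 hα) (oz_mem_HH.2 hG))
      ZFSet.sep_subset, fun z hz => ?_, fun z hz => ?_, ?_⟩
  · obtain ⟨ξ, hξ, rfl⟩ := mem_oz.1 (hA hz)
    have := oz_mem.2 (G_lt (H := Od A) hξ hz)
    exact ⟨_, this, ZFSet.mem_sep.2 ⟨ZFSet.pair_mem_prod.2 ⟨oz_mem.2 hξ, this⟩, ξ, rfl⟩⟩
  · obtain ⟨d, hd, rfl⟩ := mem_oz.1 hz
    obtain ⟨ξ, hξ, hlt, rfl⟩ := lt_G.1 hd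
    exact ⟨_, hξ, ZFSet.mem_sep.2 ⟨ZFSet.pair_mem_prod.2 ⟨oz_mem.2 hlt, hz⟩, ξ, rfl⟩⟩
  · intro x hx y hy s hs t ht h1 h2
    obtain ⟨-, ξ, hξ⟩ := ZFSet.mem_sep.1 h1
    obtain ⟨-, ζ, hζ⟩ := ZFSet.mem_sep.1 h2
    rw [ZFSet.pair_inj] at hξ hζ
    obtain ⟨rfl, rfl⟩ := hξ
    obtain ⟨rfl, rfl⟩ := hζ
    rw [oz_mem, oz_mem, G_lt_iff (H := Od A) hy hx]

/-- `E` codes an increasing `o₁`-sequence of subsets of `x`, each the image of `w`, with union `x`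
and such that the order type of each proper nonempty union is a cardinal in `L`. -/
def LChain (W : Set V) (w o₁ o₂ x E : V) : Prop :=
  (∀ ξ ∈ x, ∃ i ∈ o₁, pair i ξ ∈ E) ∧
  (∀ i ∈ o₁, CsIn W w (ZFSet.sep (fun ξ => pair i ξ ∈ E) x)) ∧
  ∀ δ ∈ o₁, ¬ δ = ∅ → ∃ l ∈ o₂, (∀ a ∈ l, ∀ ξ ∈ o₂, ¬ SurjR (Fv ξ) a l) ∧
    ∃ e ∈ W, OtR e (ZFSet.sep (fun ξ => ∃ i ∈ δ, pair i ξ ∈ E) x) l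

set_option synthInstance.maxHeartbeats 400000 in
set_option synthInstance.maxSize 2000 in
instance Dfn.LChain_inst {W A : Set V} [Good W] [Par W A] {w o₁ o₂ : V} [Fact (w ∈ A)]
    [Fact (o₁ ∈ A)] [Fact (o₂ ∈ A)] {s t : Env → V} [hs : DfnF W A s] [ht : DfnF W A t] :
    Dfn W A (fun v => LChain W w o₁ o₂ (s v) (t v)) := by
  have h : Dfn W A (fun v => LChain W w o₁ o₂ (v 0) (v 1)) := by
    unfold LChain
    infer_instance
  exact h.comp2 hs ht

theorem lCard_iff_omega {n : ℕ} {δ : Ordinal.{0}}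
    (hδ : δ < Ordinal.omega ((n : Ordinal.{0}) + 1)) :
    LCard (oz δ) ↔ ∀ a ∈ oz δ, ∀ ξ ∈ oz (Ordinal.omega ((n : Ordinal.{0}) + 1)),
      ¬ SurjR (Fv ξ) a (oz δ) := by
  have hL : LCard (oz (Ordinal.omega ((n : Ordinal.{0}) + 1))) := by
    have := lCard_omega (n + 1)
    rwa [Nat.cast_succ] at this
  rw [lCard_iff_lt hL (fun a ha => ?_) hδ]
  swap
  · obtain ⟨γ, h1, h2, h3, -⟩ := jCl_cofinal n ha
    exact ⟨γ, h1, h2, h3⟩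
  constructor
  · intro h z hz w hw
    obtain ⟨a, ha, rfl⟩ := mem_oz.1 hz
    obtain ⟨ξ, hξ, rfl⟩ := mem_oz.1 hw
    rw [Fv_oz]
    exact h a ha ξ hξ
  · intro h a ha ξ hξ
    rw [← Fv_oz]
    exact h _ (oz_mem.2 ha) _ (oz_mem.2 hξ)

theorem G_le {H : Set Ordinal.{0}} {α : Ordinal.{0}} : G H α ≤ α := by
  induction α using WellFoundedLT.induction with
  | _ α ih =>
  refine le_of_forall_lt fun d hd => ?_
  obtain ⟨ξ, -, hlt, rfl⟩ := lt_G.1 hd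
  exact (ih ξ hlt).trans_lt hlt

theorem omega_zero_lt_one : Ordinal.omega (((0 : ℕ) : Ordinal.{0}) + 1) <
    Ordinal.omega (((1 : ℕ) : Ordinal.{0}) + 1) :=
  Ordinal.omega_lt_omega.2 (by simp)

theorem exists_lChain {c : Cardinal.{0}} [hc : RegC c]
    (hlt : Ordinal.omega (((1 : ℕ) : Ordinal.{0}) + 1) < c.ord) {α : Ordinal.{0}}
    (hα : α < Ordinal.omega (((1 : ℕ) : Ordinal.{0}) + 1)) (hω : Ordinal.omega0 < α)
    (h : SRPL (oz α)) : ∃ E ∈ HH c, LChain (HH c) (oz (Ordinal.omega ((0 : ℕ) : Ordinal.{0})))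
      (oz (Ordinal.omega (((0 : ℕ) : Ordinal.{0}) + 1)))
      (oz (Ordinal.omega (((1 : ℕ) : Ordinal.{0}) + 1))) (oz α) E := by
  obtain ⟨d, hd, hαd, h⟩ := (srpl_iff hω).1 h
  obtain ⟨g, hgα, hg⟩ : ∃ g : Ordinal.{0} → V, (∀ i, g i ∈ oz α) ∧
      ∀ ξ ∈ oz α, ∃ i < Ordinal.omega (((0 : ℕ) : Ordinal.{0}) + 1), g i = ξ := by
    have hle : (oz α).card ≤ (oz (Ordinal.omega (((0 : ℕ) : Ordinal.{0}) + 1))).card := by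
      rw [card_oz, card_oz, Ordinal.card_omega]
      simpa using lt_omega_succ.1 hα
    rw [← cardLE_iff] at hle
    obtain ⟨f⟩ := hle
    have h0 : oz 0 ∈ oz α := oz_mem.2 (Ordinal.omega0_pos.trans hω)
    refine ⟨fun i => if h : ∃ y : (oz α).toSet, (f y).1 = oz i then h.choose.1 else oz 0,
      fun i => ?_, fun ξ hξ => ?_⟩
    · dsimp only
      split_ifs with h
      · exact h.choose.2
      · exact h0
    · obtain ⟨i, hi, hi'⟩ := mem_oz.1 (f ⟨ξ, hξ⟩).2
      have hex : ∃ y : (oz α).toSet, (f y).1 = oz i := ⟨⟨ξ, hξ⟩, hi'⟩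
      refine ⟨i, hi, ?_⟩
      dsimp only
      rw [dif_pos hex]
      have := f.injective (Subtype.ext (hex.choose_spec.trans hi'.symm))
      exact congrArg Subtype.val this
  have hαH : oz α ∈ HH d := oz_mem_HH.2 hαd
  have hY := fun i => chain_spec (i := i) hαH fun j => HH_trans hαH (hgα j)
  set Y := chain (HH d) (oz α) g
  set w₁ := Ordinal.omega (((0 : ℕ) : Ordinal.{0}) + 1)
  have hw₁ : w₁ < c.ord := omega_zero_lt_one.trans hlt
  have hmono : ∀ i < w₁, ∀ j ≤ i, Y j ⊆ Y i := by
    intro i hi j hj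
    rcases hj.lt_or_eq with hj | rfl
    · exact fun y hy => (hY i hi).1 (Or.inl (Set.mem_iUnion.2 ⟨⟨j, hj⟩, hy⟩))
    · exact fun _ h => h
  have hαc := hα.trans hlt
  have hpm : ∀ i ξ, i < w₁ → ξ ∈ oz α → (pair (oz i) ξ ∈ ZFSet.sep
      (fun p => ∃ i ξ, ξ ∈ Y i ∧ p = pair (oz i) ξ) ((oz w₁).prod (oz α)) ↔ ξ ∈ Y i) := by
    intro i ξ hi hξ
    rw [ZFSet.mem_sep, ZFSet.pair_mem_prod]
    constructor
    · rintro ⟨-, j, ζ, h, hp⟩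
      rw [ZFSet.pair_inj] at hp
      rw [hp.2, oz_inj.1 hp.1]
      exact h
    · intro h
      exact ⟨⟨oz_mem.2 hi, hξ⟩, i, ξ, h, rfl⟩
  refine ⟨ZFSet.sep (fun p => ∃ i ξ, ξ ∈ Y i ∧ p = pair (oz i) ξ)
    ((oz w₁).prod (oz α)), HH_subset (Good.prod_mem (oz_mem_HH.2 hw₁)
      (oz_mem_HH.2 hαc)) ZFSet.sep_subset, fun ξ hξ => ?_, fun x hx => ?_, fun x hx hδ0 => ?_⟩
  · obtain ⟨i, hi, rfl⟩ := hg ξ hξ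
    exact ⟨oz i, oz_mem.2 hi, (hpm i _ hi (hgα i)).2 ((hY i hi).1 (Or.inr (Or.inr rfl)))⟩
  · obtain ⟨i, hi, rfl⟩ := mem_oz.1 hx
    rw [csIn_iff (oz_mem_HH.2 ?_) (HH_subset (oz_mem_HH.2 hαc) ZFSet.sep_subset), card_oz,
      Ordinal.card_omega]
    · refine (card_mono (y := Y i) fun z hz => ?_).trans ((hY i hi).2.2.trans (by simp))
      obtain ⟨h1, h2⟩ := ZFSet.mem_sep.1 hz
      exact (hpm i z hi h1).1 h2
    · exact (omega_lt_omega_succ 0).trans hw₁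
  · obtain ⟨δ, hδ, rfl⟩ := mem_oz.1 hx
    have hδ0' : 0 < δ := by
      rw [pos_iff_ne_zero]
      rintro rfl
      exact hδ0 oz_zero
    have := countable_Iio hδ
    have : Nonempty (Set.Iio δ) := ⟨⟨0, hδ0'⟩⟩
    obtain ⟨U, hU, hUc⟩ := exists_toSet_eq (s := ⋃ i : Set.Iio δ, (Y i).toSet)
      (Set.countable_iUnion fun i => countable_iff.2 (hY i (i.2.trans hδ)).2.2)
    have hU' : ∀ x, x ∈ U ↔ ∃ i : Set.Iio δ, x ∈ Y i := fun x => by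
      have := Set.ext_iff.1 hU x
      rwa [Set.mem_iUnion] at this
    have hUe : ElemSub U (HH d) := elemSub_of_directed (Y := fun i : Set.Iio δ => Y i)
      (fun i => (hY i (i.2.trans hδ)).2.1) (fun j i hj => hmono i (i.2.trans hδ) j hj) hU'
    have hαU : α ∈ Od U := (hU' _).2 ⟨⟨0, hδ0'⟩, (hY 0 (hδ0'.trans hδ)).1 (Or.inr (Or.inl rfl))⟩
    have hLU := h U hUe hUc hαU
    set A := ZFSet.sep (fun ξ => ∃ i ∈ oz δ, pair i ξ ∈ ZFSet.sep
      (fun p => ∃ i ξ, ξ ∈ Y i ∧ p = pair (oz i) ξ) ((oz w₁).prod (oz α))) (oz α)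
    have hA : ∀ z, z ∈ A ↔ z ∈ oz α ∧ z ∈ U := by
      intro z
      rw [ZFSet.mem_sep, hU']
      refine and_congr_right fun hz => ⟨?_, ?_⟩
      · rintro ⟨y, hy, h⟩
        obtain ⟨i, hi, rfl⟩ := mem_oz.1 hy
        exact ⟨⟨i, hi⟩, (hpm i z (hi.trans hδ) hz).1 h⟩
      · rintro ⟨i, h⟩
        exact ⟨oz i, oz_mem.2 i.2, (hpm i z (i.2.trans hδ) hz).2 h⟩
    have hGA : G (Od U) α = G (Od A) α := G_congr fun ξ hξ => by
      show oz ξ ∈ U ↔ oz ξ ∈ A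
      rw [hA, oz_mem]
      exact ⟨fun h => ⟨hξ, h⟩, fun h => h.2⟩
    have hGle : G (Od A) α ≤ α := G_le
    have hAα : A ⊆ oz α := fun z hz => ((hA z).1 hz).1
    refine ⟨oz (G (Od A) α), oz_mem.2 (hGle.trans_lt hα), ?_,
      exists_otR hAα hαc (hGle.trans_lt hαc)⟩
    rw [← lCard_iff_omega (hGle.trans_lt hα), ← hGA]
    exact hLU

theorem ElemSub.lCard_of_lChain {c : Cardinal.{0}} [hc : RegC c] {X : V} (hX : ElemSub X (HH c))
    (hXc : X.card ≤ Cardinal.aleph0) (h2 : Ordinal.omega (((1 : ℕ) : Ordinal.{0}) + 1) ∈ Od X)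
    {α : Ordinal.{0}} {E : V} (hα : α ∈ Od X) (hE : E ∈ X)
    (h : LChain (HH c) (oz (Ordinal.omega ((0 : ℕ) : Ordinal.{0})))
      (oz (Ordinal.omega (((0 : ℕ) : Ordinal.{0}) + 1)))
      (oz (Ordinal.omega (((1 : ℕ) : Ordinal.{0}) + 1))) (oz α) E) :
    LCard (oz (G (Od X) α)) := by
  have h1 : Ordinal.omega (((0 : ℕ) : Ordinal.{0}) + 1) ∈ Od X := by
    have := hX.omega_pred h2
    simpa using this
  have h0 := hX.omega_pred h1
  have h0X : oz (Ordinal.omega ((0 : ℕ) : Ordinal.{0})) ⊆ X := by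
    intro z hz
    obtain ⟨a, ha, rfl⟩ := mem_oz.1 hz
    rw [Nat.cast_zero, Ordinal.omega_zero] at ha
    obtain ⟨n, rfl⟩ := Ordinal.lt_omega0.1 ha
    rw [← natZ_eq]
    exact hX.natZ_mem n
  obtain ⟨ζ, hζ, hiff⟩ := hX.exists_segment h0X h1 (hXc.trans (by simp))
  have hζ0 : ζ ≠ 0 := by
    have h00 := (hiff 0 ((zero_le).trans_lt hζ)).1 (by
      have := hX.natZ_mem 0
      rw [natZ_eq] at this
      simpa [Od] using this)
    exact h00.ne'
  obtain ⟨l, hl, hΛ, e, -, ho⟩ := h.2.2 (oz ζ) (oz_mem.2 hζ) (by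
    rw [← oz_zero]
    exact fun h => hζ0 (oz_inj.1 h))
  obtain ⟨l, hl', rfl⟩ := mem_oz.1 hl
  have hLl := (lCard_iff_omega hl').2 hΛ
  rw [ho.eq_G (α := α) ZFSet.sep_subset] at hLl
  rw [G_congr fun ξ hξ => ?_]
  · exact hLl
  have := hX.par
  have : Fact (oz α ∈ X.toSet) := ⟨hα⟩
  have : Fact (E ∈ X.toSet) := ⟨hE⟩
  show oz ξ ∈ X ↔ oz ξ ∈ ZFSet.sep (fun ξ => ∃ i ∈ oz ζ, pair i ξ ∈ E) (oz α)
  rw [ZFSet.mem_sep]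
  constructor
  · intro hξX
    refine ⟨oz_mem.2 hξ, ?_⟩
    generalize hK : oz (Ordinal.omega (((0 : ℕ) : Ordinal.{0}) + 1)) = K at *
    have : Fact (K ∈ X.toSet) := ⟨by rw [← hK]; exact h1⟩
    have : Fact (oz ξ ∈ X.toSet) := ⟨hξX⟩
    obtain ⟨i, hi, hE⟩ := h.1 (oz ξ) (oz_mem.2 hξ)
    obtain ⟨i, hiX, hi, hE⟩ := hX.wit (P := fun i => i ∈ K ∧ pair i (oz ξ) ∈ E) inferInstance
      ⟨i, HH_trans (hX.1 (Fact.out : K ∈ X.toSet)) hi, hi, hE⟩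
    rw [← hK] at hi
    obtain ⟨j, hj, rfl⟩ := mem_oz.1 hi
    exact ⟨oz j, oz_mem.2 ((hiff j hj).1 hiX), hE⟩
  · rintro ⟨-, z, hz, hzE⟩
    obtain ⟨i, hi, rfl⟩ := mem_oz.1 hz
    have hiX := (hiff i (hi.trans hζ)).2 hi
    have : Fact (oz i ∈ X.toSet) := ⟨hiX⟩
    have hA : ZFSet.sep (fun ξ => pair (oz i) ξ ∈ E) (oz α) ∈ X := hX.term inferInstance
    refine hX.subset_of_card h0 hA ?_ h0X (ZFSet.mem_sep.2 ⟨oz_mem.2 hξ, hzE⟩)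
    exact (csIn_iff (hX.1 h0) (hX.1 hA)).1 (h.2.1 (oz i) (oz_mem.2 (hi.trans hζ)))

theorem SurjR.mono {f a b b' : V} (h : SurjR f a b) (hb : b' ⊆ b) : SurjR f a b' := by
  intro y hy
  obtain ⟨x, hx, h1, h2⟩ := h y (hb hy)
  exact ⟨x, hx, h1, fun y' hy' => h2 y' (hb hy')⟩

/-- If ordinals with the strong reflecting property are unbounded below `ω₂`, then `ω₂` has it. -/
theorem srpl_omega_two_of_unbounded (h : ∀ b < Ordinal.omega (((1 : ℕ) : Ordinal.{0}) + 1),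
    ∃ α < Ordinal.omega (((1 : ℕ) : Ordinal.{0}) + 1), b < α ∧ SRPL (oz α)) :
    SRPL (oz (Ordinal.omega (((1 : ℕ) : Ordinal.{0}) + 1))) := by
  have hω := omega0_lt_omega_one.trans (omega_lt_omega_succ 1)
  rw [srpl_iff hω]
  have hc : RegC (Cardinal.aleph (((2 : ℕ) : Ordinal.{0}) + 1)) := inferInstance
  have hlt : Ordinal.omega (((1 : ℕ) : Ordinal.{0}) + 1) <
      (Cardinal.aleph (((2 : ℕ) : Ordinal.{0}) + 1)).ord := by
    rw [Cardinal.ord_aleph, ← Nat.cast_succ]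
    exact omega_lt_omega_succ 2
  generalize Cardinal.aleph (((2 : ℕ) : Ordinal.{0}) + 1) = c at hc hlt
  refine ⟨c, hc, hlt, fun X hX hXc h2 => ?_⟩
  have h1 : Ordinal.omega (((0 : ℕ) : Ordinal.{0}) + 1) ∈ Od X := by
    have := hX.omega_pred h2
    simpa using this
  have h0 := hX.omega_pred h1
  have key : ∀ b < G (Od X) (Ordinal.omega (((1 : ℕ) : Ordinal.{0}) + 1)),
      ∃ l ≤ G (Od X) (Ordinal.omega (((1 : ℕ) : Ordinal.{0}) + 1)), b < l ∧ LCard (oz l) := by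
    intro b hb
    obtain ⟨β, hβ, hβ2, rfl⟩ := lt_G.1 hb
    obtain ⟨α, hα2, hα, hs⟩ := h (max β Ordinal.omega0) (max_lt hβ2 hω)
    obtain ⟨hβα, hωα⟩ := max_lt_iff.1 hα
    obtain ⟨E, hE, hC⟩ := exists_lChain hlt hα2 hωα hs
    have hCC : ∀ α E, LChain (HH c) (oz (Ordinal.omega ((0 : ℕ) : Ordinal.{0})))
      (oz (Ordinal.omega (((0 : ℕ) : Ordinal.{0}) + 1)))
      (oz (Ordinal.omega (((1 : ℕ) : Ordinal.{0}) + 1))) (oz α) E → α ∈ Od X → E ∈ X →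
      LCard (oz (G (Od X) α)) := fun α E h hα hE => hX.lCard_of_lChain hXc h2 hα hE h
    have hK2' := oz_mem.2 hα2
    have hK2m : ∀ a, oz a ∈ oz (Ordinal.omega (((1 : ℕ) : Ordinal.{0}) + 1)) →
        a < Ordinal.omega (((1 : ℕ) : Ordinal.{0}) + 1) := fun a => oz_mem.1
    have := hX.par
    have : Fact (oz β ∈ X.toSet) := ⟨hβ⟩
    obtain ⟨K0, hK0⟩ : ∃ K, K = oz (Ordinal.omega ((0 : ℕ) : Ordinal.{0})) := ⟨_, rfl⟩
    obtain ⟨K1, hK1⟩ : ∃ K, K = oz (Ordinal.omega (((0 : ℕ) : Ordinal.{0}) + 1)) := ⟨_, rfl⟩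
    obtain ⟨K2, hK2⟩ : ∃ K, K = oz (Ordinal.omega (((1 : ℕ) : Ordinal.{0}) + 1)) := ⟨_, rfl⟩
    have : Fact (K0 ∈ X.toSet) := ⟨hK0 ▸ h0⟩
    have : Fact (K1 ∈ X.toSet) := ⟨hK1 ▸ h1⟩
    have : Fact (K2 ∈ X.toSet) := ⟨hK2 ▸ h2⟩
    rw [← hK0, ← hK1, ← hK2] at hC hCC
    rw [← hK2] at hK2' hK2m
    obtain ⟨α', hα'X, hβα', hα'2, hex⟩ := hX.ord_wit (P := fun x => oz β ∈ x ∧ x ∈ K2 ∧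
      ∃ E ∈ HH c, LChain (HH c) K0 K1 K2 x E) inferInstance
      ⟨α, hα2.trans hlt, oz_mem.2 hβα, hK2', E, hE, hC⟩
    have : Fact (oz α' ∈ X.toSet) := ⟨hα'X⟩
    obtain ⟨E', hE'X, hC'⟩ := hX.wit (P := fun E => LChain (HH c) K0 K1 K2 (oz α') E)
      inferInstance hex
    exact ⟨_, (G_lt (hK2m _ hα'2) hα'X).le, G_lt (oz_mem.1 hβα') hβ, hCC α' E' hC' hα'X hE'X⟩
  rw [lCard_iff]
  intro a ha ξ hs
  obtain ⟨l, hl, hal, hL⟩ := key a ha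
  refine lCard_iff.1 hL a hal ξ (hs.mono fun z hz => ?_)
  obtain ⟨d, hd, rfl⟩ := mem_oz.1 hz
  exact oz_mem.2 (hd.trans_le hl)

theorem aleph_one_eq : Aleph 1 = oz (Ordinal.omega ((1 : ℕ) : Ordinal.{0})) := aleph_eq 1

theorem aleph_two_eq : Aleph 2 = oz (Ordinal.omega (((1 : ℕ) : Ordinal.{0}) + 1)) :=
  aleph_succ_eq 1

/-- Every L-cardinal is a von Neumann ordinal. -/
theorem LCard.exists_oz {x : V} (h : LCard x) : ∃ γ, x = oz γ := isOrd_iff.1 h.1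

/-! ## The statement -/

/-- Proposition 2.13: characterizations of `SRP^L(ω₂)`. -/
theorem statement6 :
    List.TFAE
      [SRPL (Aleph 2),
       (LCard (Aleph 2) ∧ ∀ β, β ∈ Aleph 2 → ∃ δ, δ ∈ Aleph 2 ∧ β ∈ δ ∧ LCard δ) ∧
         ∀ γ, LCard γ → (Aleph 1 ∈ γ ∨ Aleph 1 = γ) → γ ∈ Aleph 2 → SRPL γ,
       ∀ β, β ∈ Aleph 2 → ∃ α, α ∈ Aleph 2 ∧ β ∈ α ∧ LCard α ∧ SRPL α] := by
  rw [aleph_one_eq, aleph_two_eq]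
  tfae_have 1 → 2 := by
    intro h
    refine ⟨⟨?_, fun β hβ => ?_⟩, fun γ hγ h1 h2 => ?_⟩
    · rw [← aleph_two_eq, aleph_eq]
      exact lCard_omega 2
    · obtain ⟨b, hb, rfl⟩ := mem_oz.1 hβ
      obtain ⟨ζ, h1, h2, h3⟩ := exists_lCard_of_srpl h hb
      exact ⟨oz ζ, oz_mem.2 h1, oz_mem.2 h2, h3⟩
    · obtain ⟨g, rfl⟩ := hγ.exists_oz
      refine srpl_of_omega_two h hγ ?_ (oz_mem.1 h2)
      exact h1.elim (fun h => (oz_mem.1 h).le) fun h => (oz_inj.1 h).le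
  tfae_have 2 → 3 := by
    rintro ⟨⟨-, h⟩, h'⟩ β hβ
    obtain ⟨b, hb, rfl⟩ := mem_oz.1 hβ
    obtain ⟨δ, hδ, hlt, hL⟩ := h _ (oz_mem.2 (max_lt hb (omega_lt_omega_succ 1)))
    obtain ⟨d, hd, rfl⟩ := mem_oz.1 hδ
    obtain ⟨h1, h2⟩ := max_lt_iff.1 (oz_mem.1 hlt)
    exact ⟨oz d, hδ, oz_mem.2 h1, hL, h' _ hL (Or.inl (oz_mem.2 h2)) hδ⟩
  tfae_have 3 → 1 := by
    intro h
    refine srpl_omega_two_of_unbounded fun b hb => ?_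
    obtain ⟨α, hα, hlt, -, hs⟩ := h _ (oz_mem.2 hb)
    obtain ⟨a, ha, rfl⟩ := mem_oz.1 hα
    exact ⟨a, ha, oz_mem.1 hlt, hs⟩
  tfae_finish

end SRPPaper
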